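/- MPN¬ Coherence: the functor G from MPN¬ to Br is faithful; that is, for all arrow terms f, g : A ⊢ B of MPN¬, if Gf = Gg in Br then f = g in MPN¬. -/

import Mathlib

/-! ### The category Br of Brauerian split equivalences of finite ordinals

An arrow `m ⊢ n` of `Br` is represented as a relation on `ℕ ⊕ ℕ`, where
`Sum.inl i` (with `i < m`) is the source copy `i_s` and `Sum.inr j`
(with `j < n`) is the target copy `j_t`. -/

abbrev GRel : Type := (ℕ ⊕ ℕ) → (ℕ ⊕ ℕ) → Prop

/-- The identity arrow of `Br` on `n`: transversals `{i_s, i_t}` for `i < n`. -/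
def gId (n : ℕ) : GRel := fun u v =>
  ∃ i, i < n ∧ (u = Sum.inl i ∨ u = Sum.inr i) ∧ (v = Sum.inl i ∨ v = Sum.inr i)

/-- The Brauerian split equivalence whose transversals are `{i_s, (φ i)_t}` for `i < m`. -/
def gFun (m : ℕ) (φ : ℕ → ℕ) : GRel := fun u v =>
  ∃ i, i < m ∧ (u = Sum.inl i ∨ u = Sum.inr (φ i)) ∧ (v = Sum.inl i ∨ v = Sum.inr (φ i))

/-- The block transposition exchanging the first `a` and the last `b` elements. -/
def gSwap (a b : ℕ) : GRel :=
  gFun (a + b) (fun i => if i < a then i + b else i - a)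

/-- `G Δ̂∧_{B,A}` with `a = GA`, `b = GB`: identity transversals on the stem `A`
together with caps joining the two copies of each letter occurrence of `B` in
the crown `¬B ∨ B` of the target. -/
def gDelta (a b : ℕ) : GRel := fun u v =>
  (∃ i, i < a ∧ (u = Sum.inl i ∨ u = Sum.inr i) ∧ (v = Sum.inl i ∨ v = Sum.inr i)) ∨
  (∃ j, j < b ∧ (u = Sum.inr (a + j) ∨ u = Sum.inr (a + b + j)) ∧
                (v = Sum.inr (a + j) ∨ v = Sum.inr (a + b + j)))

/-- `G Σ̂∨_{B,A}` with `a = GA`, `b = GB`: identity transversals on the stem `A`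
together with cups joining the two copies of each letter occurrence of `B` in
the crown `B ∧ ¬B` of the source. -/
def gSigma (a b : ℕ) : GRel := fun u v =>
  (∃ i, i < a ∧ (u = Sum.inl (2*b + i) ∨ u = Sum.inr i) ∧
                (v = Sum.inl (2*b + i) ∨ v = Sum.inr i)) ∨
  (∃ j, j < b ∧ (u = Sum.inl j ∨ u = Sum.inl (b + j)) ∧
                (v = Sum.inl j ∨ v = Sum.inl (b + j)))

/-- Composition `P ∗ R` in `Br`: glue along the middle copy and take the
transitive closure, restricted to the outer copies. -/
def gComp (Pr R : GRel) : GRel := fun u v =>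
  Relation.TransGen
    (fun x y : ℕ ⊕ ℕ ⊕ ℕ =>
      (∃ x' y', Sum.map id Sum.inl x' = x ∧ Sum.map id Sum.inl y' = y ∧ R x' y') ∨
      (∃ x' y', Sum.inr x' = x ∧ Sum.inr y' = y ∧ Pr x' y'))
    (Sum.map id Sum.inr u) (Sum.map id Sum.inr v)

/-- Shift a split relation by `a` on the source side and by `d` on the target side. -/
def gShift (a d : ℕ) (R : GRel) : GRel := fun u v =>
  ∃ u' v', R u' v' ∧ u = Sum.map (· + a) (· + d) u' ∧ v = Sum.map (· + a) (· + d) v'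

/-- Disjoint union of split relations: `G(f ξ g) = Gf ∪ Gg_{+GD}^{+GA}`. -/
def gPar (a d : ℕ) (R S : GRel) : GRel := fun u v => R u v ∨ gShift a d S u v
/-! ### The language L¬,∧,∨ generated from the set `P` of letters -/

inductive Form (P : Type) : Type
  | letter : P → Form P
  | neg : Form P → Form P
  | conj : Form P → Form P → Form P
  | disj : Form P → Form P → Form P

infixr:70 " ⋏ " => Form.conj
infixr:66 " ⋎ " => Form.disj
prefix:77 "∼" => Form.neg

/-- The number of occurrences of letters in a formula (the object map of `G`). -/
def Form.size {P : Type} : Form P → ℕ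
  | .letter _ => 1
  | .neg A => A.size
  | .conj A B => A.size + B.size
  | .disj A B => A.size + B.size
/-! ### Arrow terms of the free mix-proof-net category MPN¬ -/

inductive Term (P : Type) : Form P → Form P → Type
  | id (A : Form P) : Term P A A
  | comp {A B C : Form P} : Term P B C → Term P A B → Term P A C
  | conj {A B D E : Form P} : Term P A D → Term P B E → Term P (A ⋏ B) (D ⋏ E)
  | disj {A B D E : Form P} : Term P A D → Term P B E → Term P (A ⋎ B) (D ⋎ E)
  | bConjTo (A B C : Form P) : Term P (A ⋏ (B ⋏ C)) ((A ⋏ B) ⋏ C)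
  | bConjFrom (A B C : Form P) : Term P ((A ⋏ B) ⋏ C) (A ⋏ (B ⋏ C))
  | bDisjTo (A B C : Form P) : Term P (A ⋎ (B ⋎ C)) ((A ⋎ B) ⋎ C)
  | bDisjFrom (A B C : Form P) : Term P ((A ⋎ B) ⋎ C) (A ⋎ (B ⋎ C))
  | cConj (A B : Form P) : Term P (A ⋏ B) (B ⋏ A)
  | cDisj (A B : Form P) : Term P (B ⋎ A) (A ⋎ B)
  | d (A B C : Form P) : Term P (A ⋏ (B ⋎ C)) ((A ⋏ B) ⋎ C)
  | delta (B A : Form P) : Term P A (A ⋏ (∼B ⋎ B))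
  | sigma (B A : Form P) : Term P ((B ⋏ ∼B) ⋎ A) A
  | mix (A B : Form P) : Term P (A ⋏ B) (A ⋎ B)

infixr:80 " ⬝ " => Term.comp
infixr:70 " ⊼ " => Term.conj
infixr:66 " ⊽ " => Term.disj

/-- The arrow `d^R_{C,B,A} : (C∨B)∧A ⊢ C∨(B∧A)`. -/
def dR {P : Type} (C B A : Form P) : Term P ((C ⋎ B) ⋏ A) (C ⋎ (B ⋏ A)) :=
  Term.cDisj C (B ⋏ A) ⬝ ((Term.cConj A B ⊽ Term.id C) ⬝
    (Term.d A B C ⬝ ((Term.id A ⊼ Term.cDisj B C) ⬝ Term.cConj (C ⋎ B) A)))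

/-- `Σ̂∧_{B,A} = ĉ∧ ∘ Δ̂∧_{B,A} : A ⊢ (¬B∨B)∧A`. -/
def sigmaConj {P : Type} (B A : Form P) : Term P A ((∼B ⋎ B) ⋏ A) :=
  Term.cConj A (∼B ⋎ B) ⬝ Term.delta B A

/-- `Δ̂∨_{B,A} = Σ̂∨_{B,A} ∘ ĉ∨ : A∨(B∧¬B) ⊢ A`. -/
def deltaDisj {P : Type} (B A : Form P) : Term P (A ⋎ (B ⋏ ∼B)) A :=
  Term.sigma B A ⬝ Term.cDisj (B ⋏ ∼B) A

/-- `Δ̂∧′_{B,A} = (1_A ∧ ĉ∨) ∘ Δ̂∧_{B,A} : A ⊢ A∧(B∨¬B)`. -/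
def delta' {P : Type} (B A : Form P) : Term P A (A ⋏ (B ⋎ ∼B)) :=
  (Term.id A ⊼ Term.cDisj B (∼B)) ⬝ Term.delta B A

/-- `Σ̂∨′_{B,A} = Σ̂∨_{B,A} ∘ (ĉ∧ ∨ 1_A) : (¬B∧B)∨A ⊢ A`. -/
def sigma' {P : Type} (B A : Form P) : Term P ((∼B ⋏ B) ⋎ A) A :=
  Term.sigma B A ⬝ (Term.cConj (∼B) B ⊽ Term.id A)
/-! ### The equations of DS, imposed on arrow terms -/

inductive Eqv {P : Type} : ∀ {A B : Form P}, Term P A B → Term P A B → Prop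
  -- equivalence and congruence
  | refl {A B : Form P} (f : Term P A B) : Eqv f f
  | symm {A B : Form P} {f g : Term P A B} : Eqv f g → Eqv g f
  | trans {A B : Form P} {f g h : Term P A B} : Eqv f g → Eqv g h → Eqv f h
  | congComp {A B C : Form P} {g g' : Term P B C} {f f' : Term P A B} :
      Eqv g g' → Eqv f f' → Eqv (g ⬝ f) (g' ⬝ f')
  | congConj {A B D E : Form P} {f f' : Term P A D} {g g' : Term P B E} :
      Eqv f f' → Eqv g g' → Eqv (f ⊼ g) (f' ⊼ g')
  | congDisj {A B D E : Form P} {f f' : Term P A D} {g g' : Term P B E} :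
      Eqv f f' → Eqv g g' → Eqv (f ⊽ g) (f' ⊽ g')
  -- (cat 1), (cat 2)
  | catIdR {A B : Form P} (f : Term P A B) : Eqv (f ⬝ Term.id A) f
  | catIdL {A B : Form P} (f : Term P A B) : Eqv (Term.id B ⬝ f) f
  | catAssoc {A B C D : Form P} (f : Term P A B) (g : Term P B C) (h : Term P C D) :
      Eqv (h ⬝ (g ⬝ f)) ((h ⬝ g) ⬝ f)
  -- bifunctorial equations (ξ 1), (ξ 2)
  | conjOne (A B : Form P) : Eqv (Term.id A ⊼ Term.id B) (Term.id (A ⋏ B))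
  | disjOne (A B : Form P) : Eqv (Term.id A ⊽ Term.id B) (Term.id (A ⋎ B))
  | conjTwo {A₁ B₁ C₁ A₂ B₂ C₂ : Form P} (g₁ : Term P B₁ C₁) (f₁ : Term P A₁ B₁)
      (g₂ : Term P B₂ C₂) (f₂ : Term P A₂ B₂) :
      Eqv ((g₁ ⬝ f₁) ⊼ (g₂ ⬝ f₂)) ((g₁ ⊼ g₂) ⬝ (f₁ ⊼ f₂))
  | disjTwo {A₁ B₁ C₁ A₂ B₂ C₂ : Form P} (g₁ : Term P B₁ C₁) (f₁ : Term P A₁ B₁)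
      (g₂ : Term P B₂ C₂) (f₂ : Term P A₂ B₂) :
      Eqv ((g₁ ⬝ f₁) ⊽ (g₂ ⬝ f₂)) ((g₁ ⊽ g₂) ⬝ (f₁ ⊽ f₂))
  -- naturality equations
  | bConjNat {A B C D E F : Form P} (f : Term P A D) (g : Term P B E) (h : Term P C F) :
      Eqv (((f ⊼ g) ⊼ h) ⬝ Term.bConjTo A B C) (Term.bConjTo D E F ⬝ (f ⊼ (g ⊼ h)))
  | bDisjNat {A B C D E F : Form P} (f : Term P A D) (g : Term P B E) (h : Term P C F) :
      Eqv (((f ⊽ g) ⊽ h) ⬝ Term.bDisjTo A B C) (Term.bDisjTo D E F ⬝ (f ⊽ (g ⊽ h)))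
  | cConjNat {A B D E : Form P} (f : Term P A D) (g : Term P B E) :
      Eqv ((g ⊼ f) ⬝ Term.cConj A B) (Term.cConj D E ⬝ (f ⊼ g))
  | cDisjNat {A B D E : Form P} (f : Term P A D) (g : Term P B E) :
      Eqv ((g ⊽ f) ⬝ Term.cDisj B A) (Term.cDisj E D ⬝ (f ⊽ g))
  | dNat {A B C D E F : Form P} (f : Term P A D) (g : Term P B E) (h : Term P C F) :
      Eqv (((f ⊼ g) ⊽ h) ⬝ Term.d A B C) (Term.d D E F ⬝ (f ⊼ (g ⊽ h)))
  -- (b̂ξ b̂ξ)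
  | bConjIso₁ (A B C : Form P) :
      Eqv (Term.bConjFrom A B C ⬝ Term.bConjTo A B C) (Term.id (A ⋏ (B ⋏ C)))
  | bConjIso₂ (A B C : Form P) :
      Eqv (Term.bConjTo A B C ⬝ Term.bConjFrom A B C) (Term.id ((A ⋏ B) ⋏ C))
  | bDisjIso₁ (A B C : Form P) :
      Eqv (Term.bDisjFrom A B C ⬝ Term.bDisjTo A B C) (Term.id (A ⋎ (B ⋎ C)))
  | bDisjIso₂ (A B C : Form P) :
      Eqv (Term.bDisjTo A B C ⬝ Term.bDisjFrom A B C) (Term.id ((A ⋎ B) ⋎ C))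
  -- (b̂ξ 5)
  | bConjPent (A B C D : Form P) :
      Eqv (Term.bConjFrom A B (C ⋏ D) ⬝ Term.bConjFrom (A ⋏ B) C D)
        ((Term.id A ⊼ Term.bConjFrom B C D) ⬝
          (Term.bConjFrom A (B ⋏ C) D ⬝ (Term.bConjFrom A B C ⊼ Term.id D)))
  | bDisjPent (A B C D : Form P) :
      Eqv (Term.bDisjFrom A B (C ⋎ D) ⬝ Term.bDisjFrom (A ⋎ B) C D)
        ((Term.id A ⊽ Term.bDisjFrom B C D) ⬝
          (Term.bDisjFrom A (B ⋎ C) D ⬝ (Term.bDisjFrom A B C ⊽ Term.id D)))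
  -- (ĉ∧ ĉ∧), (ĉ∨ ĉ∨)
  | cConjIso (A B : Form P) : Eqv (Term.cConj B A ⬝ Term.cConj A B) (Term.id (A ⋏ B))
  | cDisjIso (A B : Form P) : Eqv (Term.cDisj A B ⬝ Term.cDisj B A) (Term.id (A ⋎ B))
  -- (b̂∧ ĉ∧), (b̂∨ ĉ∨)
  | bcConj (A B C : Form P) :
      Eqv ((Term.id B ⊼ Term.cConj C A) ⬝ (Term.bConjFrom B C A ⬝
            (Term.cConj A (B ⋏ C) ⬝ (Term.bConjFrom A B C ⬝ (Term.cConj B A ⊼ Term.id C)))))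
        (Term.bConjFrom B A C)
  | bcDisj (A B C : Form P) :
      Eqv ((Term.id B ⊽ Term.cDisj A C) ⬝ (Term.bDisjFrom B C A ⬝
            (Term.cDisj (B ⋎ C) A ⬝ (Term.bDisjFrom A B C ⬝ (Term.cDisj A B ⊽ Term.id C)))))
        (Term.bDisjFrom B A C)
  -- (d ∧), (d ∨)
  | dConj (A B C D : Form P) :
      Eqv ((Term.bConjFrom A B C ⊽ Term.id D) ⬝ Term.d (A ⋏ B) C D)
        (Term.d A (B ⋏ C) D ⬝ ((Term.id A ⊼ Term.d B C D) ⬝ Term.bConjFrom A B (C ⋎ D)))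
  | dDisj (D C B A : Form P) :
      Eqv (Term.d D C (B ⋎ A) ⬝ (Term.id D ⊼ Term.bDisjFrom C B A))
        (Term.bDisjFrom (D ⋏ C) B A ⬝ ((Term.d D C B ⊽ Term.id A) ⬝ Term.d D (C ⋎ B) A))
  -- (d b̂∧), (d b̂∨)
  | dBConj (A B C D : Form P) :
      Eqv (dR (A ⋏ B) C D ⬝ (Term.d A B C ⊼ Term.id D))
        (Term.d A B (C ⋏ D) ⬝ ((Term.id A ⊼ dR B C D) ⬝ Term.bConjFrom A (B ⋎ C) D))
  | dBDisj (D C B A : Form P) :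
      Eqv ((Term.id D ⊽ Term.d C B A) ⬝ dR D C (B ⋎ A))
        (Term.bDisjFrom D (C ⋏ B) A ⬝ ((dR D C B ⊽ Term.id A) ⬝ Term.d (D ⋎ C) B A))
  -- (Δ̂∧ nat)
  | deltaNat {A D : Form P} (B : Form P) (f : Term P A D) :
      Eqv ((f ⊼ Term.id (∼B ⋎ B)) ⬝ Term.delta B A) (Term.delta B D ⬝ f)
  -- (Σ̂∨ nat)
  | sigmaNat {A D : Form P} (B : Form P) (f : Term P A D) :
      Eqv (f ⬝ Term.sigma B A) (Term.sigma B D ⬝ (Term.id (B ⋏ ∼B) ⊽ f))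
  -- (b̂∧ Δ̂∧)
  | bDelta (A B C : Form P) :
      Eqv (Term.bConjFrom A B (∼C ⋎ C) ⬝ Term.delta C (A ⋏ B)) (Term.id A ⊼ Term.delta C B)
  -- (b̂∨ Σ̂∨)
  | bSigma (C B A : Form P) :
      Eqv (Term.sigma C (B ⋎ A) ⬝ Term.bDisjFrom (C ⋏ ∼C) B A) (Term.sigma C B ⊽ Term.id A)
  -- (d Σ̂∧)
  | dSigmaConj (A B C : Form P) :
      Eqv (Term.d (∼A ⋎ A) B C ⬝ sigmaConj A (B ⋎ C)) (sigmaConj A B ⊽ Term.id C)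
  -- (d Δ̂∨)
  | dDeltaDisj (A C B : Form P) :
      Eqv (deltaDisj A (C ⋏ B) ⬝ Term.d C B (A ⋏ ∼A)) (Term.id C ⊼ deltaDisj A B)
  -- (Σ̂∨ Δ̂∧)
  | sigmaDelta (A : Form P) :
      Eqv (Term.sigma A A ⬝ (Term.d A (∼A) A ⬝ Term.delta A A)) (Term.id A)
  -- (Σ̂∨′ Δ̂∧′)
  | sigmaDelta' (A : Form P) :
      Eqv (sigma' A (∼A) ⬝ (Term.d (∼A) A (∼A) ⬝ delta' A (∼A))) (Term.id (∼A))
  -- (m nat)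
  | mixNat {A B D E : Form P} (f : Term P A D) (g : Term P B E) :
      Eqv ((f ⊽ g) ⬝ Term.mix A B) (Term.mix D E ⬝ (f ⊼ g))
  -- (b̂∧ m)
  | mixBConj (A B C : Form P) :
      Eqv (Term.mix (A ⋏ B) C ⬝ Term.bConjTo A B C) (Term.d A B C ⬝ (Term.id A ⊼ Term.mix B C))
  -- (b̂∨ m)
  | mixBDisj (C B A : Form P) :
      Eqv (Term.bDisjTo C B A ⬝ Term.mix C (B ⋎ A)) ((Term.mix C B ⊽ Term.id A) ⬝ Term.d C B A)
  -- (c m)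
  | mixC (A B : Form P) :
      Eqv (Term.mix B A ⬝ Term.cConj A B) (Term.cDisj B A ⬝ Term.mix A B)
/-- The functor `G` from DS to Br on arrow terms. -/
def Term.G {P : Type} : ∀ {A B : Form P}, Term P A B → GRel
  | _, _, .id A => gId A.size
  | _, _, .comp g f => gComp (Term.G g) (Term.G f)
  | _, _, @Term.conj _ A _ D _ f g => gPar A.size D.size (Term.G f) (Term.G g)
  | _, _, @Term.disj _ A _ D _ f g => gPar A.size D.size (Term.G f) (Term.G g)
  | _, _, .bConjTo A B C => gId (A.size + (B.size + C.size))
  | _, _, .bConjFrom A B C => gId (A.size + B.size + C.size)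
  | _, _, .bDisjTo A B C => gId (A.size + (B.size + C.size))
  | _, _, .bDisjFrom A B C => gId (A.size + B.size + C.size)
  | _, _, .cConj A B => gSwap A.size B.size
  | _, _, .cDisj A B => gSwap B.size A.size
  | _, _, .d A B C => gId (A.size + (B.size + C.size))
  | _, _, .delta B A => gDelta A.size B.size
  | _, _, .sigma B A => gSigma A.size B.size
  | _, _, .mix A B => gId (A.size + B.size)


namespace MPN
open CategoryTheory
variable {P : Type}

/-! ### The category of arrow terms modulo equations -/

def Hm (A B : Form P) : Type := Quot (@Eqv P A B)

def mkH {A B : Form P} (f : Term P A B) : Hm A B := Quot.mk _ f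

theorem mkH_eq {A B : Form P} {f g : Term P A B} : mkH f = mkH g ↔ Eqv f g := by
  constructor
  · intro h
    have := Quot.eqvGen_exact h
    clear h
    induction this with
    | rel _ _ h => exact h
    | refl => exact .refl _
    | symm _ _ _ ih => exact .symm ih
    | trans _ _ _ _ _ h1 h2 => exact .trans h1 h2
  · exact fun h => Quot.sound h

def cmp {A B C : Form P} (f : Hm A B) (g : Hm B C) : Hm A C :=
  Quot.map₂ (fun f g => Term.comp g f) (fun _ _ _ h => .congComp h (.refl _))
    (fun _ _ _ h => .congComp (.refl _) h) f g

instance instCat : Category (Form P) where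
  Hom A B := Hm A B
  id A := mkH (.id A)
  comp f g := cmp f g
  id_comp f := by
    induction f using Quot.ind; exact Quot.sound (.catIdR _)
  comp_id f := by
    induction f using Quot.ind; exact Quot.sound (.catIdL _)
  assoc f g h := by
    induction f using Quot.ind; induction g using Quot.ind; induction h using Quot.ind
    exact Quot.sound (.catAssoc _ _ _)

def tm {A B : Form P} (f : Term P A B) : A ⟶ B := mkH f

theorem tm_eq {A B : Form P} {f g : Term P A B} : tm f = tm g ↔ Eqv f g := mkH_eq

theorem tm_surj {A B : Form P} (f : A ⟶ B) : ∃ t, f = tm t := by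
  induction f using Quot.ind; exact ⟨_, rfl⟩

def cj {A B D E : Form P} (f : A ⟶ D) (g : B ⟶ E) : A ⋏ B ⟶ D ⋏ E :=
  (Quot.map₂ (fun f g => Term.conj f g) (fun _ _ _ h => .congConj (.refl _) h)
    (fun _ _ _ h => .congConj h (.refl _)) f g : Hm _ _)
def dj {A B D E : Form P} (f : A ⟶ D) (g : B ⟶ E) : A ⋎ B ⟶ D ⋎ E :=
  (Quot.map₂ (fun f g => Term.disj f g) (fun _ _ _ h => .congDisj (.refl _) h)
    (fun _ _ _ h => .congDisj h (.refl _)) f g : Hm _ _)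

def bC (A B C : Form P) : A ⋏ B ⋏ C ⟶ (A ⋏ B) ⋏ C := tm (.bConjTo A B C)
def bC' (A B C : Form P) : (A ⋏ B) ⋏ C ⟶ A ⋏ B ⋏ C := tm (.bConjFrom A B C)
def bD (A B C : Form P) : A ⋎ B ⋎ C ⟶ (A ⋎ B) ⋎ C := tm (.bDisjTo A B C)
def bD' (A B C : Form P) : (A ⋎ B) ⋎ C ⟶ A ⋎ B ⋎ C := tm (.bDisjFrom A B C)
def cC (A B : Form P) : A ⋏ B ⟶ B ⋏ A := tm (.cConj A B)
/-- note the order: `cD A B : A ⋎ B ⟶ B ⋎ A` -/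
def cD (A B : Form P) : A ⋎ B ⟶ B ⋎ A := tm (.cDisj B A)
def dd (A B C : Form P) : A ⋏ (B ⋎ C) ⟶ (A ⋏ B) ⋎ C := tm (.d A B C)
def del (B A : Form P) : A ⟶ A ⋏ (∼B ⋎ B) := tm (.delta B A)
def sig (B A : Form P) : (B ⋏ ∼B) ⋎ A ⟶ A := tm (.sigma B A)
def mx (A B : Form P) : A ⋏ B ⟶ A ⋎ B := tm (.mix A B)

theorem tm_id (A : Form P) : tm (.id A) = 𝟙 A := rfl
theorem tm_comp {A B C : Form P} (g : Term P B C) (f : Term P A B) :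
    tm (g ⬝ f) = tm f ≫ tm g := rfl
theorem tm_conj {A B D E : Form P} (f : Term P A D) (g : Term P B E) :
    tm (f ⊼ g) = cj (tm f) (tm g) := rfl
theorem tm_disj {A B D E : Form P} (f : Term P A D) (g : Term P B E) :
    tm (f ⊽ g) = dj (tm f) (tm g) := rfl

section
variable {A B C D E F : Form P} {A₁ B₁ C₁ A₂ B₂ C₂ : Form P}

@[simp] theorem cj_id (A B : Form P) : cj (𝟙 A) (𝟙 B) = 𝟙 _ := tm_eq.2 (.conjOne A B)
@[simp] theorem dj_id (A B : Form P) : dj (𝟙 A) (𝟙 B) = 𝟙 _ := tm_eq.2 (.disjOne A B)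
theorem cj_comp (f₁ : A₁ ⟶ B₁) (g₁ : B₁ ⟶ C₁) (f₂ : A₂ ⟶ B₂) (g₂ : B₂ ⟶ C₂) :
    cj f₁ f₂ ≫ cj g₁ g₂ = cj (f₁ ≫ g₁) (f₂ ≫ g₂) := by
  induction f₁ using Quot.ind; induction g₁ using Quot.ind
  induction f₂ using Quot.ind; induction g₂ using Quot.ind
  exact (tm_eq.2 (.conjTwo _ _ _ _)).symm
theorem dj_comp (f₁ : A₁ ⟶ B₁) (g₁ : B₁ ⟶ C₁) (f₂ : A₂ ⟶ B₂) (g₂ : B₂ ⟶ C₂) :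
    dj f₁ f₂ ≫ dj g₁ g₂ = dj (f₁ ≫ g₁) (f₂ ≫ g₂) := by
  induction f₁ using Quot.ind; induction g₁ using Quot.ind
  induction f₂ using Quot.ind; induction g₂ using Quot.ind
  exact (tm_eq.2 (.disjTwo _ _ _ _)).symm
theorem bC_nat (f : A ⟶ D) (g : B ⟶ E) (h : C ⟶ F) :
    bC A B C ≫ cj (cj f g) h = cj f (cj g h) ≫ bC D E F := by
  induction f using Quot.ind; induction g using Quot.ind; induction h using Quot.ind
  exact tm_eq.2 (.bConjNat _ _ _)
theorem bD_nat (f : A ⟶ D) (g : B ⟶ E) (h : C ⟶ F) :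
    bD A B C ≫ dj (dj f g) h = dj f (dj g h) ≫ bD D E F := by
  induction f using Quot.ind; induction g using Quot.ind; induction h using Quot.ind
  exact tm_eq.2 (.bDisjNat _ _ _)
theorem cC_nat (f : A ⟶ D) (g : B ⟶ E) : cC A B ≫ cj g f = cj f g ≫ cC D E := by
  induction f using Quot.ind; induction g using Quot.ind
  exact tm_eq.2 (.cConjNat _ _)
theorem cD_nat (f : A ⟶ D) (g : B ⟶ E) : cD A B ≫ dj g f = dj f g ≫ cD D E := by
  induction f using Quot.ind; induction g using Quot.ind
  exact tm_eq.2 (.cDisjNat _ _)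
theorem dd_nat (f : A ⟶ D) (g : B ⟶ E) (h : C ⟶ F) :
    dd A B C ≫ dj (cj f g) h = cj f (dj g h) ≫ dd D E F := by
  induction f using Quot.ind; induction g using Quot.ind; induction h using Quot.ind
  exact tm_eq.2 (.dNat _ _ _)
theorem mx_nat (f : A ⟶ D) (g : B ⟶ E) : mx A B ≫ dj f g = cj f g ≫ mx D E := by
  induction f using Quot.ind; induction g using Quot.ind
  exact tm_eq.2 (.mixNat _ _)
theorem del_nat (f : A ⟶ D) : del B A ≫ cj f (𝟙 _) = f ≫ del B D := by
  induction f using Quot.ind; exact tm_eq.2 (.deltaNat _ _)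
theorem sig_nat (f : A ⟶ D) : dj (𝟙 _) f ≫ sig B D = sig B A ≫ f := by
  induction f using Quot.ind; exact (tm_eq.2 (.sigmaNat _ _)).symm
@[simp] theorem bC_bC' (A B C : Form P) : bC A B C ≫ bC' A B C = 𝟙 _ := tm_eq.2 (.bConjIso₁ _ _ _)
@[simp] theorem bC'_bC (A B C : Form P) : bC' A B C ≫ bC A B C = 𝟙 _ := tm_eq.2 (.bConjIso₂ _ _ _)
@[simp] theorem bD_bD' (A B C : Form P) : bD A B C ≫ bD' A B C = 𝟙 _ := tm_eq.2 (.bDisjIso₁ _ _ _)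
@[simp] theorem bD'_bD (A B C : Form P) : bD' A B C ≫ bD A B C = 𝟙 _ := tm_eq.2 (.bDisjIso₂ _ _ _)
@[simp] theorem cC_cC (A B : Form P) : cC A B ≫ cC B A = 𝟙 _ := tm_eq.2 (.cConjIso _ _)
@[simp] theorem cD_cD (A B : Form P) : cD A B ≫ cD B A = 𝟙 _ := tm_eq.2 (.cDisjIso _ _)
theorem bC_pent (A B C D : Form P) : bC' (A ⋏ B) C D ≫ bC' A B (C ⋏ D) =
    cj (bC' A B C) (𝟙 D) ≫ bC' A (B ⋏ C) D ≫ cj (𝟙 A) (bC' B C D) := by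
  rw [← Category.assoc]; exact tm_eq.2 (.bConjPent _ _ _ _)
theorem bD_pent (A B C D : Form P) : bD' (A ⋎ B) C D ≫ bD' A B (C ⋎ D) =
    dj (bD' A B C) (𝟙 D) ≫ bD' A (B ⋎ C) D ≫ dj (𝟙 A) (bD' B C D) := by
  rw [← Category.assoc]; exact tm_eq.2 (.bDisjPent _ _ _ _)
theorem bcC (A B C : Form P) : cj (cC B A) (𝟙 C) ≫ bC' A B C ≫ cC A (B ⋏ C) ≫
    bC' B C A ≫ cj (𝟙 B) (cC C A) = bC' B A C := by
  simp only [← Category.assoc]; exact tm_eq.2 (.bcConj _ _ _)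
theorem bcD (A B C : Form P) : dj (cD B A) (𝟙 C) ≫ bD' A B C ≫ cD A (B ⋎ C) ≫
    bD' B C A ≫ dj (𝟙 B) (cD C A) = bD' B A C := by
  simp only [← Category.assoc]; exact tm_eq.2 (.bcDisj _ _ _)
theorem d_conj (A B C D : Form P) : dd (A ⋏ B) C D ≫ dj (bC' A B C) (𝟙 D) =
    bC' A B (C ⋎ D) ≫ cj (𝟙 A) (dd B C D) ≫ dd A (B ⋏ C) D := by
  rw [← Category.assoc]; exact tm_eq.2 (.dConj _ _ _ _)
theorem d_disj (D C B A : Form P) : cj (𝟙 D) (bD' C B A) ≫ dd D C (B ⋎ A) =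
    dd D (C ⋎ B) A ≫ dj (dd D C B) (𝟙 A) ≫ bD' (D ⋏ C) B A := by
  rw [← Category.assoc]; exact tm_eq.2 (.dDisj _ _ _ _)
/-- `dR` -/
def ddR (C B A : Form P) : (C ⋎ B) ⋏ A ⟶ C ⋎ (B ⋏ A) := tm (dR C B A)
theorem ddR_eq (C B A : Form P) : ddR C B A = cC (C ⋎ B) A ≫ cj (𝟙 A) (cD C B) ≫
    dd A B C ≫ dj (cC A B) (𝟙 C) ≫ cD (B ⋏ A) C := by
  simp only [← Category.assoc]; rfl
theorem d_bD (D C B A : Form P) : ddR D C (B ⋎ A) ≫ dj (𝟙 D) (dd C B A) =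
    dd (D ⋎ C) B A ≫ dj (ddR D C B) (𝟙 A) ≫ bD' D (C ⋏ B) A := by
  rw [← Category.assoc]; exact tm_eq.2 (.dBDisj _ _ _ _)
theorem d_bC (A B C D : Form P) : cj (dd A B C) (𝟙 D) ≫ ddR (A ⋏ B) C D =
    bC' A (B ⋎ C) D ≫ cj (𝟙 A) (ddR B C D) ≫ dd A B (C ⋏ D) := by
  rw [← Category.assoc]; exact tm_eq.2 (.dBConj _ _ _ _)
theorem b_del (A B C : Form P) : del C (A ⋏ B) ≫ bC' A B (∼C ⋎ C) = cj (𝟙 A) (del C B) :=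
  tm_eq.2 (.bDelta _ _ _)
theorem b_sig (C B A : Form P) : bD' (C ⋏ ∼C) B A ≫ sig C (B ⋎ A) = dj (sig C B) (𝟙 A) :=
  tm_eq.2 (.bSigma _ _ _)
theorem d_del (A B C : Form P) : (del A (B ⋎ C) ≫ cC _ _) ≫ dd (∼A ⋎ A) B C =
    dj (del A B ≫ cC _ _) (𝟙 C) := tm_eq.2 (.dSigmaConj _ _ _)
theorem d_sig (A C B : Form P) : dd C B (A ⋏ ∼A) ≫ cD _ _ ≫ sig A (C ⋏ B) =
    cj (𝟙 C) (cD _ _ ≫ sig A B) := tm_eq.2 (.dDeltaDisj _ _ _)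
theorem sig_del (A : Form P) : del A A ≫ dd A (∼A) A ≫ sig A A = 𝟙 A := by
  rw [← Category.assoc]; exact tm_eq.2 (.sigmaDelta A)
theorem sig_del' (A : Form P) : (del A (∼A) ≫ cj (𝟙 _) (cD _ _)) ≫ dd (∼A) A (∼A) ≫
    dj (cC _ _) (𝟙 _) ≫ sig A (∼A) = 𝟙 (∼A) := by
  rw [← Category.assoc]; exact tm_eq.2 (.sigmaDelta' A)
theorem mx_bC (A B C : Form P) : bC A B C ≫ mx (A ⋏ B) C = cj (𝟙 A) (mx B C) ≫ dd A B C :=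
  tm_eq.2 (.mixBConj _ _ _)
theorem mx_bD (C B A : Form P) : mx C (B ⋎ A) ≫ bD C B A = dd C B A ≫ dj (mx C B) (𝟙 A) :=
  tm_eq.2 (.mixBDisj _ _ _)
theorem mx_c (A B : Form P) : cC A B ≫ mx B A = mx A B ≫ cD A B := tm_eq.2 (.mixC _ _)
end

theorem term_ind {motive : ∀ {A B : Form P}, (A ⟶ B) → Prop}
    (hid : ∀ A : Form P, motive (𝟙 A))
    (hcomp : ∀ {A B C : Form P} (f : A ⟶ B) (g : B ⟶ C), motive f → motive g → motive (f ≫ g))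
    (hcj : ∀ {A B C D : Form P} (f : A ⟶ B) (g : C ⟶ D), motive f → motive g → motive (cj f g))
    (hdj : ∀ {A B C D : Form P} (f : A ⟶ B) (g : C ⟶ D), motive f → motive g → motive (dj f g))
    (hbC : ∀ A B C : Form P, motive (bC A B C)) (hbC' : ∀ A B C : Form P, motive (bC' A B C))
    (hbD : ∀ A B C : Form P, motive (bD A B C)) (hbD' : ∀ A B C : Form P, motive (bD' A B C))
    (hcC : ∀ A B : Form P, motive (cC A B)) (hcD : ∀ A B : Form P, motive (cD A B))
    (hdd : ∀ A B C : Form P, motive (dd A B C))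
    (hdel : ∀ A B : Form P, motive (del A B)) (hsig : ∀ A B : Form P, motive (sig A B))
    (hmx : ∀ A B : Form P, motive (mx A B)) {A B : Form P} (f : A ⟶ B) : motive f := by
  obtain ⟨t, rfl⟩ := tm_surj f
  induction t with
  | id => exact hid _
  | comp g f ihg ihf => exact hcomp _ _ ihf ihg
  | conj f g ihf ihg => exact hcj _ _ ihf ihg
  | disj f g ihf ihg => exact hdj _ _ ihf ihg
  | bConjTo => exact hbC _ _ _
  | bConjFrom => exact hbC' _ _ _
  | bDisjTo => exact hbD _ _ _
  | bDisjFrom => exact hbD' _ _ _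
  | cConj => exact hcC _ _
  | cDisj => exact hcD _ _
  | d => exact hdd _ _ _
  | delta => exact hdel _ _
  | sigma => exact hsig _ _
  | mix => exact hmx _ _

end MPN

namespace MPN
open CategoryTheory
variable {P : Type}

section
variable {A B C D E F : Form P}
theorem cj_comp_assoc {A₁ B₁ C₁ A₂ B₂ C₂ Z : Form P}
    (f₁ : A₁ ⟶ B₁) (g₁ : B₁ ⟶ C₁) (f₂ : A₂ ⟶ B₂) (g₂ : B₂ ⟶ C₂) (h : C₁ ⋏ C₂ ⟶ Z) :
    cj f₁ f₂ ≫ cj g₁ g₂ ≫ h = cj (f₁ ≫ g₁) (f₂ ≫ g₂) ≫ h := by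
  rw [← Category.assoc, cj_comp]
theorem dj_comp_assoc {A₁ B₁ C₁ A₂ B₂ C₂ Z : Form P}
    (f₁ : A₁ ⟶ B₁) (g₁ : B₁ ⟶ C₁) (f₂ : A₂ ⟶ B₂) (g₂ : B₂ ⟶ C₂) (h : C₁ ⋎ C₂ ⟶ Z) :
    dj f₁ f₂ ≫ dj g₁ g₂ ≫ h = dj (f₁ ≫ g₁) (f₂ ≫ g₂) ≫ h := by
  rw [← Category.assoc, dj_comp]
@[simp] theorem bC_bC'_assoc (A B C : Form P) (h : A ⋏ B ⋏ C ⟶ D) :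
    bC A B C ≫ bC' A B C ≫ h = h := by rw [← Category.assoc]; simp
@[simp] theorem bC'_bC_assoc (A B C : Form P) (h : (A ⋏ B) ⋏ C ⟶ D) :
    bC' A B C ≫ bC A B C ≫ h = h := by rw [← Category.assoc]; simp
@[simp] theorem bD_bD'_assoc (A B C : Form P) (h : A ⋎ B ⋎ C ⟶ D) :
    bD A B C ≫ bD' A B C ≫ h = h := by rw [← Category.assoc]; simp
@[simp] theorem bD'_bD_assoc (A B C : Form P) (h : (A ⋎ B) ⋎ C ⟶ D) :
    bD' A B C ≫ bD A B C ≫ h = h := by rw [← Category.assoc]; simp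
@[simp] theorem cC_cC_assoc (A B : Form P) (h : A ⋏ B ⟶ D) :
    cC A B ≫ cC B A ≫ h = h := by rw [← Category.assoc]; simp
@[simp] theorem cD_cD_assoc (A B : Form P) (h : A ⋎ B ⟶ D) :
    cD A B ≫ cD B A ≫ h = h := by rw [← Category.assoc]; simp

theorem bC'_nat (f : A ⟶ D) (g : B ⟶ E) (h : C ⟶ F) :
    bC' A B C ≫ cj f (cj g h) = cj (cj f g) h ≫ bC' D E F := by
  have := bC_nat f g h
  calc _ = bC' A B C ≫ (cj f (cj g h) ≫ bC D E F) ≫ bC' D E F := by simp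
    _ = _ := by rw [← this]; simp
theorem bD'_nat (f : A ⟶ D) (g : B ⟶ E) (h : C ⟶ F) :
    bD' A B C ≫ dj f (dj g h) = dj (dj f g) h ≫ bD' D E F := by
  have := bD_nat f g h
  calc _ = bD' A B C ≫ (dj f (dj g h) ≫ bD D E F) ≫ bD' D E F := by simp
    _ = _ := by rw [← this]; simp

theorem hexC (A B C : Form P) : bC' A B C ≫ cC A (B ⋏ C) ≫ bC' B C A =
    cj (cC A B) (𝟙 C) ≫ bC' B A C ≫ cj (𝟙 B) (cC A C) := by
  rw [← bcC A B C]; simp [cj_comp, cj_comp_assoc]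
theorem hexD (A B C : Form P) : bD' A B C ≫ cD A (B ⋎ C) ≫ bD' B C A =
    dj (cD A B) (𝟙 C) ≫ bD' B A C ≫ dj (𝟙 B) (cD A C) := by
  rw [← bcD A B C]; simp [dj_comp, dj_comp_assoc]
instance bC_mono (A B C : Form P) : Mono (bC A B C) :=
  ⟨fun a b h => by simpa using congrArg (· ≫ bC' A B C) h⟩
instance bD_mono (A B C : Form P) : Mono (bD A B C) :=
  ⟨fun a b h => by simpa using congrArg (· ≫ bD' A B C) h⟩
/-- reversed hexagon -/
theorem hexC' (A B C : Form P) : bC A B C ≫ cC (A ⋏ B) C ≫ bC C A B =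
    cj (𝟙 A) (cC B C) ≫ bC A C B ≫ cj (cC A C) (𝟙 B) := by
  have h := hexC C A B
  have h2 : bC A B C ≫ cC (A ⋏ B) C ≫ bC C A B ≫ (bC' C A B ≫ cC C (A ⋏ B) ≫ bC' A B C) ≫
      cj (𝟙 A) (cC B C) ≫ bC A C B ≫ cj (cC A C) (𝟙 B) = bC A B C ≫ cC (A ⋏ B) C ≫ bC C A B ≫
      (cj (cC C A) (𝟙 B) ≫ bC' A C B ≫ cj (𝟙 A) (cC C B)) ≫
      cj (𝟙 A) (cC B C) ≫ bC A C B ≫ cj (cC A C) (𝟙 B) := by rw [h]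
  simpa [cj_comp, cj_comp_assoc] using h2.symm
theorem hexD' (A B C : Form P) : bD A B C ≫ cD (A ⋎ B) C ≫ bD C A B =
    dj (𝟙 A) (cD B C) ≫ bD A C B ≫ dj (cD A C) (𝟙 B) := by
  have h := hexD C A B
  have h2 : bD A B C ≫ cD (A ⋎ B) C ≫ bD C A B ≫ (bD' C A B ≫ cD C (A ⋎ B) ≫ bD' A B C) ≫
      dj (𝟙 A) (cD B C) ≫ bD A C B ≫ dj (cD A C) (𝟙 B) = bD A B C ≫ cD (A ⋎ B) C ≫ bD C A B ≫
      (dj (cD C A) (𝟙 B) ≫ bD' A C B ≫ dj (𝟙 A) (cD C B)) ≫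
      dj (𝟙 A) (cD B C) ≫ bD A C B ≫ dj (cD A C) (𝟙 B) := by rw [h]
  simpa [dj_comp, dj_comp_assoc] using h2.symm
end

/-! ### Global elements -/

@[ext] structure Pt (X : Form P) where
  l : ∀ Z : Form P, Z ⟶ X ⋏ Z
  nat : ∀ {Z W : Form P} (f : Z ⟶ W), f ≫ l W = l Z ≫ cj (𝟙 X) f
  ass : ∀ Z W : Form P, l (Z ⋏ W) = cj (l Z) (𝟙 W) ≫ bC' X Z W
  dis : ∀ Z W : Form P, l (Z ⋎ W) ≫ dd X Z W = dj (l Z) (𝟙 W)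

namespace Pt
variable {X Y Z W : Form P}
def push (u : Pt X) (f : X ⟶ Y) : Pt Y where
  l Z := u.l Z ≫ cj f (𝟙 Z)
  nat g := by simp only [Category.assoc, cj_comp]; rw [← Category.assoc, u.nat]; simp [cj_comp]
  ass Z W := by
    rw [u.ass]
    calc _ = cj (u.l Z) (𝟙 W) ≫ bC' _ _ _ ≫ cj f (cj (𝟙 _) (𝟙 _)) := by simp
      _ = _ := by rw [bC'_nat]; simp [cj_comp_assoc]
  dis Z W := by
    calc _ = u.l (Z ⋎ W) ≫ cj f (dj (𝟙 _) (𝟙 _)) ≫ dd _ _ _ := by simp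
      _ = _ := by rw [← dd_nat, ← Category.assoc, u.dis]; simp [dj_comp]

theorem nat_assoc (u : Pt X) (f : Z ⟶ W) {V : Form P} (h : X ⋏ W ⟶ V) :
    f ≫ u.l W ≫ h = u.l Z ≫ cj (𝟙 X) f ≫ h := by
  rw [← Category.assoc, u.nat]; simp

/-- moving the new component past the first one -/
theorem mid (v : Pt Y) (X Z : Form P) :
    cj (𝟙 X) (v.l Z) = v.l (X ⋏ Z) ≫ bC Y X Z ≫ cj (cC Y X) (𝟙 Z) ≫ bC' X Y Z := by
  have h1 : cj (𝟙 X) (v.l Z) = cC X Z ≫ cj (v.l Z) (𝟙 X) ≫ cC _ _ := by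
    rw [← cC_nat]; simp
  have h2 : cj (v.l Z) (𝟙 X) = v.l (Z ⋏ X) ≫ bC _ _ _ := by rw [v.ass]; simp
  rw [h1, h2, Category.assoc, nat_assoc, ← cancel_mono (bC X Y Z)]
  simp only [Category.assoc]
  rw [hexC']; simp [cj_comp_assoc, cj_comp]

theorem comm (u : Pt X) (v : Pt Y) : v.push (u.l Y) = u.push (v.l X ≫ cC Y X) := by
  ext Z
  have h1 : cj (u.l Y) (𝟙 Z) = u.l (Y ⋏ Z) ≫ bC _ _ _ := by rw [u.ass]; simp
  have h2 : cj (v.l X) (𝟙 Z) = v.l (X ⋏ Z) ≫ bC _ _ _ := by rw [v.ass]; simp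
  have h3 : cj (v.l X ≫ cC Y X) (𝟙 Z) = cj (v.l X) (𝟙 Z) ≫ cj (cC Y X) (𝟙 Z) := by
    simp [cj_comp]
  simp only [push]
  rw [h1, h3, h2, nat_assoc, mid]
  simp

/-- addition of a component by mix -/
def a (u : Pt X) (Z : Form P) : Z ⟶ X ⋎ Z := u.l Z ≫ mx X Z

theorem a_nat (u : Pt X) (f : Z ⟶ W) : f ≫ u.a W = u.a Z ≫ dj (𝟙 X) f := by
  simp only [a, Category.assoc, mx_nat]; rw [nat_assoc]
theorem a_nat_assoc (u : Pt X) (f : Z ⟶ W) {V : Form P} (h : X ⋎ W ⟶ V) :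
    f ≫ u.a W ≫ h = u.a Z ≫ dj (𝟙 X) f ≫ h := by
  rw [← Category.assoc, u.a_nat]; simp
theorem a_ass (u : Pt X) (Z W : Form P) : u.a (Z ⋎ W) = dj (u.a Z) (𝟙 W) ≫ bD' X Z W := by
  have h : dj (u.a Z) (𝟙 W) = dj (u.l Z) (𝟙 W) ≫ dj (mx X Z) (𝟙 W) := by simp [dj_comp, a]
  rw [h, ← u.dis, Category.assoc, Category.assoc]
  have := mx_bD X Z W
  rw [← Category.assoc (dd _ _ _), ← this]; simp [a]
theorem a_push (u : Pt X) (f : X ⟶ Y) (Z : Form P) : (u.push f).a Z = u.a Z ≫ dj f (𝟙 Z) := by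
  simp [a, push, mx_nat]
theorem a_mid (v : Pt Y) (X Z : Form P) :
    dj (𝟙 X) (v.a Z) = v.a (X ⋎ Z) ≫ bD Y X Z ≫ dj (cD Y X) (𝟙 Z) ≫ bD' X Y Z := by
  have h1 : dj (𝟙 X) (v.a Z) = cD X Z ≫ dj (v.a Z) (𝟙 X) ≫ cD _ _ := by
    rw [← cD_nat]; simp
  have h2 : dj (v.a Z) (𝟙 X) = v.a (Z ⋎ X) ≫ bD _ _ _ := by rw [v.a_ass]; simp
  rw [h1, h2, Category.assoc, a_nat_assoc, ← cancel_mono (bD X Y Z)]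
  simp only [Category.assoc]
  rw [hexD']; simp [dj_comp_assoc, dj_comp]
theorem push_push (u : Pt X) (f : X ⟶ Y) (g : Y ⟶ Z) : (u.push f).push g = u.push (f ≫ g) := by
  ext W; simp [push, cj_comp]
theorem push_id (u : Pt X) : u.push (𝟙 X) = u := by ext W; simp [push]
theorem a_comm (u : Pt X) (v : Pt Y) : v.push (u.a Y) = u.push (v.a X ≫ cD Y X) := by
  have h1 : v.push (u.a Y) = (v.push (u.l Y)).push (mx X Y) := by rw [push_push]; rfl
  rw [h1, comm, push_push]
  simp [a, mx_c]
theorem l_push (u : Pt X) (f : X ⟶ Y) (Z : Form P) : (u.push f).l Z = u.l Z ≫ cj f (𝟙 Z) := rfl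
end Pt

/-- The axiom link. -/
def ptDel (B : Form P) : Pt (∼B ⋎ B) where
  l Z := del B Z ≫ cC _ _
  nat f := by rw [← Category.assoc, ← del_nat, Category.assoc, Category.assoc, cC_nat]
  ass Z W := by
    have h := b_del W Z B
    have h0 : del B (Z ⋏ W) = cC Z W ≫ del B (W ⋏ Z) ≫ cj (cC W Z) (𝟙 _) := by
      rw [del_nat]; simp
    have h1 : del B (W ⋏ Z) = cj (𝟙 W) (del B Z) ≫ bC _ _ _ := by rw [← h]; simp
    have h2 : cj (del B Z ≫ cC _ _) (𝟙 W) = cC Z W ≫ cj (𝟙 W) (del B Z ≫ cC _ _) ≫ cC _ _ := by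
      rw [← cC_nat]; simp
    have h3 : cj (𝟙 W) (del B Z ≫ cC Z (∼B ⋎ B)) = cj (𝟙 W) (del B Z) ≫ cj (𝟙 W) (cC _ _) := by
      simp [cj_comp]
    rw [h0, h1, h2, h3]
    simp only [Category.assoc]
    congr 2
    have h4 := hexC' W Z (∼B ⋎ B)
    have h5 : cj (𝟙 W) (cC Z (∼B ⋎ B)) = bC W Z (∼B ⋎ B) ≫ cC (W ⋏ Z) (∼B ⋎ B) ≫
       bC (∼B ⋎ B) W Z ≫ cj (cC _ _) (𝟙 _) ≫ bC' _ _ _ := by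
      have := congrArg (· ≫ cj (cC (∼B ⋎ B) W) (𝟙 Z) ≫ bC' W (∼B ⋎ B) Z) h4
      simpa [cj_comp_assoc] using this.symm
    rw [h5]
    have h6 := hexC W (∼B ⋎ B) Z
    have h7 : cj (cC (∼B ⋎ B) W) (𝟙 Z) ≫ bC' W (∼B ⋎ B) Z ≫ cC W ((∼B ⋎ B) ⋏ Z) ≫
      bC' (∼B ⋎ B) Z W = bC' _ _ _ ≫ cj (𝟙 _) (cC _ _) := by
      rw [h6]; simp [cj_comp_assoc]
    simp only [Category.assoc]
    rw [h7]
    simp [cC_nat]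
  dis Z W := by simpa using d_del B Z W

end MPN

namespace MPN
open CategoryTheory
variable {P : Type}

/-! ### Adding a unit object on the left -/

inductive Ob (P : Type) : Type
  | I : Ob P
  | o : Form P → Ob P

inductive OHom : Ob P → Ob P → Type
  | nil : OHom .I .I
  | pt {X : Form P} (u : Pt X) : OHom .I (.o X)
  | ar {X Y : Form P} (f : X ⟶ Y) : OHom (.o X) (.o Y)

open Ob OHom

def oid : ∀ X : Ob P, OHom X X
  | I => nil
  | o X => ar (𝟙 X)

def ocomp : ∀ {X Y Z : Ob P}, OHom X Y → OHom Y Z → OHom X Z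
  | _, _, _, nil, g => g
  | _, _, _, pt u, ar g => pt (u.push g)
  | _, _, _, ar f, ar g => ar (f ≫ g)

instance instOCat : Category (Ob P) where
  Hom := OHom
  id := oid
  comp := ocomp
  id_comp f := by cases f <;> simp [oid, ocomp]
  comp_id f := by cases f <;> simp [oid, ocomp, Pt.push_id]
  assoc f g h := by cases f <;> cases g <;> cases h <;> simp [ocomp, Pt.push_push]

def oten : Ob P → Ob P → Ob P
  | I, Y => Y
  | o X, I => o X
  | o X, o Y => o (X ⋎ Y)

def ocj : Ob P → Ob P → Ob P
  | I, Y => Y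
  | o X, I => o X
  | o X, o Y => o (X ⋏ Y)

def htn : ∀ {X Y X' Y' : Ob P}, OHom X Y → OHom X' Y' → OHom (oten X X') (oten Y Y')
  | _, _, _, _, nil, g => g
  | _, _, _, _, pt u, nil => pt u
  | _, _, _, _, ar f, nil => ar f
  | _, _, _, _, pt u, pt v => pt (v.push (u.a _))
  | _, _, _, _, pt u, ar g => ar (g ≫ u.a _)
  | _, _, _, _, ar f, pt v => ar (f ≫ v.a _ ≫ cD _ _)
  | _, _, _, _, ar f, ar g => ar (dj f g)

def hcj : ∀ {X Y X' Y' : Ob P}, OHom X Y → OHom X' Y' → OHom (ocj X X') (ocj Y Y')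
  | _, _, _, _, nil, g => g
  | _, _, _, _, pt u, nil => pt u
  | _, _, _, _, ar f, nil => ar f
  | _, _, _, _, pt u, pt v => pt (v.push (u.l _))
  | _, _, _, _, pt u, ar g => ar (g ≫ u.l _)
  | _, _, _, _, ar f, pt v => ar (f ≫ v.l _ ≫ cC _ _)
  | _, _, _, _, ar f, ar g => ar (cj f g)

def oass : ∀ X Y Z : Ob P, OHom (oten (oten X Y) Z) (oten X (oten Y Z))
  | I, Y, Z => oid (oten Y Z)
  | o X, I, Z => oid (oten (o X) Z)
  | o X, o Y, I => oid (o (X ⋎ Y))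
  | o X, o Y, o Z => ar (bD' X Y Z)
def oass' : ∀ X Y Z : Ob P, OHom (oten X (oten Y Z)) (oten (oten X Y) Z)
  | I, Y, Z => oid (oten Y Z)
  | o X, I, Z => oid (oten (o X) Z)
  | o X, o Y, I => oid (o (X ⋎ Y))
  | o X, o Y, o Z => ar (bD X Y Z)
def orun : ∀ X : Ob P, OHom (oten X I) X
  | I => nil
  | o X => ar (𝟙 X)
def orun' : ∀ X : Ob P, OHom X (oten X I)
  | I => nil
  | o X => ar (𝟙 X)
def obr : ∀ X Y : Ob P, OHom (oten X Y) (oten Y X)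
  | I, I => nil
  | I, o Y => ar (𝟙 Y)
  | o X, I => ar (𝟙 X)
  | o X, o Y => ar (cD X Y)

theorem ocomp_eq {X Y Z : Ob P} (f : X ⟶ Y) (g : Y ⟶ Z) : f ≫ g = ocomp f g := rfl
theorem oid_eq (X : Ob P) : 𝟙 X = oid X := rfl

theorem cD_nat_assoc {A B D E F : Form P} (f : A ⟶ D) (g : B ⟶ E) (h : E ⋎ D ⟶ F) :
    cD A B ≫ dj g f ≫ h = dj f g ≫ cD D E ≫ h := by
  rw [← Category.assoc, cD_nat, Category.assoc]
theorem cC_nat_assoc {A B D E F : Form P} (f : A ⟶ D) (g : B ⟶ E) (h : E ⋏ D ⟶ F) :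
    cC A B ≫ cj g f ≫ h = cj f g ≫ cC D E ≫ h := by
  rw [← Category.assoc, cC_nat, Category.assoc]

theorem htn_comp {X Y Z X' Y' Z' : Ob P} (f : OHom X Y) (g : OHom Y Z) (f' : OHom X' Y')
    (g' : OHom Y' Z') : htn (ocomp f g) (ocomp f' g') = ocomp (htn f f') (htn g g') := by
  cases f <;> cases g <;> cases f' <;> cases g' <;>
    simp [ocomp, htn, oten, Pt.push_push, Pt.a_push, Pt.a_nat, Pt.a_nat_assoc, dj_comp, cD_nat,
      dj_comp_assoc]
  · rename_i _ u _ f _ v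
    have := congrArg (fun t => t.push (dj f (𝟙 _))) (Pt.a_comm u v)
    simp [Pt.push_push, cD_nat] at this
    rw [this]

theorem hcj_comp {X Y Z X' Y' Z' : Ob P} (f : OHom X Y) (g : OHom Y Z) (f' : OHom X' Y')
    (g' : OHom Y' Z') : hcj (ocomp f g) (ocomp f' g') = ocomp (hcj f f') (hcj g g') := by
  cases f <;> cases g <;> cases f' <;> cases g' <;>
    simp [ocomp, hcj, ocj, Pt.push_push, Pt.l_push, Pt.nat, Pt.nat_assoc, cj_comp, cC_nat,
      cj_comp_assoc]
  · rename_i _ u _ f _ v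
    have := congrArg (fun t => t.push (cj f (𝟙 _))) (Pt.comm u v)
    simp [Pt.push_push, cC_nat] at this
    rw [this]

theorem str1 (W X Y : Form P) : cD W (X ⋎ Y) ≫ bD' X Y W =
    bD W X Y ≫ dj (cD W X) (𝟙 Y) ≫ bD' X W Y ≫ dj (𝟙 X) (cD W Y) := by
  rw [← hexD]; simp
theorem str2 (W V Y : Form P) : cD W (V ⋎ Y) ≫ dj (cD V Y) (𝟙 W) ≫ bD' Y V W =
    bD W V Y ≫ dj (cD W V) (𝟙 Y) ≫ cD (V ⋎ W) Y := by
  have h := hexD' V W Y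
  have h' : cD (V ⋎ W) Y = bD' V W Y ≫ (bD V W Y ≫ cD (V ⋎ W) Y ≫ bD Y V W) ≫ bD' Y V W := by simp
  have h2 : cD W (V ⋎ Y) = (cD W (V ⋎ Y) ≫ bD' V Y W) ≫ bD _ _ _ := by simp
  rw [h', h, h2, str1]; simp

theorem a_mid1 {A : Form P} (v : Pt A) (X Y : Form P) :
    dj (v.a X ≫ cD A X) (𝟙 Y) ≫ bD' X A Y = dj (𝟙 X) (v.a Y) := by
  have h1 : dj (v.a X ≫ cD A X) (𝟙 Y) = dj (v.a X) (𝟙 Y) ≫ dj (cD A X) (𝟙 Y) := by simp [dj_comp]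
  have h2 : dj (v.a X) (𝟙 Y) = v.a (X ⋎ Y) ≫ bD _ _ _ := by rw [v.a_ass]; simp
  rw [h1, h2, Pt.a_mid]; simp
theorem a_mid2 {A : Form P} (w : Pt A) (X Y : Form P) :
    w.a (X ⋎ Y) ≫ cD A (X ⋎ Y) ≫ bD' X Y A = dj (𝟙 X) (w.a Y ≫ cD A Y) := by
  have h1 : dj (𝟙 X) (w.a Y ≫ cD A Y) = dj (𝟙 X) (w.a Y) ≫ dj (𝟙 X) (cD A Y) := by simp [dj_comp]
  rw [h1, Pt.a_mid, str1]; simp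

theorem oass_nat {X Y Z X' Y' Z' : Ob P} (f : OHom X X') (g : OHom Y Y') (h : OHom Z Z') :
    ocomp (htn (htn f g) h) (oass X' Y' Z') = ocomp (oass X Y Z) (htn f (htn g h)) := by
  cases f <;> cases g <;> cases h <;>
    simp [ocomp, oid, htn, oass, oten, Pt.push_push, Pt.a_push, Pt.push_id]
  · rename_i u _ v _ w
    simp [Pt.a_ass]
  · rename_i u _ v _ _ h
    simp [Pt.a_ass]
  · rename_i u _ _ g _ w
    rw [a_mid2, Pt.a_nat_assoc, Pt.a_nat]; simp [dj_comp, Pt.a_nat_assoc]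
  · rename_i u _ _ g _ _ h
    rw [Pt.a_ass]; simp [dj_comp_assoc]
  · rename_i Y f _ v _ w
    have h := congrArg (fun t => t.a Y) (Pt.a_comm v w)
    simp only [Pt.a_push] at h
    rw [a_mid2, cD_nat, ← Category.assoc (w.a _), h]; simp
  · rename_i f _ v _ _ h
    have := a_mid1 v
    have h1 : dj (f ≫ v.a _ ≫ cD _ _) h = dj f h ≫ dj (v.a _ ≫ cD _ _) (𝟙 _) := by simp [dj_comp]
    rw [h1, Category.assoc, a_mid1]; simp [dj_comp]
  · rename_i f _ _ g _ w
    rw [a_mid2]; simp [dj_comp]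
  · rw [bD'_nat]

theorem oass_inv (X Y Z : Ob P) : ocomp (oass X Y Z) (oass' X Y Z) = oid _ := by
  cases X <;> cases Y <;> cases Z <;> simp [oass, oass', oid, ocomp, oten]
theorem oass'_inv (X Y Z : Ob P) : ocomp (oass' X Y Z) (oass X Y Z) = oid _ := by
  cases X <;> cases Y <;> cases Z <;> simp [oass, oass', oid, ocomp, oten]
theorem htn_id (X Y : Ob P) : htn (oid X) (oid Y) = oid (oten X Y) := by
  cases X <;> cases Y <;> simp [oid, htn, oten]
theorem hcj_id (X Y : Ob P) : hcj (oid X) (oid Y) = oid (ocj X Y) := by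
  cases X <;> cases Y <;> simp [oid, hcj, ocj]

theorem lun_nat {X Y : Ob P} (f : OHom X Y) :
    ocomp (htn (oid I) f) (oid Y) = ocomp (oid X) f := by
  cases f <;> simp [oid, ocomp, htn, oten, Pt.push_id]
theorem runit_nat {X Y : Ob P} (f : OHom X Y) :
    ocomp (htn f (oid I)) (orun Y) = ocomp (orun X) f := by
  cases f <;> simp [oid, ocomp, htn, oten, orun, Pt.push_id]
theorem obr_nr (X : Ob P) {Y Z : Ob P} (f : OHom Y Z) :
    ocomp (htn (oid X) f) (obr X Z) = ocomp (obr X Y) (htn f (oid X)) := by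
  cases X <;> cases f <;> simp [oid, ocomp, htn, oten, obr, cD_nat, Pt.push_id]
theorem obr_nl {X Y : Ob P} (f : OHom X Y) (Z : Ob P) :
    ocomp (htn f (oid Z)) (obr Y Z) = ocomp (obr X Z) (htn (oid Z) f) := by
  cases Z <;> cases f <;> simp [oid, ocomp, htn, oten, obr, cD_nat, Pt.push_id]

instance instMS : MonoidalCategoryStruct (Ob P) where
  tensorObj := oten
  tensorUnit := I
  tensorHom f g := htn f g
  whiskerLeft X _ _ f := htn (oid X) f
  whiskerRight f Y := htn f (oid Y)
  associator X Y Z := ⟨oass X Y Z, oass' X Y Z, oass_inv X Y Z, oass'_inv X Y Z⟩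
  leftUnitor X := ⟨oid X, oid X, Category.id_comp (𝟙 X), Category.id_comp (𝟙 X)⟩
  rightUnitor X := ⟨orun X, orun' X, by cases X <;> simp [orun, orun', ocomp_eq, ocomp, oid_eq, oid, oten],
    by cases X <;> simp [orun, orun', ocomp_eq, ocomp, oid_eq, oid, oten]⟩

open MonoidalCategory

instance instMon : MonoidalCategory (Ob P) := MonoidalCategory.ofTensorHom
  (id_tensorHom_id := htn_id)
  (id_tensorHom := fun _ _ _ _ => rfl)
  (tensorHom_id := fun _ _ => rfl)
  (tensorHom_comp_tensorHom := fun f g h k => (htn_comp f h g k).symm)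
  (associator_naturality := fun f g h => oass_nat f g h)
  (leftUnitor_naturality := fun f => lun_nat f)
  (rightUnitor_naturality := fun f => runit_nat f)
  (pentagon := fun W X Y Z => by
    change ocomp (htn (oass W X Y) (oid Z)) (ocomp (oass W (oten X Y) Z) (htn (oid W) (oass X Y Z)))
      = ocomp (oass (oten W X) Y Z) (oass W X (oten Y Z))
    cases W <;> cases X <;> cases Y <;> cases Z <;>
      simp [oid, ocomp, htn, oten, oass, bD_pent])
  (triangle := fun X Y => by
    change ocomp (oass X I Y) (htn (oid X) (oid Y)) = htn (orun X) (oid Y)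
    cases X <;> cases Y <;> simp [oid, ocomp, htn, oten, oass, orun])

instance instSym : SymmetricCategory (Ob P) where
  braiding X Y := ⟨obr X Y, obr Y X,
    by change ocomp (obr X Y) (obr Y X) = oid (oten X Y)
       cases X <;> cases Y <;> simp [oid, ocomp, oten, obr],
    by change ocomp (obr Y X) (obr X Y) = oid (oten Y X)
       cases X <;> cases Y <;> simp [oid, ocomp, oten, obr]⟩
  braiding_naturality_right X _ _ f := obr_nr X f
  braiding_naturality_left f Z := obr_nl f Z
  hexagon_forward X Y Z := by
    change ocomp (oass X Y Z) (ocomp (obr X (oten Y Z)) (oass Y Z X)) =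
      ocomp (htn (obr X Y) (oid Z)) (ocomp (oass Y X Z) (htn (oid Y) (obr X Z)))
    cases X <;> cases Y <;> cases Z <;> simp [oid, ocomp, htn, oten, oass, obr, hexD]
  hexagon_reverse X Y Z := by
    change ocomp (oass' X Y Z) (ocomp (obr (oten X Y) Z) (oass' Z X Y)) =
      ocomp (htn (oid X) (obr Y Z)) (ocomp (oass' X Z Y) (htn (obr X Z) (oid Y)))
    cases X <;> cases Y <;> cases Z <;> simp [oid, ocomp, htn, oten, oass', obr, hexD']
  symmetry X Y := by
    change ocomp (obr X Y) (obr Y X) = oid (oten X Y)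
    cases X <;> cases Y <;> simp [oid, ocomp, oten, obr]

end MPN

namespace MPN
open CategoryTheory MonoidalCategory
variable {P : Type}
open Ob OHom

theorem hexC_str1 (W X Y : Form P) : cC W (X ⋏ Y) ≫ bC' X Y W =
    bC W X Y ≫ cj (cC W X) (𝟙 Y) ≫ bC' X W Y ≫ cj (𝟙 X) (cC W Y) := by
  rw [← hexC]; simp
theorem l_mid2 {A : Form P} (w : Pt A) (X Y : Form P) :
    w.l (X ⋏ Y) ≫ cC A (X ⋏ Y) ≫ bC' X Y A = cj (𝟙 X) (w.l Y ≫ cC A Y) := by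
  have h1 : cj (𝟙 X) (w.l Y ≫ cC A Y) = cj (𝟙 X) (w.l Y) ≫ cj (𝟙 X) (cC A Y) := by simp [cj_comp]
  rw [h1, Pt.mid, hexC_str1]; simp

theorem mx_bC'' (A B C : Form P) : mx (A ⋏ B) C = bC' A B C ≫ cj (𝟙 A) (mx B C) ≫ dd A B C := by
  rw [← mx_bC]; simp
theorem mx_bD'' (A B C : Form P) : mx A (B ⋎ C) = dd A B C ≫ dj (mx A B) (𝟙 C) ≫ bD' A B C := by
  rw [← Category.assoc, ← mx_bD]; simp
theorem l_mid1 {A : Form P} (v : Pt A) (X Y : Form P) :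
    cj (v.l X ≫ cC A X) (𝟙 Y) ≫ bC' X A Y = cj (𝟙 X) (v.l Y) := by
  have h1 : cj (v.l X ≫ cC A X) (𝟙 Y) = cj (v.l X) (𝟙 Y) ≫ cj (cC A X) (𝟙 Y) := by simp [cj_comp]
  have h2 : cj (v.l X) (𝟙 Y) = v.l (X ⋏ Y) ≫ bC _ _ _ := by rw [v.ass]; simp
  rw [h1, h2, Pt.mid]; simp
theorem a_K {A : Form P} (u : Pt A) (X Y : Form P) :
    u.a (X ⋏ Y) ≫ cD A (X ⋏ Y) = cj (𝟙 X) (u.a Y ≫ cD A Y) ≫ dd X Y A := by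
  have h1 : ∀ Z, u.a Z ≫ cD A Z = (u.l Z ≫ cC A Z) ≫ mx Z A := by
    intro Z; simp [Pt.a, mx_c]
  have h2 : cj (𝟙 X) ((u.l Y ≫ cC A Y) ≫ mx Y A) = cj (𝟙 X) (u.l Y ≫ cC A Y) ≫ cj (𝟙 X) (mx Y A) := by
    simp [cj_comp]
  rw [h1, h1, mx_bC'', h2, ← l_mid2]; simp
theorem a_K2 {A : Form P} (u : Pt A) (Y Z : Form P) :
    cj (u.l Y ≫ cC A Y) (𝟙 Z) ≫ mx (Y ⋏ A) Z = cj (𝟙 Y) (u.a Z) ≫ dd Y A Z := by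
  rw [mx_bC'', ← Category.assoc, l_mid1, ← Category.assoc, cj_comp]; simp [Pt.a]

def ocb : ∀ X Y : Ob P, OHom (ocj X Y) (ocj Y X)
  | I, I => nil
  | I, o Y => ar (𝟙 Y)
  | o X, I => ar (𝟙 X)
  | o X, o Y => ar (cC X Y)
def ocr : ∀ X : Ob P, OHom X (ocj X I)
  | I => nil
  | o X => ar (𝟙 X)
def oca : ∀ X Y Z : Ob P, OHom (ocj (ocj X Y) Z) (ocj X (ocj Y Z))
  | I, Y, Z => oid (ocj Y Z)
  | o X, I, Z => oid (ocj (o X) Z)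
  | o X, o Y, I => oid (o (X ⋏ Y))
  | o X, o Y, o Z => ar (bC' X Y Z)
def odd : ∀ X Y Z : Ob P, OHom (ocj X (oten Y Z)) (oten (ocj X Y) Z)
  | I, Y, Z => oid (oten Y Z)
  | o X, I, I => oid (o X)
  | o X, I, o Z => ar (mx X Z)
  | o X, o Y, I => oid (o (X ⋏ Y))
  | o X, o Y, o Z => ar (dd X Y Z)
/-- right-handed distribution -/
def odr (X Y Z : Ob P) : OHom (ocj (oten X Y) Z) (oten (ocj X Z) Y) :=
  ocomp (ocb (oten X Y) Z) (ocomp (odd Z X Y) (htn (ocb Z X) (oid Y)))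

theorem ocb_nat {X Y X' Y' : Ob P} (f : OHom X Y) (g : OHom X' Y') :
    ocomp (ocb X X') (hcj g f) = ocomp (hcj f g) (ocb Y Y') := by
  cases f <;> cases g <;> simp [ocb, ocomp, hcj, ocj, Pt.push_id, Pt.push_push, cC_nat, Pt.comm]
theorem ocb_inv (X Y : Ob P) : ocomp (ocb X Y) (ocb Y X) = oid _ := by
  cases X <;> cases Y <;> simp [oid, ocomp, ocj, ocb]
theorem ocr_nat {X Y : Ob P} (f : OHom X Y) : ocomp f (ocr Y) = ocomp (ocr X) (hcj f (oid I)) := by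
  cases f <;> simp [oid, ocomp, hcj, ocj, ocr, Pt.push_id]
theorem oca_nat_r (X Y : Ob P) {Z Z' : Ob P} (h : OHom Z Z') :
    ocomp (hcj (oid _) h) (oca X Y Z') = ocomp (oca X Y Z) (hcj (oid X) (hcj (oid Y) h)) := by
  cases X <;> cases Y <;> cases h <;>
    simp [ocomp, oid, hcj, oca, ocj, Pt.push_id, bC'_nat, l_mid2]
theorem odd_nat {X Y Z X' Y' Z' : Ob P} (f : OHom X X') (g : OHom Y Y') (h : OHom Z Z') :
    ocomp (odd X Y Z) (htn (hcj f g) h) = ocomp (hcj f (htn g h)) (odd X' Y' Z') := by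
  cases f <;> cases g <;> cases h <;>
    simp [ocomp, oid, hcj, htn, odd, oten, ocj, Pt.push_id, Pt.push_push, dd_nat, mx_nat]
  · simp [Pt.a]
  · simp [Pt.a]
  · rw [Pt.a_push, Pt.dis]
  · rw [Pt.a_push, Pt.dis]
  · rename_i u _ Y f Z v
    have := u.nat_assoc (v.a Y ≫ cD Z Y) (dd _ _ _)
    simp only [Category.assoc] at this
    rw [this, a_K]
  · rw [Pt.dis, dj_comp]; simp
  · simp [Pt.a, mx_c]
  · rename_i Y f X u _ v
    congr 1
    have h := v.nat_assoc (u.l Y ≫ cC X Y) (cC _ _ ≫ mx _ _)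
    simp only [Category.assoc] at h
    simp only [Pt.l_push, Category.assoc, Pt.a, mx_c] at h ⊢
    rw [h, ← mx_c]
    congr 1
    rw [← cC_nat_assoc, a_K2, ← cC_nat_assoc]; simp [Pt.a]
  · rename_i f _ u _ _ g
    have h := congrArg (cj f g ≫ ·) (a_K2 u _ _)
    simpa [cj_comp_assoc] using h
  · rename_i f _ _ g _ u
    rw [a_K, cj_comp_assoc]; simp

theorem odd_disj (X Y Z W : Ob P) : ocomp (hcj (oid X) (oass Y Z W)) (odd X Y (oten Z W)) =
    ocomp (odd X (oten Y Z) W) (ocomp (htn (odd X Y Z) (oid W)) (oass (ocj X Y) Z W)) := by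
  cases X <;> cases Y <;> cases Z <;> cases W <;>
    simp [ocomp, oid, hcj, htn, odd, oten, ocj, oass, d_disj]
  rw [← mx_bD'']
theorem odd_conj (X Y Z W : Ob P) : ocomp (odd (ocj X Y) Z W) (htn (oca X Y Z) (oid W)) =
    ocomp (oca X Y (oten Z W)) (ocomp (hcj (oid X) (odd Y Z W)) (odd X (ocj Y Z) W)) := by
  cases X <;> cases Y <;> cases Z <;> cases W <;>
    simp [ocomp, oid, hcj, htn, odd, oten, ocj, oca, d_conj]
  rw [← mx_bC'']
theorem odr_unit (X Y : Ob P) : ocomp (ocr (oten X Y)) (odr X Y I) = htn (ocr X) (oid Y) := by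
  cases X <;> cases Y <;> simp [ocomp, oid, htn, odr, odd, oten, ocj, ocr, ocb]
theorem oca_unit (X Y : Ob P) : ocomp (ocr (ocj X Y)) (oca X Y I) = hcj (oid X) (ocr Y) := by
  cases X <;> cases Y <;> simp [ocomp, oid, hcj, ocj, ocr, oca]
/-- the two ways of distributing both sides -/
theorem odd_odr (X G Y D : Ob P) :
    ocomp (odr X G (oten Y D)) (htn (odd X Y D) (oid G)) =
    ocomp (odd (oten X G) Y D) (ocomp (htn (odr X G Y) (oid D))
      (ocomp (oass _ _ _) (ocomp (htn (oid _) (obr G D)) (oass' _ _ _)))) := by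
  cases X <;> cases G <;> cases Y <;> cases D <;>
    simp [ocomp, oid, hcj, htn, odd, oten, ocj, oass, oass', odr, ocb, obr]
  · exact mx_c _ _
  · rename_i A B C
    rw [mx_c, mx_c, mx_bD'']
    have h : dj (mx A B ≫ cD A B) (𝟙 C) = dj (mx A B) (𝟙 C) ≫ dj (cD A B) (𝟙 C) := by simp [dj_comp]
    have h2 : bD' A B C ≫ cD A (B ⋎ C) = (bD' A B C ≫ cD A (B ⋎ C) ≫ bD' _ _ _) ≫ bD _ _ _ := by simp
    rw [h]; simp only [Category.assoc]; rw [h2, hexD]; simp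
  · rename_i X G a
    have h : bD' X G a ≫ dj (𝟙 _) (cD G a) ≫ bD _ _ _ =
       bD' X G a ≫ (dj (𝟙 _) (cD G a) ≫ bD _ _ _ ≫ dj (cD _ _) (𝟙 _)) ≫ dj (cD _ _) (𝟙 _) := by
      simp [dj_comp]
    rw [h, ← hexD', dj_comp, mx_c]
    have h2 : dj (mx a X ≫ cD a X) (𝟙 G) = dj (mx a X) (𝟙 G) ≫ dj (cD a X) (𝟙 G) := by simp [dj_comp]
    simp only [Category.comp_id]
    rw [h2]
    simp only [Category.assoc, bD'_bD_assoc]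
    rw [← Category.assoc (dd _ _ _), ← mx_bD, Category.assoc, ← Category.assoc, mx_c]; simp
  · rename_i X G Y D
    have hR : ∀ Y, cC (X ⋎ G) Y ≫ dd Y X G ≫ dj (cC Y X) (𝟙 G) =
        cj (cD X G) (𝟙 Y) ≫ ddR G X Y ≫ cD _ _ := by
      intro Y; rw [ddR_eq]; simp only [Category.assoc]; rw [← cC_nat_assoc, cj_comp_assoc]; simp
    have h1 : cC (X ⋎ G) (Y ⋎ D) ≫ dd (Y ⋎ D) X G ≫ dj (cC (Y ⋎ D) X) (𝟙 G) ≫ dj (dd X Y D) (𝟙 G) =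
      (cC (X ⋎ G) (Y ⋎ D) ≫ dd (Y ⋎ D) X G ≫ dj (cC (Y ⋎ D) X) (𝟙 G)) ≫ dj (dd X Y D) (𝟙 G) := by simp
    rw [h1, hR, hR]
    simp only [Category.assoc]
    rw [cD_nat]
    rw [← Category.assoc (ddR _ _ _), d_bD]
    have h2 : dj (cj (cD X G) (𝟙 Y) ≫ ddR G X Y ≫ cD G (X ⋏ Y)) (𝟙 D) =
      dj (cj (cD X G) (𝟙 Y)) (𝟙 D) ≫ dj (ddR G X Y) (𝟙 D) ≫ dj (cD G (X ⋏ Y)) (𝟙 D) := by simp [dj_comp]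
    rw [h2]
    simp only [Category.assoc]
    rw [← Category.assoc (dd (X ⋎ G) _ _), dd_nat]
    simp only [Category.assoc, dj_id]
    have h3 : bD' G (X ⋏ Y) D ≫ cD _ _ = (bD' G (X ⋏ Y) D ≫ cD _ _ ≫ bD' _ _ _) ≫ bD _ _ _ := by simp
    rw [h3, hexD]; simp
end MPN

namespace MPN
open CategoryTheory MonoidalCategory
variable {P : Type}
open Ob OHom

infixr:71 " ⊠ " => ocj

def cm {X Y X' Y' : Ob P} (f : X ⟶ Y) (g : X' ⟶ Y') : X ⊠ X' ⟶ Y ⊠ Y' := hcj f g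
def kap (X Y : Ob P) : X ⊠ Y ⟶ Y ⊠ X := ocb X Y
def rc (X : Ob P) : X ⟶ X ⊠ I := ocr X
def ac (X Y Z : Ob P) : (X ⊠ Y) ⊠ Z ⟶ X ⊠ (Y ⊠ Z) := oca X Y Z
def dl (X Y Z : Ob P) : X ⊠ (Y ⊗ Z) ⟶ (X ⊠ Y) ⊗ Z := odd X Y Z
def dr (X Y Z : Ob P) : (X ⊗ Y) ⊠ Z ⟶ (X ⊠ Z) ⊗ Y := odr X Y Z
/-- exchange of the last two factors -/
def sw (X Y Z : Ob P) : (X ⊗ Y) ⊗ Z ⟶ (X ⊗ Z) ⊗ Y :=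
  (α_ X Y Z).hom ≫ X ◁ (β_ Y Z).hom ≫ (α_ X Z Y).inv

section
variable {X Y Z X' Y' Z' W D G : Ob P}
@[simp] theorem cm_id (X Y : Ob P) : cm (𝟙 X) (𝟙 Y) = 𝟙 _ := hcj_id _ _
theorem cm_comp (f : X ⟶ Y) (g : Y ⟶ Z) (f' : X' ⟶ Y') (g' : Y' ⟶ Z') :
    cm f f' ≫ cm g g' = cm (f ≫ g) (f' ≫ g') := (hcj_comp f g f' g').symm
theorem cm_comp_assoc (f : X ⟶ Y) (g : Y ⟶ Z) (f' : X' ⟶ Y') (g' : Y' ⟶ Z') (h : Z ⊠ Z' ⟶ W) :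
    cm f f' ≫ cm g g' ≫ h = cm (f ≫ g) (f' ≫ g') ≫ h := by
  rw [← Category.assoc, cm_comp]
theorem kap_nat (f : X ⟶ Y) (g : X' ⟶ Y') : kap X X' ≫ cm g f = cm f g ≫ kap Y Y' := ocb_nat f g
theorem kap_nat_assoc (f : X ⟶ Y) (g : X' ⟶ Y') (h : Y' ⊠ Y ⟶ Z) :
    kap X X' ≫ cm g f ≫ h = cm f g ≫ kap Y Y' ≫ h := by
  rw [← Category.assoc, kap_nat]; simp
@[simp] theorem kap_kap (X Y : Ob P) : kap X Y ≫ kap Y X = 𝟙 _ := ocb_inv X Y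
@[simp] theorem kap_kap_assoc (X Y : Ob P) (h : X ⊠ Y ⟶ Z) : kap X Y ≫ kap Y X ≫ h = h := by
  rw [← Category.assoc]; simp
theorem rc_nat (f : X ⟶ Y) : f ≫ rc Y = rc X ≫ cm f (𝟙 I) := ocr_nat f
theorem rc_nat_assoc (f : X ⟶ Y) (h : Y ⊠ I ⟶ Z) : f ≫ rc Y ≫ h = rc X ≫ cm f (𝟙 I) ≫ h := by
  rw [← Category.assoc, rc_nat]; simp
theorem ac_nat_r (X Y : Ob P) (h : Z ⟶ Z') :
    cm (𝟙 _) h ≫ ac X Y Z' = ac X Y Z ≫ cm (𝟙 X) (cm (𝟙 Y) h) := oca_nat_r X Y h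
theorem dl_nat (f : X ⟶ X') (g : Y ⟶ Y') (h : Z ⟶ Z') :
    dl X Y Z ≫ (cm f g ⊗ₘ h) = cm f (g ⊗ₘ h) ≫ dl X' Y' Z' := odd_nat f g h
theorem dl_disj (X Y Z W : Ob P) : cm (𝟙 X) (α_ Y Z W).hom ≫ dl X Y (Z ⊗ W) =
    dl X (Y ⊗ Z) W ≫ dl X Y Z ▷ W ≫ (α_ (X ⊠ Y) Z W).hom := odd_disj X Y Z W
theorem dl_conj (X Y Z W : Ob P) : dl (X ⊠ Y) Z W ≫ ac X Y Z ▷ W =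
    ac X Y (Z ⊗ W) ≫ cm (𝟙 X) (dl Y Z W) ≫ dl X (Y ⊠ Z) W := odd_conj X Y Z W
theorem dr_def (X Y Z : Ob P) : dr X Y Z = kap (X ⊗ Y) Z ≫ dl Z X Y ≫ kap Z X ▷ Y := rfl
theorem dr_unit (X Y : Ob P) : rc (X ⊗ Y) ≫ dr X Y I = rc X ▷ Y := odr_unit X Y
theorem ac_unit (X Y : Ob P) : rc (X ⊠ Y) ≫ ac X Y I = cm (𝟙 X) (rc Y) := oca_unit X Y
theorem dl_dr (X G Y D : Ob P) : dr X G (Y ⊗ D) ≫ dl X Y D ▷ G =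
    dl (X ⊗ G) Y D ≫ dr X G Y ▷ D ≫ sw (X ⊠ Y) G D := odd_odr X G Y D
theorem rc_kap : rc (I : Ob P) ≫ kap I I = rc I := rfl
theorem dl_I (Y Z : Ob P) : dl I Y Z = 𝟙 (Y ⊗ Z) := rfl

theorem dl_nat_l (f : X ⟶ X') (Y Z : Ob P) :
    dl X Y Z ≫ cm f (𝟙 Y) ▷ Z = cm f (𝟙 _) ≫ dl X' Y Z := by
  have := dl_nat f (𝟙 Y) (𝟙 Z); simpa using this
theorem dl_nat_m (X : Ob P) (g : Y ⟶ Y') (Z : Ob P) :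
    dl X Y Z ≫ cm (𝟙 X) g ▷ Z = cm (𝟙 _) (g ▷ Z) ≫ dl X Y' Z := by
  have := dl_nat (𝟙 X) g (𝟙 Z); simpa using this
theorem dl_nat_r (X Y : Ob P) (h : Z ⟶ Z') :
    dl X Y Z ≫ (X ⊠ Y) ◁ h = cm (𝟙 _) (Y ◁ h) ≫ dl X Y Z' := by
  have := dl_nat (𝟙 X) (𝟙 Y) h; simpa using this
theorem dr_nat_r (X G : Ob P) (h : Z ⟶ Z') :
    dr X G Z ≫ cm (𝟙 X) h ▷ G = cm (𝟙 _) h ≫ dr X G Z' := by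
  rw [dr_def, dr_def]; simp only [Category.assoc, ← comp_whiskerRight]
  rw [kap_nat, ← kap_nat_assoc, comp_whiskerRight, reassoc_of% (dl_nat_l h X G)]

/-- acting on `X` with a point of `Y ⊗ D`. -/
def act (X : Ob P) (v : I ⟶ Y ⊗ D) : X ⟶ (X ⊠ Y) ⊗ D := rc X ≫ cm (𝟙 X) v ≫ dl X Y D

theorem act_nat (f : X ⟶ X') (v : I ⟶ Y ⊗ D) :
    f ≫ act X' v = act X v ≫ cm f (𝟙 Y) ▷ D := by
  simp only [act, Category.assoc]
  rw [rc_nat_assoc, dl_nat_l, cm_comp_assoc, cm_comp_assoc]; simp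
theorem act_nat_assoc (f : X ⟶ X') (v : I ⟶ Y ⊗ D) (h : (X' ⊠ Y) ⊗ D ⟶ Z) :
    f ≫ act X' v ≫ h = act X v ≫ cm f (𝟙 Y) ▷ D ≫ h := by
  rw [← Category.assoc, act_nat]; simp
theorem act_r (X : Ob P) (v : I ⟶ Y ⊗ D) (g : D ⟶ G) :
    act X (v ≫ Y ◁ g) = act X v ≫ _ ◁ g := by
  simp only [act, Category.assoc]
  rw [dl_nat_r, cm_comp_assoc]; simp
theorem act_m (X : Ob P) (v : I ⟶ Y ⊗ D) (f : Y ⟶ Y') :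
    act X (v ≫ f ▷ D) = act X v ≫ cm (𝟙 X) f ▷ D := by
  simp only [act, Category.assoc]
  rw [dl_nat_m, cm_comp_assoc]; simp
theorem act_disj (X : Ob P) (v : I ⟶ (Y ⊗ W) ⊗ D) :
    act X v ≫ dl X Y W ▷ D = act X (v ≫ (α_ _ _ _).hom) ≫ (α_ _ _ _).inv := by
  have h : cm (𝟙 X) (v ≫ (α_ Y W D).hom) = cm (𝟙 X) v ≫ cm (𝟙 X) (α_ Y W D).hom := by
    simp [cm_comp]
  simp only [act, Category.assoc]
  rw [h, Category.assoc, ← Category.assoc (cm (𝟙 X) (α_ Y W D).hom), dl_disj]; simp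
theorem act_conj (X Y : Ob P) (v : I ⟶ Z ⊗ D) :
    cm (𝟙 X) (act Y v) ≫ dl X (Y ⊠ Z) D = act (X ⊠ Y) v ≫ ac X Y Z ▷ D := by
  simp only [act, Category.assoc]
  rw [dl_conj, ← Category.assoc (cm _ v), ac_nat_r, Category.assoc, reassoc_of% (ac_unit X Y),
    cm_comp_assoc, cm_comp_assoc]; simp
theorem act_tensor (X G : Ob P) (v : I ⟶ Y ⊗ D) :
    act X v ▷ G = act (X ⊗ G) v ≫ dr X G Y ▷ D ≫ sw (X ⊠ Y) G D := by
  simp only [act, Category.assoc, comp_whiskerRight]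
  rw [← dl_dr, ← dr_unit, ← Category.assoc (cm _ _), ← dr_nat_r]; simp
theorem act_I (v : I ⟶ Y ⊗ D) : act I v = v := by
  change rc I ≫ (cm (𝟙 I) v) ≫ 𝟙 _ = v
  rw [Category.comp_id]; rfl

/-- the tensor rule -/
def tens (u : I ⟶ X ⊗ G) (v : I ⟶ Y ⊗ D) : I ⟶ ((X ⊠ Y) ⊗ D) ⊗ G := u ≫ act X v ▷ G

theorem tens_eq (u : I ⟶ X ⊗ G) (v : I ⟶ Y ⊗ D) : tens u v =
    (rc I ≫ cm u v) ≫ dl (X ⊗ G) Y D ≫ dr X G Y ▷ D ≫ sw (X ⊠ Y) G D := by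
  simp only [tens, act_tensor]; simp only [act, Category.assoc]
  rw [rc_nat_assoc, cm_comp_assoc]; simp
@[simp] theorem sw_sw (X G D : Ob P) : sw X G D ≫ sw X D G = 𝟙 _ := by
  have h : X ◁ (β_ G D).hom ≫ X ◁ (β_ D G).hom = 𝟙 _ := by
    rw [← MonoidalCategory.whiskerLeft_comp]; simp
  simp [sw, reassoc_of% h]
theorem tens_eq' (u : I ⟶ X ⊗ G) (v : I ⟶ Y ⊗ D) : tens u v =
    (rc I ≫ cm u v) ≫ dr X G (Y ⊗ D) ≫ dl X Y D ▷ G := by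
  rw [tens_eq, dl_dr]
theorem tens_comm (u : I ⟶ X ⊗ G) (v : I ⟶ Y ⊗ D) :
    tens v u ≫ (kap Y X ▷ G) ▷ D = tens u v ≫ sw (X ⊠ Y) D G := by
  have h : (rc I ≫ cm v u) ≫ kap _ _ = rc I ≫ cm u v := by
    rw [Category.assoc, ← kap_nat, ← Category.assoc, rc_kap]
  rw [tens_eq', tens_eq, dr_def, ← h, dr_def]
  simp
theorem tens_m (u : I ⟶ X ⊗ G) (v : I ⟶ Y ⊗ D) (f : X ⟶ X') (g : Y ⟶ Y') :
    tens (u ≫ f ▷ G) (v ≫ g ▷ D) = tens u v ≫ (cm f g ▷ D) ▷ G := by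
  simp only [tens, act_m, Category.assoc, ← comp_whiskerRight]
  rw [act_nat_assoc, ← comp_whiskerRight, cm_comp]; simp
theorem tens_r (u : I ⟶ X ⊗ G) (v : I ⟶ Y ⊗ D) {G' D' : Ob P} (f : G ⟶ G') (g : D ⟶ D') :
    tens (u ≫ X ◁ f) (v ≫ Y ◁ g) = tens u v ≫ (_ ◁ g) ▷ G ≫ _ ◁ f := by
  simp only [tens, act_r, Category.assoc, comp_whiskerRight]
  rw [whisker_exchange_assoc, whisker_exchange]
end
end MPN

namespace MPN
open CategoryTheory MonoidalCategory
variable {P : Type}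
open Ob OHom

/-- labelled trees over objects -/
inductive Tr (P Λ : Type) : Ob P → Type
  | nil : Tr P Λ I
  | lit (p : P) (a : Λ) : Tr P Λ (o (.letter p))
  | nlit (p : P) (a : Λ) : Tr P Λ (o (∼(.letter p)))
  | conj {A B : Form P} (x : Tr P Λ (o A)) (y : Tr P Λ (o B)) : Tr P Λ (o (A ⋏ B))
  | ten {X Y : Ob P} (x : Tr P Λ X) (y : Tr P Λ Y) : Tr P Λ (X ⊗ Y)

variable {Λ : Type}

infixr:70 " ⊛ " => Tr.ten

/-- structural isomorphisms -/
inductive OSt : ∀ {X Y : Ob P}, Tr P Λ X → Tr P Λ Y → (X ⟶ Y) → Prop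
  | id {X : Ob P} (T : Tr P Λ X) : OSt T T (𝟙 X)
  | comp {X Y Z : Ob P} {T : Tr P Λ X} {S : Tr P Λ Y} {R : Tr P Λ Z} {f : X ⟶ Y} {g : Y ⟶ Z} :
      OSt T S f → OSt S R g → OSt T R (f ≫ g)
  | ten {X Y X' Y' : Ob P} {T : Tr P Λ X} {S : Tr P Λ Y} {T' : Tr P Λ X'} {S' : Tr P Λ Y'}
      {f : X ⟶ Y} {g : X' ⟶ Y'} : OSt T S f → OSt T' S' g → OSt (T ⊛ T') (S ⊛ S') (f ⊗ₘ g)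
  | ass {X Y Z : Ob P} (T : Tr P Λ X) (S : Tr P Λ Y) (R : Tr P Λ Z) :
      OSt ((T ⊛ S) ⊛ R) (T ⊛ (S ⊛ R)) (α_ X Y Z).hom
  | ass' {X Y Z : Ob P} (T : Tr P Λ X) (S : Tr P Λ Y) (R : Tr P Λ Z) :
      OSt (T ⊛ (S ⊛ R)) ((T ⊛ S) ⊛ R) (α_ X Y Z).inv
  | br {X Y : Ob P} (T : Tr P Λ X) (S : Tr P Λ Y) : OSt (T ⊛ S) (S ⊛ T) (β_ X Y).hom
  | run {X : Ob P} (T : Tr P Λ X) : OSt (T ⊛ .nil) T (ρ_ X).hom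
  | run' {X : Ob P} (T : Tr P Λ X) : OSt T (T ⊛ .nil) (ρ_ X).inv

namespace OSt
variable {X Y Z W : Ob P} {T : Tr P Λ X} {S : Tr P Λ Y} {R : Tr P Λ Z}
theorem wr {f : X ⟶ Y} (h : OSt T S f) (R : Tr P Λ Z) : OSt (T ⊛ R) (S ⊛ R) (f ▷ Z) := by
  rw [← tensorHom_id]; exact h.ten (.id R)
theorem wl {f : X ⟶ Y} (R : Tr P Λ Z) (h : OSt T S f) : OSt (R ⊛ T) (R ⊛ S) (Z ◁ f) := by
  rw [← id_tensorHom]; exact (OSt.id R).ten h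
theorem lun (T : Tr P Λ X) : OSt (.nil ⊛ T) T (λ_ X).hom := by
  rw [← braiding_rightUnitor]; exact (br _ _).comp (run _)
theorem lun' (T : Tr P Λ X) : OSt T (.nil ⊛ T) (λ_ X).inv := by
  rw [← rightUnitor_inv_braiding]; exact (run' _).comp (br _ _)
theorem sw (T : Tr P Λ X) (S : Tr P Λ Y) (R : Tr P Λ Z) :
    OSt ((T ⊛ S) ⊛ R) ((T ⊛ R) ⊛ S) (sw X Y Z) :=
  (ass _ _ _).comp (((br _ _).wl _).comp (ass' _ _ _))
theorem inv {f : X ⟶ Y} (h : OSt T S f) : ∃ g, OSt S T g ∧ f ≫ g = 𝟙 _ ∧ g ≫ f = 𝟙 _ := by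
  induction h with
  | id T => exact ⟨_, .id T, by simp, by simp⟩
  | @comp _ _ _ _ _ _ f1 f2 _ _ h1 h2 =>
    obtain ⟨g1, a1, b1, c1⟩ := h1
    obtain ⟨g2, a2, b2, c2⟩ := h2
    refine ⟨_, a2.comp a1, ?_, ?_⟩
    · rw [Category.assoc, reassoc_of% b2, b1]
    · rw [Category.assoc, reassoc_of% c1, c2]
  | ten _ _ h1 h2 =>
    obtain ⟨g1, a1, b1, c1⟩ := h1
    obtain ⟨g2, a2, b2, c2⟩ := h2
    exact ⟨_, a1.ten a2, by rw [tensorHom_comp_tensorHom, b1, b2]; simp, by rw [tensorHom_comp_tensorHom, c1, c2]; simp⟩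
  | ass T S R => exact ⟨_, .ass' T S R, by simp, by simp⟩
  | ass' T S R => exact ⟨_, .ass T S R, by simp, by simp⟩
  | br T S => exact ⟨_, .br S T, by simp, by simp⟩
  | run T => exact ⟨_, .run' T, by simp, by simp⟩
  | run' T => exact ⟨_, .run T, by simp, by simp⟩
end OSt

abbrev Lf (P Λ : Type) : Type := Σ A : Ob P, Tr P Λ A

def leaves : ∀ {X : Ob P}, Tr P Λ X → Multiset (Lf P Λ)
  | _, .nil => 0
  | _, .lit p a => {⟨_, .lit p a⟩}
  | _, .nlit p a => {⟨_, .nlit p a⟩}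
  | _, .conj x y => {⟨_, .conj x y⟩}
  | _, .ten x y => leaves x + leaves y

theorem OSt.leaves_eq {X Y : Ob P} {T : Tr P Λ X} {S : Tr P Λ Y} {f : X ⟶ Y} (h : OSt T S f) :
    leaves T = leaves S := by
  induction h with
  | id T => rfl
  | comp _ _ h1 h2 => rw [h1, h2]
  | ten _ _ h1 h2 => simp [leaves, h1, h2]
  | ass T S R => simp [leaves, add_assoc]
  | ass' T S R => simp [leaves, add_assoc]
  | br T S => simp [leaves, add_comm]
  | run T => simp [leaves]
  | run' T => simp [leaves]

/-- extraction of a leaf -/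
structure Spl (P Λ : Type) (X : Ob P) where
  A : Ob P
  l : Tr P Λ A
  Y : Ob P
  R : Tr P Λ Y
  e : X ⟶ A ⊗ Y

def Spl.left {X : Ob P} (s : Spl P Λ X) {Z : Ob P} (S : Tr P Λ Z) : Spl P Λ (X ⊗ Z) :=
  ⟨s.A, s.l, s.Y ⊗ Z, s.R ⊛ S, s.e ▷ Z ≫ (α_ _ _ _).hom⟩
/-- moving a middle factor to the front -/
def mid (Z A Y : Ob P) : Z ⊗ (A ⊗ Y) ⟶ A ⊗ (Z ⊗ Y) :=
  (α_ Z A Y).inv ≫ (β_ Z A).hom ▷ Y ≫ (α_ A Z Y).hom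
def Spl.right {X : Ob P} (s : Spl P Λ X) {Z : Ob P} (S : Tr P Λ Z) : Spl P Λ (Z ⊗ X) :=
  ⟨s.A, s.l, Z ⊗ s.Y, S ⊛ s.R, Z ◁ s.e ≫ mid Z s.A s.Y⟩

def At : ∀ {X : Ob P}, Tr P Λ X → Spl P Λ X → Prop
  | _, .nil, _ => False
  | _, .lit p a, s => s = ⟨_, .lit p a, I, .nil, (ρ_ _).inv⟩
  | _, .nlit p a, s => s = ⟨_, .nlit p a, I, .nil, (ρ_ _).inv⟩
  | _, .conj x y, s => s = ⟨_, .conj x y, I, .nil, (ρ_ _).inv⟩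
  | _, .ten x y, s => (∃ s', At x s' ∧ s = s'.left y) ∨ (∃ s', At y s' ∧ s = s'.right x)

theorem OSt.mid {X Y Z : Ob P} (T : Tr P Λ X) (S : Tr P Λ Y) (R : Tr P Λ Z) :
    OSt (T ⊛ (S ⊛ R)) (S ⊛ (T ⊛ R)) (mid X Y Z) :=
  (ass' _ _ _).comp (((br _ _).wr _).comp (ass _ _ _))

theorem At.ost {X : Ob P} {T : Tr P Λ X} {s : Spl P Λ X} (h : At T s) : OSt T (s.l ⊛ s.R) s.e := by
  induction T with
  | nil => exact h.elim
  | lit p a => cases h; exact .run' _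
  | nlit p a => cases h; exact .run' _
  | conj p a => cases h; exact .run' _
  | ten x y h1 h2 =>
    rcases h with ⟨s', h, rfl⟩ | ⟨s', h, rfl⟩
    · exact ((h1 h).wr _).comp (.ass _ _ _)
    · exact ((h2 h).wl _).comp (.mid _ _ _)
theorem At.leaf {X : Ob P} {T : Tr P Λ X} {s : Spl P Λ X} (h : At T s) :
    leaves s.l = {⟨_, s.l⟩} := by
  induction T with
  | nil => exact h.elim
  | lit p a => cases h; rfl
  | nlit p a => cases h; rfl
  | conj p a => cases h; rfl
  | ten x y h1 h2 =>
    rcases h with ⟨s', h, rfl⟩ | ⟨s', h, rfl⟩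
    · exact h1 h
    · exact h2 h
theorem At.leaves_eq {X : Ob P} {T : Tr P Λ X} {s : Spl P Λ X} (h : At T s) :
    leaves T = ⟨_, s.l⟩ ::ₘ leaves s.R := by
  rw [h.ost.leaves_eq]; change leaves s.l + leaves s.R = _; rw [h.leaf]; rfl
theorem exists_at {X : Ob P} {T : Tr P Λ X} {A : Ob P} {l : Tr P Λ A}
    (h : (⟨A, l⟩ : Lf P Λ) ∈ leaves T) : ∃ Y R e, At T ⟨A, l, Y, R, e⟩ := by
  induction T with
  | nil => simp [leaves] at h
  | lit p a => obtain rfl : A = _ := by simp [leaves] at h; exact h.1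
               obtain rfl : l = _ := by simpa [leaves] using h
               exact ⟨_, _, _, rfl⟩
  | nlit p a => obtain rfl : A = _ := by simp [leaves] at h; exact h.1
                obtain rfl : l = _ := by simpa [leaves] using h
                exact ⟨_, _, _, rfl⟩
  | conj p a => obtain rfl : A = _ := by simp [leaves] at h; exact h.1
                obtain rfl : l = _ := by simpa [leaves] using h
                exact ⟨_, _, _, rfl⟩
  | ten x y h1 h2 =>
    rcases Multiset.mem_add.1 h with h | h
    · obtain ⟨Y, R, e, h⟩ := h1 h
      exact ⟨_, _, _, .inl ⟨_, h, rfl⟩⟩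
    · obtain ⟨Y, R, e, h⟩ := h2 h
      exact ⟨_, _, _, .inr ⟨_, h, rfl⟩⟩
theorem At.mem {X : Ob P} {T : Tr P Λ X} {s : Spl P Λ X} (h : At T s) :
    (⟨_, s.l⟩ : Lf P Λ) ∈ leaves T := by rw [h.leaves_eq]; simp

theorem exists_ost : ∀ (n : ℕ) {X Y : Ob P} (T : Tr P Λ X) (S : Tr P Λ Y), (leaves T).card = n →
    leaves T = leaves S → ∃ f, OSt T S f := by
  have h0 : ∀ {X : Ob P} (T : Tr P Λ X), leaves T = 0 → ∃ f, OSt T .nil f := by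
    intro X T h
    induction T with
    | nil => exact ⟨_, .id _⟩
    | ten x y h1 h2 =>
      have h := add_eq_zero.1 h
      obtain ⟨f, hf⟩ := h1 h.1
      obtain ⟨g, hg⟩ := h2 h.2
      exact ⟨_, (hf.ten hg).comp (.run _)⟩
    | _ => simp [leaves] at h
  intro n
  induction n with
  | zero =>
    intro X Y T S hn hTS
    obtain ⟨f, hf⟩ := h0 T (by simpa using hn)
    obtain ⟨g, hg⟩ := h0 S (by rw [← hTS]; simpa using hn)
    obtain ⟨g', hg', _⟩ := hg.inv
    exact ⟨_, hf.comp hg'⟩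
  | succ n ih =>
    intro X Y T S hn hTS
    obtain ⟨⟨A, l⟩, hl⟩ := Multiset.card_pos_iff_exists_mem.1 (by omega : 0 < (leaves T).card)
    obtain ⟨Y1, R1, e1, h1⟩ := exists_at hl
    obtain ⟨Y2, R2, e2, h2⟩ := exists_at (hTS ▸ hl)
    have e : leaves R1 = leaves R2 := by
      have := h1.leaves_eq.symm.trans (hTS.trans h2.leaves_eq)
      simpa using this
    obtain ⟨r, hr⟩ := ih R1 R2 (by rw [h1.leaves_eq] at hn; simpa using hn) e
    obtain ⟨g, hg, _⟩ := h2.ost.inv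
    exact ⟨_, (h1.ost.comp (hr.wl _)).comp hg⟩

theorem ost_of_leaves {X Y : Ob P} {T : Tr P Λ X} {S : Tr P Λ Y} (h : leaves T = leaves S) :
    ∃ f, OSt T S f := exists_ost _ T S rfl h

theorem At.unique {X : Ob P} {T : Tr P Λ X} (hn : (leaves T).Nodup) {s s' : Spl P Λ X}
    (h : At T s) (h' : At T s') (hl : (⟨_, s.l⟩ : Lf P Λ) = ⟨_, s'.l⟩) : s = s' := by
  induction T with
  | nil => exact h.elim
  | lit p a => cases h; cases h'; rfl
  | nlit p a => cases h; cases h'; rfl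
  | conj p a => cases h; cases h'; rfl
  | ten x y h1 h2 =>
    obtain ⟨n1, n2, nd⟩ := Multiset.nodup_add.1 hn
    rcases h with ⟨s, h, rfl⟩ | ⟨s, h, rfl⟩ <;> rcases h' with ⟨s', h', rfl⟩ | ⟨s', h', rfl⟩
    · rw [h1 n1 h h' hl]
    · exact (Multiset.disjoint_left.1 nd h.mem (by have := h'.mem; rw [← show (⟨_, s.l⟩ : Lf P Λ) = ⟨_, s'.l⟩ from hl] at this; exact this)).elim
    · exact (Multiset.disjoint_left.1 nd h'.mem (by have := h.mem; rw [show (⟨_, s.l⟩ : Lf P Λ) = ⟨_, s'.l⟩ from hl] at this; exact this)).elim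
    · rw [h2 n2 h h' hl]
end MPN

namespace MPN
open CategoryTheory MonoidalCategory
variable {P : Type} {Λ : Type}
open Ob OHom

section coh
variable {C : Type*} [Category C] [MonoidalCategory C] [SymmetricCategory C]
theorem coh_ass1 (A Y S R : C) : (α_ (A ⊗ Y) S R).hom ≫ (α_ A Y (S ⊗ R)).hom =
    (α_ A Y S).hom ▷ R ≫ (α_ A (Y ⊗ S) R).hom ≫ A ◁ (α_ Y S R).hom := by simp
end coh

theorem mid_ass2 (T A Y R : Ob P) : (α_ T (A ⊗ Y) R).hom ≫ T ◁ (α_ A Y R).hom ≫ mid T A (Y ⊗ R) =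
    mid T A Y ▷ R ≫ (α_ A (T ⊗ Y) R).hom ≫ A ◁ (α_ T Y R).hom := by
  simp [mid]
theorem mid_ass3 (T S A Y : Ob P) : (α_ T S (A ⊗ Y)).hom ≫ T ◁ mid S A Y ≫ mid T A (S ⊗ Y) =
    mid (T ⊗ S) A Y ≫ A ◁ (α_ T S Y).hom := by
  simp [mid, BraidedCategory.braiding_tensor_left_hom]
theorem mid_br1 (A Y S : Ob P) : (β_ (A ⊗ Y) S).hom ≫ mid S A Y = (α_ A Y S).hom ≫ A ◁ (β_ Y S).hom := by
  have h : (β_ A S).hom ▷ Y ≫ (β_ S A).hom ▷ Y = 𝟙 _ := by rw [← comp_whiskerRight]; simp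
  simp [mid, BraidedCategory.braiding_tensor_left_hom, reassoc_of% h]
theorem mid_br2 (A Y S : Ob P) : (β_ S (A ⊗ Y)).hom ≫ (α_ A Y S).hom = mid S A Y ≫ A ◁ (β_ S Y).hom := by
  simp [mid, BraidedCategory.braiding_tensor_right_hom]
theorem mid_nat (Z A : Ob P) {Z' Y Y' : Ob P} (f : Z ⟶ Z') (g : Y ⟶ Y') :
    (f ⊗ₘ (A ◁ g)) ≫ mid Z' A Y' = mid Z A Y ≫ A ◁ (f ⊗ₘ g) := by
  have h : ((f ⊗ₘ 𝟙 A) ⊗ₘ g) ≫ (β_ Z' A).hom ▷ Y' = (β_ Z A).hom ▷ Y ≫ ((𝟙 A ⊗ₘ f) ⊗ₘ g) := by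
    rw [← tensorHom_id, ← tensorHom_id, tensorHom_comp_tensorHom, tensorHom_comp_tensorHom,
      BraidedCategory.braiding_naturality]; simp
  rw [mid, mid, ← id_tensorHom, ← id_tensorHom, associator_inv_naturality_assoc, reassoc_of% h,
    associator_naturality]; simp

theorem OSt.ES {X Y : Ob P} {T : Tr P Λ X} {S : Tr P Λ Y} {e : X ⟶ Y} (h : OSt T S e) :
    ∀ s, At T s → ∃ Y' R' e' r, At S ⟨s.A, s.l, Y', R', e'⟩ ∧ OSt s.R R' r ∧ e ≫ e' = s.e ≫ s.A ◁ r := by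
  induction h with
  | id T => exact fun s hs => ⟨_, _, _, _, hs, .id _, by simp⟩
  | comp _ _ h1 h2 =>
    intro s hs
    obtain ⟨Y1, R1, e1, r1, a1, b1, c1⟩ := h1 s hs
    obtain ⟨Y2, R2, e2, r2, a2, b2, c2⟩ := h2 _ a1
    refine ⟨_, _, _, _, a2, b1.comp b2, ?_⟩
    rw [Category.assoc, c2, reassoc_of% c1]; simp
  | @ten _ _ _ _ _ _ _ _ f g hf hg h1 h2 =>
    rintro s (⟨s, hs, rfl⟩ | ⟨s, hs, rfl⟩)
    · obtain ⟨Y1, R1, e1, r1, a1, b1, c1⟩ := h1 s hs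
      refine ⟨_, _, _, _, .inl ⟨_, a1, rfl⟩, b1.ten hg, ?_⟩
      have : (f ⊗ₘ g) ≫ e1 ▷ _ = (s.e ≫ s.A ◁ r1) ▷ _ ≫ _ ◁ g := by
        rw [← c1, MonoidalCategory.tensorHom_def, comp_whiskerRight, Category.assoc, whisker_exchange, Category.assoc]
      dsimp only [Spl.left]
      rw [reassoc_of% this]
      simp [MonoidalCategory.tensorHom_def]
    · obtain ⟨Y1, R1, e1, r1, a1, b1, c1⟩ := h2 s hs
      refine ⟨_, _, _, _, .inr ⟨_, a1, rfl⟩, hf.ten b1, ?_⟩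
      have : (f ⊗ₘ g) ≫ _ ◁ e1 = _ ◁ s.e ≫ (f ⊗ₘ (s.A ◁ r1)) := by
        rw [MonoidalCategory.tensorHom_def, Category.assoc, ← whiskerLeft_comp, c1, MonoidalCategory.tensorHom_def]
        rw [MonoidalCategory.whiskerLeft_comp, ← Category.assoc, ← whisker_exchange, Category.assoc]
      dsimp only [Spl.right]
      rw [reassoc_of% this, mid_nat, Category.assoc]
  | ass T S R =>
    rintro s (⟨s, (⟨s, hs, rfl⟩ | ⟨s, hs, rfl⟩), rfl⟩ | ⟨s, hs, rfl⟩)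
    · refine ⟨_, _, _, _, .inl ⟨_, hs, rfl⟩, .ass _ _ _, ?_⟩
      dsimp only [Spl.left]
      simp
    · refine ⟨_, _, _, _, .inr ⟨_, .inl ⟨_, hs, rfl⟩, rfl⟩, .ass _ _ _, ?_⟩
      dsimp only [Spl.left, Spl.right]
      have := mid_ass2 (P := P) 
      simp only [whiskerLeft_comp, comp_whiskerRight, Category.assoc] at this ⊢
      rw [← this]; simp
    · refine ⟨_, _, _, _, .inr ⟨_, .inr ⟨_, hs, rfl⟩, rfl⟩, .ass _ _ _, ?_⟩
      dsimp only [Spl.left, Spl.right]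
      have := mid_ass3 (P := P) 
      simp only [whiskerLeft_comp, comp_whiskerRight, Category.assoc] at this ⊢
      rw [← this]; simp
  | ass' T S R =>
    rintro s (⟨s, hs, rfl⟩ | ⟨s, (⟨s, hs, rfl⟩ | ⟨s, hs, rfl⟩), rfl⟩)
    · refine ⟨_, _, _, _, .inl ⟨_, .inl ⟨_, hs, rfl⟩, rfl⟩, .ass' _ _ _, ?_⟩
      dsimp only [Spl.left]
      simp
    · refine ⟨_, _, _, _, .inl ⟨_, .inr ⟨_, hs, rfl⟩, rfl⟩, .ass' _ _ _, ?_⟩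
      dsimp only [Spl.left, Spl.right]
      have := fun T A Y R => (mid_ass2 (P := P) T A Y R) =≫ A ◁ (α_ T Y R).inv
      simp at this
      rw [Iso.inv_comp_eq]
      simp [← this]
    · refine ⟨_, _, _, _, .inr ⟨_, hs, rfl⟩, .ass' _ _ _, ?_⟩
      dsimp only [Spl.left, Spl.right]
      have := fun T A Y R => (mid_ass3 (P := P) T A Y R) =≫ Y ◁ (α_ T A R).inv
      simp at this
      rw [Iso.inv_comp_eq]
      simp [← this]
  | br T S =>
    rintro s (⟨s, hs, rfl⟩ | ⟨s, hs, rfl⟩)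
    · refine ⟨_, _, _, _, .inr ⟨_, hs, rfl⟩, .br _ _, ?_⟩
      dsimp only [Spl.left, Spl.right]
      rw [Category.assoc, ← mid_br1, ← Category.assoc, ← BraidedCategory.braiding_naturality_left, Category.assoc]
    · refine ⟨_, _, _, _, .inl ⟨_, hs, rfl⟩, .br _ _, ?_⟩
      dsimp only [Spl.left, Spl.right]
      rw [Category.assoc, ← mid_br2, ← Category.assoc, ← BraidedCategory.braiding_naturality_right, Category.assoc]
  | run T =>
    rintro s (⟨s, hs, rfl⟩ | ⟨s, hs, rfl⟩)
    · refine ⟨_, _, _, _, hs, .run _, ?_⟩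
      dsimp only [Spl.left, Spl.right]
      change (ρ_ _).hom ≫ s.e = (s.e ▷ 𝟙_ (Ob P) ≫ (α_ s.A s.Y (𝟙_ (Ob P))).hom) ≫ _
      simp
    · exact hs.elim
  | run' T =>
    intro s hs
    refine ⟨_, _, _, _, .inl ⟨_, hs, rfl⟩, .run' _, ?_⟩
    change (ρ_ _).inv ≫ (s.e ▷ 𝟙_ (Ob P) ≫ (α_ s.A s.Y (𝟙_ (Ob P))).hom) = s.e ≫ s.A ◁ (ρ_ _).inv
    simp

theorem obj_of_leafless {X : Ob P} (T : Tr P Λ X) (h : leaves T = 0) : X = I := by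
  induction T with
  | nil => rfl
  | ten x y h1 h2 =>
    have h := add_eq_zero.1 h
    rw [h1 h.1, h2 h.2]; rfl
  | _ => simp [leaves] at h

theorem hom_I_I (f g : (I : Ob P) ⟶ I) : f = g := by
  revert f g
  intro (f : OHom I I) (g : OHom I I)
  cases f; cases g; rfl

theorem OSt.ML : ∀ (n : ℕ) {X Y : Ob P} {T : Tr P Λ X} {S : Tr P Λ Y} {e e' : X ⟶ Y},
    (leaves T).card = n → OSt T S e → OSt T S e' → (leaves T).Nodup → e = e' := by
  intro n
  induction n with
  | zero =>
    intro X Y T S e e' hn h h' hd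
    have h0 : leaves T = 0 := by simpa using hn
    obtain rfl := obj_of_leafless T h0
    obtain rfl := obj_of_leafless S (h.leaves_eq ▸ h0)
    exact hom_I_I _ _
  | succ n ih =>
    intro X Y T S e e' hn h h' hd
    obtain ⟨⟨A, l⟩, hl⟩ := Multiset.card_pos_iff_exists_mem.1 (by omega : 0 < (leaves T).card)
    obtain ⟨Y1, R1, e1, h1⟩ := exists_at hl
    obtain ⟨Y2, R2, e2, r2, a2, b2, c2⟩ := h.ES _ h1
    obtain ⟨Y3, R3, e3, r3, a3, b3, c3⟩ := h'.ES _ h1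
    have := At.unique (h.leaves_eq ▸ hd) a2 a3 rfl
    cases this
    have hh := h1.leaves_eq
    rw [hh] at hn hd
    have : r2 = r3 := ih (by simpa using hn) b2 b3 (Multiset.nodup_cons.1 hd).2
    subst this
    obtain ⟨k, _, hk, _⟩ := a2.ost.inv
    have := (c2.trans c3.symm) =≫ k
    dsimp only at hk
    simpa [hk] using this

theorem OSt.unique {X Y : Ob P} {T : Tr P Λ X} {S : Tr P Λ Y} {e e' : X ⟶ Y}
    (h : OSt T S e) (h' : OSt T S e') (hd : (leaves T).Nodup) : e = e' := ML _ rfl h h' hd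
end MPN

namespace MPN
open CategoryTheory MonoidalCategory
variable {P : Type} {Λ : Type}
open Ob OHom

inductive Pr (P Λ : Type) : Ob P → Ob P → Type
  | mix : Pr P Λ I I
  | conj {A B : Form P} (x : Tr P Λ (o A)) (y : Tr P Λ (o B)) : Pr P Λ (o A) (o B)

def Pr.L : ∀ {X Y : Ob P}, Pr P Λ X Y → Tr P Λ X
  | _, _, .mix => .nil
  | _, _, .conj x _ => x
def Pr.R : ∀ {X Y : Ob P}, Pr P Λ X Y → Tr P Λ Y
  | _, _, .mix => .nil
  | _, _, .conj _ y => y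
def Pr.C : ∀ {X Y : Ob P}, Pr P Λ X Y → Tr P Λ (X ⊠ Y)
  | _, _, .mix => .nil
  | _, _, .conj x y => .conj x y

/-- the axiom point -/
def axp (p : P) : (I : Ob P) ⟶ o (∼(.letter p)) ⊗ o (.letter p) := OHom.pt (ptDel (.letter p))

inductive CF : ∀ {X : Ob P}, Tr P Λ X → (I ⟶ X) → Prop
  | unit : CF .nil (𝟙 I)
  | ax (p : P) (a : Λ) : CF (.nlit p a ⊛ .lit p a) (axp p)
  | ten {X Y G D : Ob P} (p : Pr P Λ X Y) {TG : Tr P Λ G} {TD : Tr P Λ D} {u v} :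
      CF (p.L ⊛ TG) u → CF (p.R ⊛ TD) v → CF ((p.C ⊛ TD) ⊛ TG) (tens u v)
  | st {X Y : Ob P} {T : Tr P Λ X} {S : Tr P Λ Y} {u e} : CF T u → OSt T S e → CF S (u ≫ e)

structure Pres {X Y : Ob P} (T : Tr P Λ X) (S : Tr P Λ Y) (f : X ⟶ Y) : Prop where
  h : ∀ {Z : Ob P} (R : Tr P Λ Z) (t : I ⟶ X ⊗ Z), CF (T ⊛ R) t → CF (S ⊛ R) (t ≫ f ▷ Z)

section
variable {X Y Z W X' Y' G D : Ob P} {T : Tr P Λ X} {S : Tr P Λ Y} {R : Tr P Λ Z}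

theorem CF.st' {u : I ⟶ X} {e : X ⟶ Y} {w : I ⟶ Y} (h : CF T u) (he : OSt T S e) (hw : u ≫ e = w) :
    CF S w := hw ▸ h.st he
theorem Pres.id (T : Tr P Λ X) : Pres T T (𝟙 X) := ⟨fun R t h => by simpa using h⟩
theorem Pres.comp {f : X ⟶ Y} {g : Y ⟶ Z} (h : Pres T S f) (h' : Pres S R g) : Pres T R (f ≫ g) :=
  ⟨fun U t ht => by have := h'.h U _ (h.h U t ht); simpa using this⟩
theorem OSt.pres {f : X ⟶ Y} (h : OSt T S f) : Pres T S f := ⟨fun R _ ht => ht.st (h.wr R)⟩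
theorem Pres.wr {f : X ⟶ Y} (h : Pres T S f) (R : Tr P Λ Z) : Pres (T ⊛ R) (S ⊛ R) (f ▷ Z) := by
  refine ⟨fun U t ht => ?_⟩
  have := (h.h _ _ (ht.st (.ass _ _ _))).st (.ass' _ _ _)
  simpa using this
theorem Pres.wl {f : X ⟶ Y} (R : Tr P Λ Z) (h : Pres T S f) : Pres (R ⊛ T) (R ⊛ S) (Z ◁ f) := by
  have := ((OSt.br R T).pres.comp (h.wr R)).comp (OSt.br S R).pres
  simpa [BraidedCategory.braiding_naturality_left_assoc] using this
theorem Pres.ten {f : X ⟶ Y} {g : X' ⟶ Y'} {T' : Tr P Λ X'} {S' : Tr P Λ Y'}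
    (h : Pres T S f) (h' : Pres T' S' g) : Pres (T ⊛ T') (S ⊛ S') (f ⊗ₘ g) := by
  rw [MonoidalCategory.tensorHom_def]; exact (h.wr _).comp (h'.wl _)
theorem Pres.app {f : X ⟶ Y} {u : I ⟶ X} (h : Pres T S f) (hu : CF T u) : CF S (u ≫ f) := by
  have := (h.h _ _ (hu.st (.run' _))).st (.run _)
  have e : (ρ_ X).inv ≫ f ▷ 𝟙_ (Ob P) ≫ (ρ_ Y).hom = f := by simp
  convert this using 1
  simp only [Category.assoc]
  exact (u ≫= e).symm
theorem Pres.act (p : Pr P Λ X Y) {TD : Tr P Λ D} {v : I ⟶ Y ⊗ D} (h : CF (p.R ⊛ TD) v) :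
    Pres p.L (p.C ⊛ TD) (MPN.act X v) := ⟨fun _ _ ht => CF.ten p ht h⟩
/-- action on the right conjunct -/
def actR (Y : Ob P) (u : I ⟶ X ⊗ G) : Y ⟶ (X ⊠ Y) ⊗ G := MPN.act Y u ≫ kap Y X ▷ G
theorem tens_actR (u : I ⟶ X ⊗ G) (v : I ⟶ Y ⊗ D) : tens u v = v ≫ actR Y u ▷ D ≫ sw (X ⊠ Y) G D := by
  have := tens_comm u v =≫ sw (X ⊠ Y) G D
  simp only [Category.assoc, sw_sw, Category.comp_id] at this
  rw [← this]; simp [tens, actR]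
theorem Pres.actR (p : Pr P Λ X Y) {TG : Tr P Λ G} {u : I ⟶ X ⊗ G} (h : CF (p.L ⊛ TG) u) :
    Pres p.R (p.C ⊛ TG) (MPN.actR Y u) := by
  refine ⟨fun R t ht => ?_⟩
  have := (CF.ten p h ht).st (OSt.sw _ _ _)
  rw [tens_actR] at this; simpa using this
end

/-- the possible principal rules above a leaf -/
inductive Prin : ∀ {A Y : Ob P}, Tr P Λ A → Tr P Λ Y → (I ⟶ A ⊗ Y) → Prop
  | lit (p : P) (a : Λ) : Prin (.lit p a) (.nlit p a) (axp p ≫ (β_ _ _).hom)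
  | nlit (p : P) (a : Λ) : Prin (.nlit p a) (.lit p a) (axp p)
  | conj {A B : Form P} {G D : Ob P} (x : Tr P Λ (o A)) (y : Tr P Λ (o B)) {TG : Tr P Λ G}
      {TD : Tr P Λ D} {u v} :
      CF (x ⊛ TG) u → CF (y ⊛ TD) v → Prin (.conj x y) (TD ⊛ TG) (tens u v ≫ (α_ _ _ _).hom)

theorem mid_nat_r (Z A : Ob P) {Y Y' : Ob P} (g : Y ⟶ Y') :
    Z ◁ A ◁ g ≫ mid Z A Y' = mid Z A Y ≫ A ◁ Z ◁ g := by
  have := mid_nat Z A (𝟙 Z) g; simpa using this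
theorem mid_nat_l {Z Z' : Ob P} (A : Ob P) (Y : Ob P) (f : Z ⟶ Z') :
    f ▷ (A ⊗ Y) ≫ mid Z' A Y = mid Z A Y ≫ A ◁ f ▷ Y := by
  have := mid_nat Z A f (𝟙 Y); simpa using this

theorem mid_sw (A X G D : Ob P) : sw X G (A ⊗ D) ≫ mid X A D ▷ G ≫ (α_ _ _ _).hom =
    mid (X ⊗ G) A D ≫ A ◁ sw X G D := by
  have h := (α_ X A (G ⊗ D)).inv ≫= whisker_exchange (β_ X A).hom (β_ G D).hom =≫
    ((α_ _ _ _).inv ≫ (α_ A X D).hom ▷ G ≫ (α_ A (X ⊗ D) G).hom)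
  simp only [tensor_whiskerLeft, whiskerRight_tensor, Category.assoc, Iso.inv_hom_id_assoc,
    Iso.hom_inv_id_assoc] at h
  simp [sw, mid, BraidedCategory.braiding_tensor_left_hom, BraidedCategory.braiding_tensor_right_hom]
  rw [h]; simp
theorem sw_nat_r (X G : Ob P) {D D' : Ob P} (f : D ⟶ D') :
    (X ⊗ G) ◁ f ≫ sw X G D' = sw X G D ≫ (X ◁ f) ▷ G := by
  have h : X ◁ G ◁ f ≫ X ◁ (β_ G D').hom = X ◁ (β_ G D).hom ≫ X ◁ f ▷ G := by
    rw [← MonoidalCategory.whiskerLeft_comp, BraidedCategory.braiding_naturality_right]; simp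
  simp only [sw, tensor_whiskerLeft, Category.assoc, Iso.inv_hom_id_assoc, reassoc_of% h]
  simp

theorem CF.LP {X : Ob P} {T : Tr P Λ X} {u : I ⟶ X} (h : CF T u) : ∀ s, At T s →
    ∃ (Y0 : Ob P) (R0 : Tr P Λ Y0) (w0 : I ⟶ s.A ⊗ Y0) (g : Y0 ⟶ s.Y),
      Prin s.l R0 w0 ∧ Pres R0 s.R g ∧ u ≫ s.e = w0 ≫ s.A ◁ g := by
  induction h with
  | unit => exact fun s hs => hs.elim
  | ax p a =>
    rintro s (⟨s, hs, rfl⟩ | ⟨s, hs, rfl⟩)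
    · cases hs
      refine ⟨_, _, _, (λ_ _).inv, .nlit p a, (OSt.lun' _).pres, ?_⟩
      dsimp only [Spl.left]
      congr 1
      exact triangle_assoc_comp_right_inv _ _
    · cases hs
      refine ⟨_, _, _, (ρ_ _).inv, .lit p a, (OSt.run' _).pres, ?_⟩
      dsimp only [Spl.right]
      rw [Category.assoc]
      congr 1
      change _ ◁ (ρ_ _).inv ≫ mid _ _ (𝟙_ (Ob P)) = _
      simp [mid]
  | @st X Y T S u e hu he ih =>
    intro s hs
    obtain ⟨i, hi, h1, h2⟩ := he.inv
    obtain ⟨Y', R', e', r, a1, b1, c1⟩ := hi.ES s hs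
    obtain ⟨r', hr', k1, k2⟩ := b1.inv
    obtain ⟨Y0, R0, w0, g, ha, hb, hc⟩ := ih _ a1
    refine ⟨_, _, _, g ≫ r', ha, hb.comp hr'.pres, ?_⟩
    have h3 : e ≫ s.e = e' ≫ s.A ◁ r' := by
      have := e ≫= c1 =≫ s.A ◁ r'
      simp only [Category.assoc, reassoc_of% h1, ← MonoidalCategory.whiskerLeft_comp, k1] at this
      simpa using this.symm
    dsimp only at hc
    rw [Category.assoc, h3, reassoc_of% hc]; simp
  | @ten X Y G D p TG TD u v hu hv h1 h2 =>
    rintro s (⟨s, (⟨s, hs, rfl⟩ | ⟨s, hs, rfl⟩), rfl⟩ | ⟨s, hs, rfl⟩)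
    · cases p with
      | mix => exact hs.elim
      | conj x y =>
        cases hs
        refine ⟨_, _, _, (λ_ _).inv ▷ _, .conj x y hu hv, ((OSt.lun' _).pres.wr _), ?_⟩
        dsimp only [Spl.left]
        change _ ≫ (((ρ_ _).inv ▷ D ≫ (α_ _ (𝟙_ (Ob P)) _).hom) ▷ G ≫ (α_ _ (𝟙_ (Ob P) ⊗ _) _).hom) = _
        simp
        exact (Category.assoc _ _ _).symm
    · obtain ⟨Y0, R0, (w0 : I ⟶ s.A ⊗ Y0), (g : Y0 ⟶ Y ⊗ s.Y), ha, hb,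
        (hc : v ≫ Y ◁ s.e ≫ mid Y s.A s.Y = w0 ≫ s.A ◁ g)⟩ := h2 _ (.inr ⟨s, hs, rfl⟩)
      refine ⟨Y0, R0, w0, g ≫ actR Y u ▷ s.Y ≫ sw _ _ _, ha,
        hb.comp (((Pres.actR p hu).wr _).comp (OSt.sw _ _ _).pres), ?_⟩
      dsimp only [Spl.left, Spl.right]
      rw [MonoidalCategory.whiskerLeft_comp, ← reassoc_of% hc, tens_actR,
        MonoidalCategory.whiskerLeft_comp, ← reassoc_of% (mid_nat_l s.A s.Y (actR Y u)), ← mid_sw,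
        reassoc_of% (whisker_exchange (actR Y u) s.e), reassoc_of% (sw_nat_r (X ⊠ Y) G s.e)]
      simp
    · obtain ⟨Y0, R0, (w0 : I ⟶ s.A ⊗ Y0), (g : Y0 ⟶ X ⊗ s.Y), ha, hb,
        (hc : u ≫ X ◁ s.e ≫ mid X s.A s.Y = w0 ≫ s.A ◁ g)⟩ := h1 _ (.inr ⟨s, hs, rfl⟩)
      refine ⟨Y0, R0, w0, g ≫ act X v ▷ s.Y, ha, hb.comp ((Pres.act p hv).wr _), ?_⟩
      dsimp only [Spl.left, Spl.right]
      rw [MonoidalCategory.whiskerLeft_comp, ← reassoc_of% hc, ← mid_nat_l, tens, ← Category.assoc,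
        Category.assoc u, ← whisker_exchange]
      simp
end MPN

namespace MPN
open CategoryTheory MonoidalCategory
variable {P : Type} {Λ : Type}
open Ob OHom

theorem CF.LPleaf {A Z : Ob P} {l : Tr P Λ A} {R : Tr P Λ Z} {t : I ⟶ A ⊗ Z} (h : CF (l ⊛ R) t)
    (hl : At l ⟨A, l, I, .nil, (ρ_ A).inv⟩) : ∃ (Y0 : Ob P) (R0 : Tr P Λ Y0) (w0 : I ⟶ A ⊗ Y0)
      (g : Y0 ⟶ Z), Prin l R0 w0 ∧ Pres R0 R g ∧ t = w0 ≫ A ◁ g := by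
  obtain ⟨Y0, R0, (w0 : I ⟶ A ⊗ Y0), (g : Y0 ⟶ 𝟙_ (Ob P) ⊗ Z), ha, hb, hc⟩ :=
    h.LP _ (.inl ⟨_, hl, rfl⟩)
  refine ⟨Y0, R0, w0, g ≫ (λ_ Z).hom, ha, hb.comp (OSt.lun R).pres, ?_⟩
  change t ≫ (ρ_ A).inv ▷ Z ≫ (α_ _ (𝟙_ (Ob P)) _).hom = w0 ≫ A ◁ g at hc
  rw [MonoidalCategory.whiskerLeft_comp, ← reassoc_of% hc]
  simp

theorem CF.LPc {A B : Form P} {Z : Ob P} {x : Tr P Λ (o A)} {y : Tr P Λ (o B)} {R : Tr P Λ Z}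
    {t} (h : CF (.conj x y ⊛ R) t) : ∃ (G D : Ob P) (TG : Tr P Λ G) (TD : Tr P Λ D)
      (u : I ⟶ o A ⊗ G) (v : I ⟶ o B ⊗ D) (g : D ⊗ G ⟶ Z), CF (x ⊛ TG) u ∧ CF (y ⊛ TD) v ∧
      Pres (TD ⊛ TG) R g ∧ t = tens u v ≫ (α_ _ _ _).hom ≫ (o A ⊠ o B) ◁ g := by
  obtain ⟨Y0, R0, w0, g, ha, hb, hc⟩ := h.LPleaf rfl
  cases ha with
  | conj _ _ h1 h2 => exact ⟨_, _, _, _, _, _, _, h1, h2, hb, by rw [hc]; exact Category.assoc _ _ _⟩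
theorem CF.LPl {p : P} {a : Λ} {Z : Ob P} {R : Tr P Λ Z}
    {t} (h : CF (.lit p a ⊛ R) t) : ∃ g : o (∼(.letter p)) ⟶ Z, Pres (.nlit p a) R g ∧
      t = axp p ≫ (β_ _ _).hom ≫ _ ◁ g := by
  obtain ⟨Y0, R0, w0, g, ha, hb, hc⟩ := h.LPleaf rfl
  cases ha
  exact ⟨_, hb, by rw [hc]; simp⟩

section
variable {A B C D' : Form P} {x : Tr P Λ (o A)} {y : Tr P Λ (o B)} {z : Tr P Λ (o C)} {w : Tr P Λ (o D')}
theorem CF.tensc {A B : Form P} {G D : Ob P} {x : Tr P Λ (o A)} {y : Tr P Λ (o B)} {TG : Tr P Λ G}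
    {TD : Tr P Λ D} {u : I ⟶ o A ⊗ G} {v : I ⟶ o B ⊗ D} (h : CF (x ⊛ TG) u) (h' : CF (y ⊛ TD) v) :
    CF ((Tr.conj x y ⊛ TD) ⊛ TG) (tens u v) := CF.ten (.conj x y) h h'

/-- to show that an arrow from a conjunction is preserving, check it on introductions -/
theorem Pres.of_conj {X : Ob P} {T : Tr P Λ X} {f : o A ⊠ o B ⟶ X}
    (H : ∀ {G D : Ob P} (TG : Tr P Λ G) (TD : Tr P Λ D) (u : I ⟶ o A ⊗ G) (v : I ⟶ o B ⊗ D),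
      CF (x ⊛ TG) u → CF (y ⊛ TD) v → CF ((T ⊛ TD) ⊛ TG) (tens u v ≫ (f ▷ D) ▷ G)) :
    Pres (X := o A ⊠ o B) (.conj x y) T f := by
  refine ⟨fun R t ht => ?_⟩
  obtain ⟨G, D, TG, TD, u, v, g, hu, hv, hg, rfl⟩ := ht.LPc
  have := (hg.wl _).app ((H TG TD u v hu hv).st (.ass _ _ _))
  convert this using 1
  simp only [Category.assoc]
  rw [whisker_exchange]; simp

theorem Pres.conj {A' B' : Form P} {x' : Tr P Λ (o A')} {y' : Tr P Λ (o B')} {f : o A ⟶ o A'}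
    {g : o B ⟶ o B'} (h : Pres x x' f) (h' : Pres y y' g) :
    Pres (.conj x y) (.conj x' y') (cm f g) := by
  refine Pres.of_conj fun TG TD u v hu hv => ?_
  have := CF.tensc (h.h _ _ hu) (h'.h _ _ hv)
  rwa [tens_m] at this
theorem Pres.kap (x : Tr P Λ (o A)) (y : Tr P Λ (o B)) : Pres (.conj x y) (.conj y x) (kap (o A) (o B)) := by
  refine Pres.of_conj fun TG TD u v hu hv => ?_
  exact CF.st' (CF.tensc hv hu) (OSt.sw _ _ _) (tens_comm v u).symm
end

section
variable {X Y Z W G D E : Ob P}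
theorem tens_dl (u : I ⟶ X ⊗ G) (v : I ⟶ (Y ⊗ W) ⊗ D) : tens u v ≫ (dl X Y W ▷ D) ▷ G =
    tens u (v ≫ (α_ _ _ _).hom) ≫ (α_ _ _ _).inv ▷ G := by
  simp only [tens, Category.assoc, ← comp_whiskerRight, act_disj]
theorem tens_ac (u : I ⟶ X ⊗ G) (v : I ⟶ Y ⊗ E) (w : I ⟶ Z ⊗ D) :
    tens (tens u v ≫ (α_ _ _ _).hom) w ≫ (ac X Y Z ▷ D) ▷ (E ⊗ G) =
    tens u (tens v w ≫ (α_ _ _ _).hom) ≫ (α_ _ _ _).inv ▷ G ≫ (α_ _ _ _).hom := by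
  have h := act_disj X (tens v w)
  have h2 : act X (tens v w) = act X v ≫ cm (𝟙 X) (act Y w) ▷ E := by rw [tens, act_m]
  rw [h2, Category.assoc, ← comp_whiskerRight, act_conj] at h
  have h3 : tens u (tens v w ≫ (α_ _ _ _).hom) ≫ (α_ _ _ _).inv ▷ G =
    u ≫ (act X (tens v w ≫ (α_ _ _ _).hom) ≫ (α_ _ _ _).inv) ▷ G := by simp [tens]
  rw [reassoc_of% h3, ← h]
  simp [tens]
theorem tens_rl (u : I ⟶ X ⊗ G) (v : I ⟶ Y ⊗ D) (f : G ⟶ E) :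
    tens (u ≫ X ◁ f) v = tens u v ≫ _ ◁ f := by
  have := tens_r u v f (𝟙 D); simpa using this
theorem tens_rr (u : I ⟶ X ⊗ G) (v : I ⟶ Y ⊗ D) (f : D ⟶ E) :
    tens u (v ≫ Y ◁ f) = tens u v ≫ (_ ◁ f) ▷ G := by
  have := tens_r u v (𝟙 G) f; simpa using this
end

section
variable {A B C D' : Form P}
theorem Pres.dl (x : Tr P Λ (o A)) (y : Tr P Λ (o B)) (z : Tr P Λ (o C)) :
    Pres (.conj x (Tr.ten y z : Tr P Λ (o (B ⋎ C)))) (.conj x y ⊛ z) (dl (o A) (o B) (o C)) := by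
  refine Pres.of_conj (A := A) (B := B ⋎ C) fun {G D} TG TD u v hu hv => ?_
  have e := tens_dl (Y := o B) (W := o C) u v
  exact CF.st' (CF.tensc hu (CF.st (e := (α_ (o B) (o C) D).hom) hv (.ass _ _ _)))
    ((OSt.ass' _ _ _).wr _) e.symm
theorem Pres.ac (x : Tr P Λ (o A)) (y : Tr P Λ (o B)) (z : Tr P Λ (o C)) :
    Pres (.conj (.conj x y) z) (.conj x (.conj y z)) (ac (o A) (o B) (o C)) := by
  refine Pres.of_conj (A := A ⋏ B) (B := C) fun {G D} TG TD u v hu hv => ?_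
  obtain ⟨G', E, TG', TE, u1, w, g, hu1, hw, hg, rfl⟩ := hu.LPc
  have h1 := (CF.tensc hu1 ((CF.tensc hw hv).st (.ass _ _ _))).st ((OSt.ass' _ _ _).wr _ |>.comp (.ass _ _ _))
  have h2 := (hg.wl _).app h1
  have e1 := tens_rl (X := o A ⊠ o B) (tens u1 w ≫ (α_ _ _ _).hom) v g
  have e2 := tens_ac u1 w v
  have e3 : tens (tens u1 w ≫ (α_ _ _ _).hom ≫ (o A ⊠ o B) ◁ g) v ≫ (MPN.ac (o A) (o B) (o C) ▷ D) ▷ G =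
    (tens u1 (tens w v ≫ (α_ _ _ _).hom) ≫ (α_ _ _ _).inv ▷ G' ≫ (α_ _ _ _).hom) ≫ _ ◁ g := by
    rw [← e2, Category.assoc, ← whisker_exchange, ← reassoc_of% e1]
  exact e3 ▸ h2
end
end MPN

namespace MPN
open CategoryTheory MonoidalCategory
variable {P : Type} {Λ : Type}
open Ob OHom

section
variable {A B C : Form P}

theorem bC_by_c (A B C : Form P) : bC A B C = cj (𝟙 A) (cC B C) ≫ cC A (C ⋏ B) ≫ bC' C B A ≫
    cj (𝟙 C) (cC B A) ≫ cC C (A ⋏ B) := by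
  have h1 := hexC' A B C =≫ bC' C A B
  have h2 := bC A C B ≫= hexC A C B
  simp only [Category.assoc, bC_bC', bC_bC'_assoc, Category.comp_id] at h1 h2
  rw [reassoc_of% h2, cj_comp_assoc]
  simp only [cC_cC, Category.comp_id, cj_id, Category.id_comp]
  rw [← reassoc_of% h1]; simp

theorem Pres.acInv (x : Tr P Λ (o A)) (y : Tr P Λ (o B)) (z : Tr P Λ (o C)) :
    Pres (X := o _) (Y := o _) (.conj x (.conj y z)) (.conj (.conj x y) z) (ar (bC A B C)) := by
  have h := ((Pres.id x).conj (Pres.kap y z)).comp ((Pres.kap x (Tr.conj z y)).comp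
    ((Pres.ac z y x).comp (((Pres.id z).conj (Pres.kap y x)).comp (Pres.kap z (Tr.conj x y)))))
  have e : (ar (bC A B C) : (o _ : Ob P) ⟶ o _) = cm (𝟙 (o A)) (MPN.kap (o B) (o C)) ≫ MPN.kap (o A) (o (C ⋏ B)) ≫
    MPN.ac (o C) (o B) (o A) ≫ cm (𝟙 (o C)) (MPN.kap (o B) (o A)) ≫ MPN.kap (o C) (o (A ⋏ B)) :=
    congrArg ar (bC_by_c A B C)
  rw [e]; exact h

theorem act_unit (A : Form P) {D : Ob P} (v : I ⟶ I ⊗ D) :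
    act (Y := I) (o A) v = (ρ_ (o A)).inv ≫ (o A) ◁ v := by
  cases D with
  | I =>
    obtain rfl : v = (OHom.nil : OHom I I) := by
      match (v : OHom I I) with
      | OHom.nil => rfl
    change ar _ = ar _
    congr 1
    simp
  | o D =>
    obtain ⟨u, rfl⟩ : ∃ u, v = (OHom.pt u : OHom I (o D)) := by
      match (v : OHom I (o D)) with
      | OHom.pt u => exact ⟨u, rfl⟩
    change ar _ = ar _
    congr 1
    simp [Pt.a, mx_c]

theorem mix_slide (A G W : Ob P) (v : 𝟙_ (Ob P) ⟶ W) : ((ρ_ A).inv ≫ A ◁ v) ▷ G =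
    (λ_ (A ⊗ G)).inv ≫ v ▷ (A ⊗ G) ≫ (α_ _ _ _).inv ≫ (β_ _ _).hom ▷ G := by
  rw [associator_inv_naturality_left_assoc, ← comp_whiskerRight,
    BraidedCategory.braiding_naturality_left]
  simp

theorem Pres.mx (x : Tr P Λ (o A)) (y : Tr P Λ (o B)) :
    Pres (X := o _) (Y := o _) (.conj x y) (x ⊛ y) (ar (mx A B)) := by
  refine Pres.of_conj fun {G D} TG TD u v hu hv => ?_
  have e := tens_dl (X := o A) (Y := I) (W := o B) (D := D) u v
  have h1 : tens (X := o A) (Y := I) u (v ≫ (α_ I (o B) D).hom) =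
    u ≫ ((ρ_ (o A)).inv ≫ (o A) ◁ v) ▷ G := by
    have hv' : v ≫ (α_ I (o B) D).hom = v := by
      have : (α_ I (o B) D).hom = 𝟙 _ := rfl
      rw [this]; exact Category.comp_id v
    rw [hv']
    exact congrArg (fun t => u ≫ t ▷ G) (act_unit A v)
  have h2 := (CF.ten (Pr.mix : Pr P Λ I I) (TG := x ⊛ TG) (TD := y ⊛ TD)
    (hu.st (.lun' _)) (hv.st (.lun' _)))
  have h3 := h2.st (((OSt.lun _).wr _).comp ((OSt.ass' _ _ _).comp (((OSt.br _ _).comp (OSt.ass' _ _ _)).wr TG)))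
  have h4 : tens (u ≫ (λ_ _).inv) (v ≫ (λ_ _).inv) = u ≫ (λ_ _).inv ≫ (v ≫ (λ_ _).inv) ▷ _ := by
    have := congrArg (fun t => (u ≫ (λ_ _).inv) ≫ t ▷ (o A ⊗ G)) (act_I (v ≫ (λ_ _).inv))
    exact this.trans (Category.assoc _ _ _)
  have e' : tens u v ≫ ((ar (MPN.mx A B) : (o (A ⋏ B) : Ob P) ⟶ o (A ⋎ B)) ▷ D) ▷ G =
    (u ≫ ((ρ_ (o A)).inv ≫ (o A) ◁ v) ▷ G) ≫ (α_ (o A) (o B) D).inv ▷ G := by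
    rw [← h1]; exact e
  refine e' ▸ ?_
  convert h3 using 1
  rw [mix_slide]
  refine iff_of_eq (congrArg _ ?_)
  have h5 : (u ≫ (λ_ (o A ⊗ G)).inv ≫ v ▷ (o A ⊗ G) ≫ (α_ (o B ⊗ D) (o A) G).inv ≫
      (β_ (o B ⊗ D) (o A)).hom ▷ G) ≫ (α_ (o A) (o B) D).inv ▷ G =
    (u ≫ (λ_ (o A ⊗ G)).inv ≫ (v ≫ (λ_ (o B ⊗ D)).inv) ▷ (o A ⊗ G)) ≫
      (λ_ (o B ⊗ D)).hom ▷ (o A ⊗ G) ≫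
        (α_ (o B ⊗ D) (o A) G).inv ≫ ((β_ (o B ⊗ D) (o A)).hom ≫ (α_ (o A) (o B) D).inv) ▷ G := by
    have hc : (v ≫ (λ_ (o B ⊗ D)).inv) ▷ (o A ⊗ G) ≫ (λ_ (o B ⊗ D)).hom ▷ (o A ⊗ G) =
        v ▷ (o A ⊗ G) := by rw [← comp_whiskerRight]; simp
    simp only [Category.assoc, reassoc_of% hc]; rw [comp_whiskerRight]
  refine Eq.trans h5 (congrArg (fun t => t ≫ (λ_ (o B ⊗ D)).hom ▷ (o A ⊗ G) ≫
        (α_ (o B ⊗ D) (o A) G).inv ≫ ((β_ (o B ⊗ D) (o A)).hom ≫ (α_ (o A) (o B) D).inv) ▷ G) h4.symm)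
end
end MPN

namespace MPN
open CategoryTheory MonoidalCategory
variable {P : Type} {Λ : Type}
open Ob OHom

theorem dd_nat_assoc' {A B C D E F Z : Form P} (f : A ⟶ D) (g : B ⟶ E) (h : C ⟶ F)
    (k : (D ⋏ E) ⋎ F ⟶ Z) :
    dd A B C ≫ dj (cj f g) h ≫ k = cj f (dj g h) ≫ dd D E F ≫ k := by
  rw [← Category.assoc, dd_nat, Category.assoc]

theorem two_side (X A B Z : Form P) (p : Pt (B ⋎ Z)) :
    cj (𝟙 X) (p.l A ≫ cC _ _ ≫ dd A B Z ≫ cD _ _) ≫ dd X Z (A ⋏ B) ≫ cD _ _ =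
    cC X A ≫ cj (𝟙 A) ((p.push (cD _ _)).l X ≫ cC _ _ ≫ dd X Z B ≫ cD _ _) ≫ dd A B (X ⋏ Z) := by
  have h := cj (p.l A ≫ cC _ _) (𝟙 X) ≫= d_bC A B Z X =≫ dj (𝟙 _) (cC Z X)
  have h1 : cj (p.l A ≫ cC _ _) (𝟙 X) ≫ bC' A (B ⋎ Z) X = cj (𝟙 A) (p.l X) := by
    have : cj (p.l A ≫ cC _ _) (𝟙 X) = cj (p.l A) (𝟙 X) ≫ cj (cC _ _) (𝟙 X) := by simp [cj_comp]
    rw [this, p.mid]; rw [p.ass]; simp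
  have h2 : dd A B (Z ⋏ X) ≫ dj (𝟙 _) (cC Z X) = cj (𝟙 A) (dj (𝟙 _) (cC Z X)) ≫ dd _ _ _ := by
    have := dd_nat (𝟙 A) (𝟙 B) (cC Z X); simpa using this
  have h3 : cj (𝟙 A) ((p.push (cD _ _)).l X ≫ cC _ _ ≫ dd X Z B ≫ cD _ _) =
    cj (𝟙 A) (p.l X) ≫ cj (𝟙 A) (ddR B Z X) ≫ cj (𝟙 A) (dj (𝟙 _) (cC Z X)) := by
    simp only [cj_comp, Category.comp_id]
    congr 1
    have h5 : cD (Z ⋏ X) B ≫ dj (𝟙 B) (cC Z X) = dj (cC Z X) (𝟙 _) ≫ cD _ _ := cD_nat _ _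
    have h6 : cj (cD B Z) (𝟙 X) ≫ cC _ _ = cC _ _ ≫ cj (𝟙 X) (cD B Z) := (cC_nat _ _).symm
    rw [ddR_eq]; simp only [Category.assoc, h5, Pt.l_push]
    rw [reassoc_of% h6, dj_comp_assoc]; simp
  simp only [Category.assoc] at h
  rw [reassoc_of% h1, h2] at h
  rw [h3]; simp only [Category.assoc]; rw [← h]
  have h5 : cD (Z ⋏ X) (A ⋏ B) ≫ dj (𝟙 _) (cC Z X) = dj (cC Z X) (𝟙 _) ≫ cD _ _ := cD_nat _ _
  have h7 : cC X A ≫ cj (p.l A ≫ cC _ _) (𝟙 X) ≫ cj (dd A B Z) (𝟙 X) ≫ cC _ X ≫ cj (𝟙 X) (cD _ _) =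
    cj (𝟙 X) (p.l A ≫ cC _ _ ≫ dd A B Z ≫ cD _ _) := by
    rw [cj_comp_assoc, Category.comp_id, cC_nat_assoc (𝟙 X)]; simp [cj_comp]
  rw [ddR_eq]; simp only [Category.assoc, h5]
  rw [← h7]; simp only [Category.assoc]; rw [dj_comp_assoc]; simp

theorem pt_eq {X : Form P} (v : I ⟶ o X) : ∃ p, v = (OHom.pt p : OHom I (o X)) := by
  match (v : OHom I (o X)) with
  | OHom.pt u => exact ⟨u, rfl⟩
theorem ar_eq {X Y : Form P} (v : o X ⟶ o Y) : ∃ p, v = (OHom.ar p : OHom (o X) (o Y)) := by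
  match (v : OHom (o X) (o Y)) with
  | OHom.ar u => exact ⟨u, rfl⟩


/-- nonunit objects -/
class NU (Z : Ob P) : Prop where
  h : ∃ A, Z = o A
instance (A : Form P) : NU (o A) := ⟨A, rfl⟩
instance (Z W : Ob P) [NU Z] : NU (Z ⊗ W) := by
  obtain ⟨A, rfl⟩ := NU.h (Z := Z)
  cases W
  · exact ⟨A, rfl⟩
  · exact ⟨_, rfl⟩
instance (Z W : Ob P) [NU W] : NU (Z ⊗ W) := by
  obtain ⟨A, rfl⟩ := NU.h (Z := W)
  cases Z
  · exact ⟨A, rfl⟩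
  · exact ⟨_, rfl⟩
instance (Z W : Ob P) [NU Z] : NU (Z ⊠ W) := by
  obtain ⟨A, rfl⟩ := NU.h (Z := Z)
  cases W
  · exact ⟨A, rfl⟩
  · exact ⟨_, rfl⟩
instance (Z W : Ob P) [NU W] : NU (Z ⊠ W) := by
  obtain ⟨A, rfl⟩ := NU.h (Z := W)
  cases Z
  · exact ⟨A, rfl⟩
  · exact ⟨_, rfl⟩
theorem not_NU_I : ¬ NU (I : Ob P) := by
  rintro ⟨A, h⟩; cases h

theorem two_side' (X A B Z : Ob P) [hX : NU X] [hA : NU A] [hB : NU B] [hZ : NU Z] (v : I ⟶ B ⊗ Z) :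
    cm (𝟙 X) (act A v ≫ (β_ _ _).hom) ≫ dl X Z (A ⊠ B) ≫ (β_ _ _).hom =
    kap X A ≫ cm (𝟙 A) (act X (v ≫ (β_ _ _).hom) ≫ (β_ _ _).hom) ≫
      dl A B (X ⊠ Z) := by
  obtain ⟨X, rfl⟩ := hX.h
  obtain ⟨A, rfl⟩ := hA.h
  obtain ⟨B, rfl⟩ := hB.h
  obtain ⟨Z, rfl⟩ := hZ.h
  obtain ⟨p, rfl⟩ := pt_eq (X := B ⋎ Z) v
  have := congrArg (ar : _ → OHom _ _) (two_side X A B Z p)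
  simp only [Pt.l_push] at this
  change ar _ = ar _
  convert this using 2
  · simp
  · simp [Pt.push]

structure DP (X' X : Ob P) [NU X'] [NU X] where
  η : I ⟶ X' ⊗ X
  ε : ∀ (Z : Ob P) [NU Z], (X ⊠ X') ⊗ Z ⟶ Z
  nat : ∀ {Z W : Ob P} [NU Z] [NU W] (f : Z ⟶ W), (X ⊠ X') ◁ f ≫ ε W = ε Z ≫ f
  bs : ∀ (Z W : Ob P) [NU Z], ε Z ▷ W = (α_ (X ⊠ X') Z W).hom ≫ ε (Z ⊗ W)
  ds : ∀ (V Z : Ob P) [NU V] [NU Z], cm (𝟙 V) ((β_ Z (X ⊠ X')).hom ≫ ε Z) =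
    dl V Z (X ⊠ X') ≫ (β_ (V ⊠ Z) _).hom ≫ ε (V ⊠ Z)
  T1 : act X η ≫ ε X = 𝟙 _
  T2 : act X' (η ≫ (β_ _ _).hom) ≫ kap _ _ ▷ _ ≫ ε X' = 𝟙 _

def sigO (B : Form P) : (Z : Ob P) → [NU Z] → ((o B ⊠ o (∼B)) ⊗ Z ⟶ Z)
  | I, h => absurd h not_NU_I
  | o Z, _ => OHom.ar (sig B Z)

namespace DP
def base (B : Form P) : DP (o (∼B)) (o B) where
  η := OHom.pt (ptDel B)
  ε Z _ := sigO B Z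
  nat {Z W} hZ hW f := by
    obtain ⟨Z, rfl⟩ := hZ.h
    obtain ⟨W, rfl⟩ := hW.h
    obtain ⟨f, rfl⟩ := ar_eq f
    exact congrArg (ar : _ → OHom _ _) (sig_nat f)
  bs Z W hZ := by
    obtain ⟨Z, rfl⟩ := hZ.h
    cases W
    · exact congrArg (ar : _ → OHom _ _) (Category.id_comp (sig B Z)).symm
    · exact congrArg (ar : _ → OHom _ _) (b_sig B Z _).symm
  ds V Z hV hZ := by
    obtain ⟨V, rfl⟩ := hV.h
    obtain ⟨Z, rfl⟩ := hZ.h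
    exact congrArg (ar : _ → OHom _ _) (d_sig B V Z).symm
  T1 := by
    have := congrArg (ar : _ → OHom _ _) (sig_del B)
    refine Eq.trans ?_ this
    change ar _ = ar _
    congr 1
    simp [ptDel]
  T2 := by
    have := congrArg (ar : _ → OHom _ _) (sig_del' B)
    refine Eq.trans ?_ this
    change ar _ = ar _
    congr 1
    have h : cj (cD (∼B) B) (𝟙 (∼B)) ≫ cC _ _ = cC _ _ ≫ cj (𝟙 _) (cD _ _) := (cC_nat _ _).symm
    simp [ptDel, Pt.push, reassoc_of% h]

variable {X' X : Ob P} [NU X'] [NU X]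
def swap (d : DP X' X) : DP X X' where
  η := d.η ≫ (β_ _ _).hom
  ε Z _ := kap _ _ ▷ _ ≫ d.ε Z
  nat f := by rw [whisker_exchange_assoc, d.nat, Category.assoc]
  bs Z W _ := by
    rw [comp_whiskerRight, d.bs]
    exact (associator_naturality_left_assoc (kap X' X) Z W (d.ε (Z ⊗ W)))
  ds V Z _ _ := by
    have h1 := dl_nat_r V Z (kap X' X)
    have h2 := d.ds V Z
    simp only [← BraidedCategory.braiding_naturality_right_assoc]
    rw [reassoc_of% h1, ← h2, cm_comp]; simp
  T1 := d.T2
  T2 := by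
    rw [Category.assoc]
    have h := d.T1
    have e : kap X X' ▷ X ≫ kap X' X ▷ X ≫ d.ε X = d.ε X := by
      rw [← comp_whiskerRight_assoc]; simp
    rw [e]; simpa using h
end DP
end MPN

namespace MPN
open CategoryTheory MonoidalCategory
variable {P : Type} {Λ : Type}
open Ob OHom

theorem ac_hex (W X Y : Ob P) [hW : NU W] [hX : NU X] [hY : NU Y] :
    ac W X Y ≫ kap W (X ⊠ Y) ≫ cm (kap X Y) (𝟙 W) ≫ ac Y X W =
    kap (W ⊠ X) Y ≫ cm (𝟙 Y) (kap W X) := by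
  obtain ⟨W, rfl⟩ := hW.h
  obtain ⟨X, rfl⟩ := hX.h
  obtain ⟨Y, rfl⟩ := hY.h
  refine congrArg (ar : _ → OHom _ _) (?_ : bC' W X Y ≫ cC W (X ⋏ Y) ≫ cj (cC X Y) (𝟙 W) ≫ bC' Y X W =
    cC (W ⋏ X) Y ≫ cj (𝟙 Y) (cC W X))
  have := bC_by_c W X Y
  have h2 := cC_nat (𝟙 W) (cC X Y)
  rw [reassoc_of% h2]
  have h3 : (bC' W X Y ≫ bC W X Y) = 𝟙 _ := by simp
  rw [this] at h3
  have h4 := h3 =≫ (cC (W ⋏ X) Y ≫ cj (𝟙 Y) (cC W X))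
  simp only [Category.assoc, Category.id_comp] at h4
  rw [← h4]
  simp [cj_comp]

theorem br_coh (A B C : Ob P) : (α_ A B C).hom ≫ A ◁ (β_ B C).hom ≫ (β_ A (C ⊗ B)).hom ≫ (α_ C B A).hom =
    (β_ A B).hom ▷ C ≫ (β_ (B ⊗ A) C).hom := by
  have := BraidedCategory.yang_baxter A B C
  simp [← this]

namespace DP
variable {X' X Y' Y : Ob P} [NU X'] [NU X] [NU Y'] [NU Y]
/-- right component of the evaluation -/
def rr (d : DP X' X) (Y' : Ob P) [NU Y'] : X ⊠ (X' ⊗ Y') ⟶ Y' := dl X X' Y' ≫ d.ε Y'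
def qq (d : DP X' X) (Y' Y : Ob P) [NU Y'] : (X ⊠ Y) ⊠ (X' ⊗ Y') ⟶ Y ⊠ Y' :=
  cm (kap X Y) (𝟙 _) ≫ ac Y X (X' ⊗ Y') ≫ cm (𝟙 Y) (d.rr Y')

theorem qq2 (d : DP X' X) (Y' Y : Ob P) [NU Y'] [NU Y] : ac (X' ⊗ Y') X Y ≫ kap _ _ ≫ d.qq Y' Y =
    cm (dr X' Y' X ≫ kap X' X ▷ Y' ≫ d.ε Y') (𝟙 Y) ≫ kap Y' Y := by
  have h : dr X' Y' X ≫ kap X' X ▷ Y' ≫ d.ε Y' = kap _ _ ≫ d.rr Y' := by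
    rw [dr_def, rr]; simp [← comp_whiskerRight_assoc]
  have := ac_hex (X' ⊗ Y') X Y
  rw [h, qq, reassoc_of% this, cm_comp, ← kap_nat]; simp

theorem T2tens (d : DP X' X) (e : DP Y' Y) : act (X' ⊗ Y') (tens (d.η ≫ (β_ _ _).hom) (e.η ≫ (β_ _ _).hom) ≫
    (α_ _ _ _).hom ≫ (X ⊠ Y) ◁ (β_ Y' X').hom) ≫ kap _ _ ▷ _ ≫ d.qq Y' Y ▷ _ ≫ e.ε _ = 𝟙 _ := by
  set u := d.η ≫ (β_ _ _).hom with hu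
  set w := e.η ≫ (β_ _ _).hom with hw
  have h1 : act (X' ⊗ Y') (tens u w ≫ (α_ _ _ _).hom ≫ (X ⊠ Y) ◁ (β_ Y' X').hom) =
    act _ u ≫ (act _ w ≫ ac _ _ _ ▷ Y') ▷ X' ≫ (α_ _ _ _).hom ≫ _ ◁ (β_ Y' X').hom := by
    rw [← Category.assoc (tens u w), act_r]
    have := act_disj (X' ⊗ Y') (tens u w) =≫ (α_ _ _ _).hom
    simp only [Category.assoc, Iso.inv_hom_id, Category.comp_id] at this
    rw [← this, tens, act_m, ← act_conj]; simp
  have h2 : ∀ {Q : Ob P} (k : Q ⟶ Y ⊠ Y'), (α_ Q Y' X').hom ≫ _ ◁ (β_ Y' X').hom ≫ k ▷ _ ≫ e.ε (X' ⊗ Y') =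
    (k ▷ Y' ≫ e.ε Y') ▷ X' ≫ (β_ Y' X').hom := by
    intro Q k
    rw [whisker_exchange_assoc, e.nat, comp_whiskerRight, e.bs]
    simp
  have h3 : kap _ _ ▷ (X' ⊗ Y') ≫ d.qq Y' Y ▷ (X' ⊗ Y') ≫ e.ε _ = (kap _ _ ≫ d.qq Y' Y) ▷ (X' ⊗ Y') ≫ e.ε _ := by simp
  rw [h3, h1]; simp only [Category.assoc]; rw [h2, ← comp_whiskerRight_assoc]
  have h6 : act ((X' ⊗ Y') ⊠ X) w ≫ (ac (X' ⊗ Y') X Y ≫ kap _ _ ≫ d.qq Y' Y) ▷ Y' ≫ e.ε Y' =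
      dr X' Y' X ≫ kap X' X ▷ Y' ≫ d.ε Y' := by
    rw [qq2, comp_whiskerRight_assoc, ← act_nat_assoc, hw, e.T2, Category.comp_id]
  have h7 : (act ((X' ⊗ Y') ⊠ X) w ≫ ac (X' ⊗ Y') X Y ▷ Y') ≫ (kap _ _ ≫ d.qq Y' Y) ▷ Y' ≫ e.ε Y' =
      dr X' Y' X ≫ kap X' X ▷ Y' ≫ d.ε Y' := by
    rw [← h6]; simp
  rw [h7]
  have h4 := act_tensor X' Y' u =≫ sw _ _ _
  simp only [Category.assoc, sw_sw, Category.comp_id] at h4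
  simp only [Category.assoc, comp_whiskerRight, Category.comp_id]
  rw [← reassoc_of% h4]
  have h5 : sw (X' ⊠ X) X' Y' ≫ kap X' X ▷ Y' ▷ X' ≫ d.ε Y' ▷ X' ≫ (β_ Y' X').hom = kap X' X ▷ X' ▷ Y' ≫ d.ε X' ▷ Y' := by
    rw [sw, d.bs, d.bs]
    have : d.ε (Y' ⊗ X') ≫ (β_ Y' X').hom = _ := (d.nat (β_ Y' X').hom).symm
    simp only [Category.assoc, this]
    simp only [associator_inv_naturality_left_assoc, associator_naturality_left_assoc, Iso.inv_hom_id_assoc]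
    rw [whisker_exchange_assoc, ← MonoidalCategory.whiskerLeft_comp_assoc]; simp
  rw [h5, ← comp_whiskerRight, ← comp_whiskerRight, d.T2]; simp

theorem T1tens (d : DP X' X) (e : DP Y' Y) : act (X ⊠ Y) (tens (d.η ≫ (β_ _ _).hom) (e.η ≫ (β_ _ _).hom) ≫
    (α_ _ _ _).hom ≫ (X ⊠ Y) ◁ (β_ Y' X').hom ≫ (β_ _ _).hom) ≫ d.qq Y' Y ▷ _ ≫ e.ε _ = 𝟙 _ := by
  set w := e.η ≫ (β_ _ _).hom with hw
  set η := tens (d.η ≫ (β_ _ _).hom) w ≫ (α_ _ _ _).hom ≫ (X ⊠ Y) ◁ (β_ Y' X').hom ≫ (β_ _ _).hom with hη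
  have h1 : η ≫ (α_ _ _ _).hom = d.η ≫ X' ◁ (act X w ≫ (β_ _ _).hom) := by
    rw [hη]; simp only [Category.assoc]; rw [br_coh, tens]
    simp only [Category.assoc]
    rw [← comp_whiskerRight_assoc, BraidedCategory.braiding_naturality_left]; simp
  have hk : act X η ≫ d.rr Y' ▷ (X ⊠ Y) = act X w ≫ (β_ _ _).hom := by
    rw [rr, comp_whiskerRight, reassoc_of% (act_disj X η), h1, act_r, d.bs]; simp only [Category.assoc, Iso.inv_hom_id_assoc]
    rw [d.nat, reassoc_of% d.T1]
  have h2 : act (X ⊠ Y) η ≫ d.qq Y' Y ▷ (X ⊠ Y) = kap X Y ≫ cm (𝟙 Y) (act X w ≫ (β_ _ _).hom) ≫ dl _ _ _ := by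
    rw [qq, comp_whiskerRight, comp_whiskerRight, ← act_nat_assoc, ← reassoc_of% (act_conj Y X η), dl_nat_m,
      cm_comp_assoc, hk]; simp
  rw [reassoc_of% h2]
  have h3 := two_side' X Y Y' Y e.η
  rw [← hw] at h3
  have h4 := h3 =≫ e.ε (X ⊠ Y)
  simp only [Category.assoc] at h4
  rw [← h4, ← e.ds, cm_comp]
  simp [e.T1]

def tens (d : DP X' X) (e : DP Y' Y) : DP (X' ⊗ Y') (X ⊠ Y) where
  η := MPN.tens (d.η ≫ (β_ _ _).hom) (e.η ≫ (β_ _ _).hom) ≫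
    (α_ _ _ _).hom ≫ (X ⊠ Y) ◁ (β_ Y' X').hom ≫ (β_ _ _).hom
  ε Z _ := d.qq Y' Y ▷ _ ≫ e.ε Z
  nat f := by rw [whisker_exchange_assoc, e.nat, Category.assoc]
  bs Z W _ := by
    rw [comp_whiskerRight, e.bs]
    exact (associator_naturality_left_assoc (d.qq Y' Y) Z W (e.ε (Z ⊗ W)))
  ds V Z _ _ := by
    have h1 := dl_nat_r V Z (d.qq Y' Y)
    have h2 := e.ds V Z
    simp only [← BraidedCategory.braiding_naturality_right_assoc]
    rw [reassoc_of% h1, ← h2, cm_comp]; simp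
  T1 := T1tens d e
  T2 := by
    have := T2tens d e
    simpa only [Category.assoc, SymmetricCategory.symmetry, Category.comp_id] using this
end DP
end MPN

namespace MPN
open CategoryTheory MonoidalCategory
variable {P : Type} {Λ : Type}
open Ob OHom

namespace DP
variable {X' X Y' Y : Ob P} [NU X'] [NU X] [NU Y'] [NU Y]

theorem T1_trans (d : DP X' X) (m : X' ≅ Y') (n : X ≅ Y) :
    act Y (d.η ≫ (m.hom ⊗ₘ n.hom)) ≫ cm n.inv m.inv ▷ Y ≫ d.ε Y = 𝟙 _ := by
  rw [MonoidalCategory.tensorHom_def, ← Category.assoc d.η, act_r, act_m]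
  simp only [Category.assoc]
  rw [whisker_exchange_assoc, d.nat, ← comp_whiskerRight_assoc, cm_comp]
  simp only [Iso.hom_inv_id, Category.id_comp]
  rw [← act_nat_assoc, reassoc_of% d.T1]; simp

def trans (d : DP X' X) (m : X' ≅ Y') (n : X ≅ Y) : DP Y' Y where
  η := d.η ≫ (m.hom ⊗ₘ n.hom)
  ε Z _ := cm n.inv m.inv ▷ _ ≫ d.ε Z
  nat f := by rw [whisker_exchange_assoc, d.nat, Category.assoc]
  bs Z W _ := by
    rw [comp_whiskerRight, d.bs]
    exact (associator_naturality_left_assoc (cm n.inv m.inv) Z W (d.ε (Z ⊗ W)))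
  ds V Z _ _ := by
    have h1 := dl_nat_r V Z (cm n.inv m.inv)
    have h2 := d.ds V Z
    simp only [← BraidedCategory.braiding_naturality_right_assoc]
    rw [reassoc_of% h1, ← h2, cm_comp]; simp
  T1 := T1_trans d m n
  T2 := by
    have := T1_trans d.swap n m
    simp only [swap, Category.assoc, ← comp_whiskerRight_assoc] at this
    rw [← kap_nat] at this
    simpa using this

theorem det (d : DP X' X) {Z : Ob P} [NU Z] (k : X' ⟶ Z) :
    k = act X' ((d.η ≫ k ▷ X) ≫ (β_ _ _).hom) ≫ kap _ _ ▷ _ ≫ d.ε Z := by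
  have : (d.η ≫ k ▷ X) ≫ (β_ _ _).hom = (d.η ≫ (β_ _ _).hom) ≫ X ◁ k := by simp
  rw [this, act_r]; simp only [Category.assoc]
  rw [whisker_exchange_assoc, d.nat, reassoc_of% d.T2]
theorem det' (d : DP X' X) {Z : Ob P} [NU Z] {k k' : X' ⟶ Z} (h : d.η ≫ k ▷ X = d.η ≫ k' ▷ X) : k = k' := by
  rw [d.det k, d.det k', h]

def cmp (e : DP Y' X) (d : DP X' X) : Y' ⟶ X' := act Y' (d.η ≫ (β_ _ _).hom) ≫ kap _ _ ▷ _ ≫ e.ε X'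

theorem sw_ε (d : DP X' X) (A B : Ob P) [NU A] [NU B] :
    sw (X ⊠ X') A B ≫ d.ε B ▷ A = d.ε A ▷ B ≫ (β_ A B).hom := by
  rw [sw, d.bs, d.bs]; simp only [Category.assoc, ← d.nat]; simp

theorem cmp_η (e : DP Y' X) (d : DP X' X) : e.η ≫ e.cmp d ▷ X = d.η := by
  have h0 := tens_comm (d.η ≫ (β_ _ _).hom) e.η =≫ e.ε X' ▷ X
  simp only [Category.assoc, sw_ε] at h0
  have h1 : MPN.tens (d.η ≫ (β_ _ _).hom) e.η ≫ e.ε X ▷ X' = d.η ≫ (β_ _ _).hom := by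
    rw [MPN.tens, Category.assoc, ← comp_whiskerRight, e.T1]; simp
  rw [reassoc_of% h1, MPN.tens] at h0
  simpa [cmp] using h0

def cmpIso (e : DP Y' X) (d : DP X' X) : Y' ≅ X' where
  hom := e.cmp d
  inv := d.cmp e
  hom_inv_id := by
    apply e.det'; rw [comp_whiskerRight, reassoc_of% (cmp_η e d), cmp_η]; simp
  inv_hom_id := by
    apply d.det'; rw [comp_whiskerRight, reassoc_of% (cmp_η d e), cmp_η]; simp

theorem uniq (d e : DP X' X) (h : d.η = e.η) (Z : Ob P) [NU Z] : d.ε Z = e.ε Z := by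
  let j : (X ⊠ X') ⟶ (X ⊠ X') ⊗ (X ⊠ X') := cm (𝟙 X) (act X' (e.η ≫ (β_ _ _).hom) ≫ kap _ _ ▷ X' ≫ (β_ _ _).hom) ≫ dl X X' (X ⊠ X')
  have hj : j = kap X X' ≫ cm (𝟙 X') (act X e.η ≫ (β_ _ _).hom) ≫ dl X' X (X ⊠ X') ≫ (β_ _ _).hom ≫ (X ⊠ X') ◁ kap _ _ := by
    have := kap X X' ≫= two_side' X' X X' X e.η =≫ ((X ⊠ X') ◁ kap X' X)
    simp only [Category.assoc, kap_kap_assoc] at this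
    rw [this, dl_nat_r, cm_comp_assoc]
    simp [j]
  have h1 : j ≫ (β_ _ _).hom ≫ e.ε (X ⊠ X') = 𝟙 _ := by
    have h2 := e.T2
    simp only [j, Category.assoc]
    rw [← e.ds, cm_comp]
    simp [h2]
  have h2 : j ≫ d.ε (X ⊠ X') = 𝟙 _ := by
    have h3 := d.T1
    rw [h] at h3
    rw [hj]; simp only [Category.assoc]
    rw [d.nat, ← reassoc_of% (d.ds X' X), cm_comp_assoc]
    simp [h3]
  have c : ∀ (e : DP X' X), (β_ (X ⊠ X') (X ⊠ X')).hom ▷ Z ≫ (α_ (X ⊠ X') (X ⊠ X') Z).hom ≫ (X ⊠ X') ◁ e.ε Z = e.ε (X ⊠ X') ▷ Z := by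
    intro e
    have h5 := e.nat (β_ (X ⊠ X') Z).hom
    have h6 := h5 =≫ (β_ Z (X ⊠ X')).hom
    simp only [Category.assoc, SymmetricCategory.symmetry, Category.comp_id] at h6
    rw [e.bs, ← h6]
    have h7 : e.ε (Z ⊗ (X ⊠ X')) = (α_ _ _ _).inv ≫ e.ε Z ▷ (X ⊠ X') := by rw [e.bs]; simp
    rw [h7]; simp [← MonoidalCategory.whiskerLeft_comp_assoc]
  have e1 : e.ε Z = j ▷ Z ≫ (d.ε (X ⊠ X') ▷ Z ≫ e.ε Z) := by
    rw [← comp_whiskerRight_assoc, h2]; simp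
  have e2 : d.ε Z = j ▷ Z ≫ ((β_ _ _).hom ▷ Z ≫ e.ε (X ⊠ X') ▷ Z ≫ d.ε Z) := by
    rw [← comp_whiskerRight_assoc, ← comp_whiskerRight_assoc, Category.assoc, h1]; simp
  rw [e2, e1]
  congr 1
  rw [← c d, e.bs, Category.assoc, ← e.nat]; simp
end DP
end MPN

namespace MPN
open CategoryTheory MonoidalCategory
variable {P : Type} {Λ : Type}
open Ob OHom

theorem NU.of_hom {A : Form P} {G : Ob P} (f : o A ⟶ G) : NU G := by
  cases G with
  | I => exact nomatch (f : OHom (o A) I)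
  | o B => infer_instance
theorem asc4 {C : Type*} [Category C] {A B D E F : C} (f : A ⟶ B) (g : B ⟶ D) (h : D ⟶ E) (k : E ⟶ F) :
    ((f ≫ g) ≫ h) ≫ k = f ≫ g ≫ h ≫ k := by simp

theorem DP.key {X' X : Ob P} [NU X'] [NU X] (d : DP X' X) {D : Ob P} (v : I ⟶ X' ⊗ D) :
    MPN.tens (d.η ≫ (β_ _ _).hom) v ≫ (α_ _ _ _).hom ≫ d.ε (D ⊗ X') = v ≫ (β_ _ _).hom := by
  have h1 : (α_ (X ⊠ X') D X').hom ≫ d.ε (D ⊗ X') = sw _ _ _ ≫ d.ε X' ▷ D ≫ (β_ _ _).hom := by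
    have h6 := d.nat (β_ D X').hom =≫ (β_ X' D).hom
    simp only [Category.assoc, SymmetricCategory.symmetry, Category.comp_id] at h6
    rw [d.bs, ← h6, sw]; simp
  rw [h1, ← reassoc_of% (tens_comm (d.η ≫ (β_ _ _).hom) v), MPN.tens]
  simp only [Category.assoc, ← comp_whiskerRight_assoc, d.T2]; simp

theorem DP.key2 {X' X : Ob P} [NU X'] [NU X] (d : DP X' X) {D G Z W : Ob P} [NU Z] [NU G] (k : X' ⟶ G)
    (v : I ⟶ X' ⊗ D) (g : D ⊗ G ⟶ Z ⊗ W) (t : I ⟶ ((X ⊠ X') ⊗ Z) ⊗ W)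
    (e : t ≫ (α_ _ _ _).hom = MPN.tens (d.η ≫ (β_ _ _).hom ≫ X ◁ k) v ≫ (α_ _ _ _).hom ≫ (X ⊠ X') ◁ g) :
    t ≫ d.ε Z ▷ W = (v ≫ (β_ _ _).hom) ≫ D ◁ k ≫ g := by
  rw [d.bs, reassoc_of% e, d.nat, ← d.key v, ← Category.assoc d.η, tens_rl]
  simp only [Category.assoc]
  rw [← reassoc_of% (d.nat (D ◁ k))]
  have h4 : ∀ (Q : Ob P), Q ◁ D ◁ k = (α_ _ _ _).inv ≫ (_ ◁ k) ≫ (α_ Q D _).hom := by intro Q; simp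
  rw [h4]
  simp only [Category.assoc, Iso.hom_inv_id_assoc]

/-- two-sided normal form bundle -/
structure Bun (P : Type) where
  A : Form P
  A' : Form P
  T : Tr P Unit (o A)
  T' : Tr P Unit (o A')
  d : DP (o A') (o A)
  hη : CF (T' ⊛ T) d.η
  hε : ∀ (Z : Ob P) [NU Z] (z : Tr P Unit Z), Pres (Tr.conj T T' ⊛ z) z (d.ε Z)

namespace Bun
def base (p : P) : Bun P where
  A := .letter p
  A' := ∼(.letter p)
  T := .lit p ()
  T' := .nlit p ()
  d := DP.base (.letter p)
  hη := .ax p ()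
  hε Z _ z := by
    constructor
    intro W R t ht
    obtain ⟨G, D, TG, TD, u, v, g, hu, hv, hg, e⟩ := (ht.st (.ass _ _ _)).LPc
    obtain ⟨k, hk, rfl⟩ := hu.LPl
    have := NU.of_hom k
    have e2 := (DP.base (P := P) (.letter p)).key2 k v g t e
    refine e2 ▸ (Pres.app ?_ (hv.st (.br _ _)))
    exact (hk.wl _).comp hg

def swap (b : Bun P) : Bun P where
  A := b.A'
  A' := b.A
  T := b.T'
  T' := b.T
  d := b.d.swap
  hη := b.hη.st (.br _ _)
  hε Z _ z := ((Pres.kap _ _).wr _).comp (b.hε Z z)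

def tens (b c : Bun P) : Bun P where
  A := b.A ⋏ c.A
  A' := b.A' ⋎ c.A'
  T := .conj b.T c.T
  T' := .ten b.T' c.T'
  d := b.d.tens c.d
  hη := by
    have h := CF.tensc (b.hη.st (.br _ _)) (c.hη.st (.br _ _))
    exact CF.st' (CF.st' (CF.st' h (.ass _ _ _) rfl) ((OSt.br c.T' b.T').wl _) rfl) (.br _ _) (asc4 _ _ _ _)
  hε Z _ z := by
    refine Pres.comp (Pres.wr ?_ _) (c.hε Z z)
    refine Pres.comp (Pres.conj (Pres.kap b.T c.T) (Pres.id _)) ?_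
    refine Pres.comp (Pres.ac c.T b.T _) ?_
    refine Pres.conj (Pres.id _) ?_
    exact Pres.comp (Pres.dl _ _ _) (b.hε _ _)

/-- the bundle of a formula -/
def of : Form P → Bun P
  | .letter p => base p
  | .neg B => (of B).swap
  | .conj B C => (of B).tens (of C)
  | .disj B C => ((of B).swap.tens (of C).swap).swap
end Bun
end MPN

namespace MPN
open CategoryTheory MonoidalCategory
variable {P : Type} {Λ : Type}
open Ob OHom

def arr {A B : Form P} (f : A ⟶ B) : (o A ⟶ o B) := (OHom.ar f : OHom (o A) (o B))

def cmIso {X Y X' Y' : Ob P} (f : X ≅ Y) (g : X' ≅ Y') : X ⊠ X' ≅ Y ⊠ Y' where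
  hom := cm f.hom g.hom
  inv := cm f.inv g.inv
  hom_inv_id := by rw [cm_comp]; simp
  inv_hom_id := by rw [cm_comp]; simp

def nIso : (B : Form P) → (o B ≅ o (Bun.of B).A)
  | .letter p => Iso.refl _
  | .neg B => ((DP.base B).trans (Iso.refl _) (nIso B)).cmpIso (Bun.of B).d
  | .conj B C => cmIso (nIso B) (nIso C)
  | .disj B C => MonoidalCategory.tensorIso (nIso B) (nIso C)

theorem n_η_gen {Y' X' X Y Q : Ob P} (η : I ⟶ X' ⊗ X) (n : X ⟶ Y) (c : X' ⟶ Q) :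
    (η ≫ ((Iso.refl X').hom ⊗ₘ n)) ≫ c ▷ _ = η ≫ (c ⊗ₘ n) := by
  rw [Category.assoc]; congr 1
  rw [Iso.refl_hom, id_tensorHom, MonoidalCategory.tensorHom_def']
theorem n_η (B : Form P) : (DP.base B).η ≫ ((nIso (∼B)).hom ⊗ₘ (nIso B).hom) = (Bun.of B).d.η := by
  have := DP.cmp_η ((DP.base B).trans (Iso.refl _) (nIso B)) (Bun.of B).d
  exact (n_η_gen (Y' := I) _ _ _).symm.trans this

theorem n_ε (B : Form P) (Z : Ob P) [NU Z] :
    sigO B Z = cm (nIso B).hom (nIso (∼B)).hom ▷ Z ≫ (Bun.of B).d.ε Z := by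
  have := DP.uniq ((DP.base B).trans (nIso (∼B)) (nIso B)) (Bun.of B).d (n_η B) Z
  rw [← this]
  have h : cm (nIso B).hom (nIso (∼B)).hom ≫ cm (nIso B).inv (nIso (∼B)).inv = 𝟙 _ := by rw [cm_comp]; simp
  have h2 : cm (nIso B).hom (nIso (∼B)).hom ▷ Z ≫ cm (nIso B).inv (nIso (∼B)).inv ▷ Z ≫ sigO B Z = sigO B Z := by
    rw [← comp_whiskerRight_assoc, h]; simp
  exact h2.symm

theorem exists_nh (A : Form P) : ∃ a : A ⟶ (Bun.of A).A, (nIso A).hom = arr a := ar_eq _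
noncomputable def nh (A : Form P) : A ⟶ (Bun.of A).A := (exists_nh A).choose
theorem nh_eq (A : Form P) : (nIso A).hom = arr (nh A) := (exists_nh A).choose_spec
theorem arr_inj {A B : Form P} {f g : A ⟶ B} (h : arr f = arr g) : f = g := by
  exact OHom.ar.inj h
theorem nh_cj (A B : Form P) : nh (A ⋏ B) = cj (nh A) (nh B) := by
  apply arr_inj; rw [← nh_eq]
  change cm (nIso A).hom (nIso B).hom = cm (arr (nh A)) (arr (nh B))
  rw [nh_eq, nh_eq]
theorem nh_dj (A B : Form P) : nh (A ⋎ B) = dj (nh A) (nh B) := by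
  apply arr_inj; rw [← nh_eq]
  change (nIso A).hom ⊗ₘ (nIso B).hom = arr (nh A) ⊗ₘ arr (nh B)
  rw [nh_eq, nh_eq]

def PN {A B : Form P} (f : A ⟶ B) : Prop :=
  Pres (Bun.of A).T (Bun.of B).T ((nIso A).inv ≫ arr f ≫ (nIso B).hom)

theorem PN.mk' {A B : Form P} {f : A ⟶ B} {k} (h : arr f ≫ (nIso B).hom = (nIso A).hom ≫ k)
    (hk : Pres (Bun.of A).T (Bun.of B).T k) : PN f := by
  unfold PN; rw [h]; simpa using hk
theorem PN.mk {A B : Form P} {f : A ⟶ B} {k} (h : f ≫ nh B = nh A ≫ k)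
    (hk : Pres (Bun.of A).T (Bun.of B).T (arr k)) : PN f := by
  refine PN.mk' ?_ hk
  rw [nh_eq, nh_eq]; exact congrArg arr h

theorem del_act (A B : Form P) : arr (del B A) = rc (o A) ≫ cm (𝟙 (o A)) (DP.base B).η := by
  change arr _ = arr _
  congr 1
  simp [ptDel]

theorem cm3 {A B C D A' B' C' D' : Ob P} (f : A ⟶ B) (g : B ⟶ C) (h : C ⟶ D) (f' : A' ⟶ B') (g' : B' ⟶ C') (h' : C' ⟶ D') :
    cm (f ≫ g ≫ h) (f' ≫ g' ≫ h') = cm f f' ≫ cm g g' ≫ cm h h' := by rw [cm_comp, cm_comp]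
theorem tn3 {A B C D A' B' C' D' : Ob P} (f : A ⟶ B) (g : B ⟶ C) (h : C ⟶ D) (f' : A' ⟶ B') (g' : B' ⟶ C') (h' : C' ⟶ D') :
    ((f ≫ g ≫ h) ⊗ₘ (f' ≫ g' ≫ h')) = (f ⊗ₘ f') ≫ (g ⊗ₘ g') ≫ (h ⊗ₘ h') := by simp
theorem Pres.cast {X Y : Ob P} {T : Tr P Λ X} {S : Tr P Λ Y} {f g : X ⟶ Y} (e : f = g) (h : Pres T S f) : Pres T S g := e ▸ h
theorem dl_run (X Y : Ob P) : cm (𝟙 X) (ρ_ Y).inv ≫ dl X Y I ≫ (ρ_ _).hom = 𝟙 _ := by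
  change ocomp (hcj (oid X) (orun' Y)) (ocomp (odd X Y I) (orun _)) = oid _
  cases X <;> cases Y <;> simp [ocomp, oid, hcj, odd, oten, ocj, orun, orun']
theorem hdel_gen {X W Y V : Ob P} (n : X ⟶ W) (η : I ⟶ Y) (m : Y ⟶ V) {η' : I ⟶ V} (h : η ≫ m = η') :
    (rc X ≫ cm (𝟙 X) η) ≫ cm n m = n ≫ act W (η' ≫ (ρ_ _).inv) ≫ (ρ_ _).hom := by
  have h2 : act W (η' ≫ (ρ_ _).inv) ≫ (ρ_ _).hom = rc W ≫ cm (𝟙 _) η' := by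
    have : cm (𝟙 W) (η' ≫ (ρ_ V).inv) = cm (𝟙 W) η' ≫ cm (𝟙 W) (ρ_ _).inv := by simp [cm_comp]
    rw [act, this]; simp only [Category.assoc]
    erw [dl_run]; rw [Category.comp_id]
  rw [h2, rc_nat_assoc, Category.assoc, cm_comp, cm_comp, h]; simp
theorem hsig_gen {X' X Q Z W : Ob P} [NU X'] [NU X] [NU Z] [NU W] (d : DP X' X) (q : Q ⟶ X ⊠ X') (n : Z ⟶ W) :
    (q ▷ Z ≫ d.ε Z) ≫ n = (q ⊗ₘ n) ≫ d.ε W := by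
  rw [Category.assoc, ← d.nat, MonoidalCategory.tensorHom_def, Category.assoc]

theorem PN.all {A B : Form P} (f : A ⟶ B) : PN f := by
  induction f using term_ind with
  | hid A => exact PN.mk (k := 𝟙 _) (by simp) (Pres.id _)
  | hcomp f g hf hg =>
    have := Pres.comp hf hg
    simp only [Category.assoc, Iso.hom_inv_id_assoc] at this
    unfold PN
    convert this using 1
    change _ ≫ (arr f ≫ arr g) ≫ _ = _
    simp
  | @hcj A B C D f g hf hg => exact Pres.cast (cm3 _ _ _ _ _ _) (Pres.conj hf hg)
  | @hdj A B C D f g hf hg => exact Pres.cast (tn3 _ _ _ _ _ _) (Pres.ten hf hg)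
  | hbC A B C => exact PN.mk (by simp only [nh_cj]; exact bC_nat _ _ _) (Pres.acInv _ _ _)
  | hbC' A B C =>
    refine PN.mk (k := bC' _ _ _) ?_ (Pres.ac _ _ _)
    simp only [nh_cj]
    have := bC' A B C ≫= bC_nat (nh A) (nh B) (nh C) =≫ bC' _ _ _
    simp at this
    exact this.symm
  | hbD A B C => exact PN.mk (by simp only [nh_dj]; exact bD_nat _ _ _) (OSt.pres (OSt.ass' _ _ _))
  | hbD' A B C =>
    refine PN.mk (k := bD' _ _ _) ?_ (OSt.pres (OSt.ass _ _ _))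
    simp only [nh_dj]
    have := bD' A B C ≫= bD_nat (nh A) (nh B) (nh C) =≫ bD' _ _ _
    simp at this
    exact this.symm
  | hcC A B => exact PN.mk (by simp only [nh_cj]; exact cC_nat _ _) (Pres.kap _ _)
  | hcD A B => exact PN.mk (by simp only [nh_dj]; exact cD_nat _ _) (OSt.pres (OSt.br _ _))
  | hdd A B C => exact PN.mk (by simp only [nh_dj, nh_cj]; exact dd_nat _ _ _) (Pres.dl _ _ _)
  | hmx A B => exact PN.mk (by simp only [nh_dj, nh_cj]; exact mx_nat _ _) (Pres.mx _ _)
  | hdel B A =>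
    refine PN.mk' (k := act (D := I) (o (Bun.of A).A) ((Bun.of B).d.η ≫ (ρ_ _).inv) ≫ (ρ_ _).hom) ?_ ?_
    · have := hdel_gen (nIso A).hom (DP.base B).η ((nIso (∼B)).hom ⊗ₘ (nIso B).hom) (n_η B)
      rw [← del_act] at this
      exact this
    · have h : CF ((Tr.ten (Bun.of B).T' (Bun.of B).T ⊛ Tr.nil)) ((Bun.of B).d.η ≫ (ρ_ _).inv) := (Bun.of B).hη.st (OSt.run' _)
      exact (Pres.act (.conj (Bun.of A).T (Tr.ten (Bun.of B).T' (Bun.of B).T : Tr P Unit (o _))) h).comp (OSt.run _).pres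
  | hsig B A =>
    refine PN.mk' (k := (Bun.of B).d.ε (o (Bun.of A).A)) ?_ ((Bun.of B).hε _ _)
    refine (congrArg (· ≫ (nIso A).hom) (n_ε B (o A))).trans ?_
    exact hsig_gen (Bun.of B).d _ _

end MPN

namespace MPN
open CategoryTheory MonoidalCategory
variable {P : Type} {Λ : Type}
open Ob OHom

/-- the point associated with an arrow -/
def pnt {A B : Form P} (f : A ⟶ B) : I ⟶ o (Bun.of A).A' ⊗ o (Bun.of B).A :=
  (Bun.of A).d.η ≫ _ ◁ ((nIso A).inv ≫ arr f ≫ (nIso B).hom)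

theorem pnt_CF {A B : Form P} (f : A ⟶ B) : CF ((Bun.of A).T' ⊛ (Bun.of B).T) (pnt f) :=
  Pres.app ((PN.all f).wl _) (Bun.of A).hη

theorem pnt_inj {A B : Form P} {f g : A ⟶ B} (h : pnt f = pnt g) : f = g := by
  have h2 := h =≫ (β_ _ _).hom
  simp only [pnt, Category.assoc, BraidedCategory.braiding_naturality_right] at h2
  have h3 := (Bun.of A).d.swap.det' (k := (nIso A).inv ≫ arr f ≫ (nIso B).hom) (k' := (nIso A).inv ≫ arr g ≫ (nIso B).hom)
    ((Category.assoc _ _ _).trans (h2.trans (Category.assoc _ _ _).symm))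
  rw [cancel_epi, cancel_mono] at h3
  exact arr_inj h3
end MPN

namespace MPN
open CategoryTheory MonoidalCategory
variable {P : Type} {Λ : Type}
open Ob OHom

/-- labels of positive atoms -/
def pos : ∀ {X : Ob P}, Tr P Λ X → Multiset Λ
  | _, .nil => 0
  | _, .lit _ a => {a}
  | _, .nlit _ _ => 0
  | _, .conj x y => pos x + pos y
  | _, .ten x y => pos x + pos y
/-- labels of negative atoms -/
def neg : ∀ {X : Ob P}, Tr P Λ X → Multiset Λ
  | _, .nil => 0
  | _, .lit _ _ => 0
  | _, .nlit _ a => {a}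
  | _, .conj x y => neg x + neg y
  | _, .ten x y => neg x + neg y

section
variable {X Y Z : Ob P} {T : Tr P Λ X} {S : Tr P Λ Y}

theorem OSt.pos_eq {e : X ⟶ Y} (h : OSt T S e) : pos T = pos S := by
  induction h with
  | comp _ _ h1 h2 => rw [h1, h2]
  | ten _ _ h1 h2 => simp [pos, h1, h2]
  | br => simp [pos, add_comm]
  | _ => simp [pos, add_assoc]
theorem OSt.neg_eq {e : X ⟶ Y} (h : OSt T S e) : neg T = neg S := by
  induction h with
  | comp _ _ h1 h2 => rw [h1, h2]
  | ten _ _ h1 h2 => simp [neg, h1, h2]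
  | br => simp [neg, add_comm]
  | _ => simp [neg, add_assoc]
theorem pos_C {X Y : Ob P} (p : Pr P Λ X Y) : pos p.C = pos p.L + pos p.R := by cases p <;> simp [Pr.C, Pr.L, Pr.R, pos]
theorem neg_C {X Y : Ob P} (p : Pr P Λ X Y) : neg p.C = neg p.L + neg p.R := by cases p <;> simp [Pr.C, Pr.L, Pr.R, neg]
theorem CF.bal {u : I ⟶ X} (h : CF T u) : pos T = neg T := by
  induction h with
  | unit => rfl
  | ax p a => simp [pos, neg]
  | ten p _ _ h1 h2 =>
    simp only [pos, neg, pos_C, neg_C] at *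
    have e : ∀ a b c d : Multiset Λ, a + b + c + d = (a + d) + (b + c) := fun a b c d => by ac_rfl
    rw [e, h1, h2, ← e]
  | st _ h ih => rw [← h.pos_eq, ← h.neg_eq, ih]

def ND (T : Tr P Λ X) : Prop := (pos T).Nodup ∧ (neg T).Nodup

def InK (K : Set Λ) (T : Tr P Λ X) : Prop := ∀ a ∈ pos T + neg T, a ∈ K

theorem InK.nil (K : Set Λ) : InK K (.nil : Tr P Λ I) := by simp [InK, pos, neg]
theorem InK.ten {K : Set Λ} : InK K (T ⊛ S) ↔ InK K T ∧ InK K S := by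
  simp only [InK, pos, neg, Multiset.mem_add]; grind
theorem InK.C {K : Set Λ} {X Y : Ob P} (p : Pr P Λ X Y) : InK K p.C ↔ InK K p.L ∧ InK K p.R := by
  simp only [InK, pos_C, neg_C, Multiset.mem_add]; grind
theorem InK.leaves {K : Set Λ} : InK K T ↔ ∀ l ∈ leaves T, InK K l.2 := by
  induction T with
  | nil => simp [InK, pos, neg, MPN.leaves]
  | ten x y h1 h2 => rw [InK.ten, h1, h2]; simp only [MPN.leaves, Multiset.mem_add]; grind
  | _ => simp [MPN.leaves]

theorem nonempty_of_leaf (h : leaves T ≠ 0) : ∃ a, a ∈ pos T + neg T := by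
  induction T with
  | nil => simp [leaves] at h
  | lit p a => exact ⟨a, by simp [pos, neg]⟩
  | nlit p a => exact ⟨a, by simp [pos, neg]⟩
  | conj x y h1 h2 =>
    obtain ⟨a, ha⟩ := h1 (fun h => by have := obj_of_leafless _ h; cases this)
    exact ⟨a, by simp only [pos, neg, Multiset.mem_add] at *; grind⟩
  | ten x y h1 h2 =>
    rw [leaves] at h
    by_cases hx : leaves x = 0
    · obtain ⟨a, ha⟩ := h2 (by simpa [hx] using h)
      exact ⟨a, by simp only [pos, neg, Multiset.mem_add] at *; grind⟩
    · obtain ⟨a, ha⟩ := h1 hx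
      exact ⟨a, by simp only [pos, neg, Multiset.mem_add] at *; grind⟩
theorem leaf_leaf {l : Lf P Λ} (h : l ∈ leaves T) : leaves l.2 = {l} := by
  induction T with
  | nil => simp [leaves] at h
  | ten x y h1 h2 =>
    rcases Multiset.mem_add.1 h with h | h
    exacts [h1 h, h2 h]
  | _ => simp only [leaves, Multiset.mem_singleton] at h; subst h; rfl
theorem leaf_sub {l : Lf P Λ} (h : l ∈ leaves T) : pos l.2 ≤ pos T ∧ neg l.2 ≤ neg T := by
  induction T with
  | nil => simp [leaves] at h
  | ten x y h1 h2 =>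
    rcases Multiset.mem_add.1 h with h | h
    · exact ⟨(h1 h).1.trans (Multiset.le_add_right _ _), (h1 h).2.trans (Multiset.le_add_right _ _)⟩
    · exact ⟨(h2 h).1.trans (Multiset.le_add_left _ _), (h2 h).2.trans (Multiset.le_add_left _ _)⟩
  | _ => simp only [leaves, Multiset.mem_singleton] at h; subst h; exact ⟨le_rfl, le_rfl⟩
theorem ND.ten : ND (T ⊛ S) ↔ ND T ∧ ND S ∧ Disjoint (pos T) (pos S) ∧ Disjoint (neg T) (neg S) := by
  simp only [ND, pos, neg, Multiset.nodup_add]; tauto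
theorem ND.leaves (h : ND T) : (leaves T).Nodup := by
  induction T with
  | nil => simp [MPN.leaves]
  | ten x y h1 h2 =>
    obtain ⟨a, b, c, d⟩ := ND.ten.1 h
    refine Multiset.nodup_add.2 ⟨h1 a, h2 b, ?_⟩
    rw [Multiset.disjoint_left] at *
    intro l hl hl'
    obtain ⟨k, hk⟩ := nonempty_of_leaf (T := l.2) (by rw [leaf_leaf hl]; simp)
    rcases Multiset.mem_add.1 hk with hk | hk
    · exact c (Multiset.mem_of_le (leaf_sub hl).1 hk) (Multiset.mem_of_le (leaf_sub hl').1 hk)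
    · exact d (Multiset.mem_of_le (leaf_sub hl).2 hk) (Multiset.mem_of_le (leaf_sub hl').2 hk)
  | _ => simp [MPN.leaves]
theorem OSt.nd {e : X ⟶ Y} (h : OSt T S e) : ND T ↔ ND S := by rw [ND, h.pos_eq, h.neg_eq]; rfl

/-- a leaf cannot lie on both sides -/
theorem not_both {K : Set Λ} {l : Lf P Λ} (h : l ∈ leaves T) (h1 : InK K l.2) (h2 : InK Kᶜ l.2) : False := by
  obtain ⟨k, hk⟩ := nonempty_of_leaf (T := l.2) (by rw [leaf_leaf h]; simp)
  exact h2 k hk (h1 k hk)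

theorem exists_tree (M : Multiset (Lf P Λ)) (h : ∀ l ∈ M, l ∈ leaves T) : ∃ (W : Ob P) (R : Tr P Λ W), leaves R = M := by
  induction M using Multiset.induction_on with
  | empty => exact ⟨I, .nil, rfl⟩
  | cons l M ih =>
    obtain ⟨W, R, rfl⟩ := ih fun l hl => h l (by simp [hl])
    exact ⟨_, l.2 ⊛ R, by simp [leaves, leaf_leaf (h l (by simp))]⟩

/-- splitting off a subtree -/
theorem ost_split (h : leaves S ≤ leaves T) : ∃ (W : Ob P) (R : Tr P Λ W) (e : X ⟶ Y ⊗ W), OSt T (S ⊛ R) e := by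
  obtain ⟨M, hM⟩ := Multiset.le_iff_exists_add.1 h
  obtain ⟨W, R, hR⟩ := exists_tree (T := T) M (by intro l hl; rw [hM]; simp [hl])
  obtain ⟨e, he⟩ := ost_of_leaves (T := T) (S := S ⊛ R) (by rw [hM, leaves, hR])
  exact ⟨W, R, e, he⟩
end
end MPN

namespace MPN
open CategoryTheory MonoidalCategory
variable {P : Type} {Λ : Type}
open Ob OHom

def Dec {X0 Y0 : Ob P} (p : Pr P Λ X0 Y0) (K : Set Λ) {X : Ob P} (T : Tr P Λ X) (v : I ⟶ X) : Prop :=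
  ∃ (G D : Ob P) (TG : Tr P Λ G) (TD : Tr P Λ D) (v1 : I ⟶ X0 ⊗ G) (v2 : I ⟶ Y0 ⊗ D) (s : _ ⟶ X),
    CF (p.L ⊛ TG) v1 ∧ CF (p.R ⊛ TD) v2 ∧ OSt ((p.C ⊛ TD) ⊛ TG) T s ∧ v = tens v1 v2 ≫ s ∧
    InK K TG ∧ InK Kᶜ TD

theorem mid_nat_r' (A Z : Ob P) {X Y : Ob P} (h : X ⟶ Y) : A ◁ h ▷ Z ≫ mid A Y Z = mid A X Z ≫ h ▷ (A ⊗ Z) := by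
  have e : A ◁ h ▷ Z ≫ (α_ _ _ _).inv = (α_ _ _ _).inv ≫ (A ◁ h) ▷ Z := by simp
  simp only [mid]
  rw [reassoc_of% e, ← comp_whiskerRight_assoc, BraidedCategory.braiding_naturality_right]
  simp

def PK {X0 Y0 : Ob P} (p : Pr P Λ X0 Y0) (K : Set Λ) : Prop := InK K p.L ∧ InK Kᶜ p.R

theorem PK.mix (K : Set Λ) : PK (Pr.mix : Pr P Λ I I) K := ⟨InK.nil K, InK.nil Kᶜ⟩

section
variable {X0 Y0 X Y Z : Ob P} {p : Pr P Λ X0 Y0} {K : Set Λ} {T : Tr P Λ X} {S : Tr P Λ Y}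

theorem ne_leaves {A : Form P} (T : Tr P Λ (o A)) : leaves T ≠ 0 := fun h => by
  have := obj_of_leafless _ h; cases this

theorem PK.leaf (h : PK p K) {l : Lf P Λ} (hl : l ∈ leaves p.C) : ¬ InK K l.2 ∧ ¬ InK Kᶜ l.2 := by
  cases p with
  | mix => simp [Pr.C, leaves] at hl
  | conj x y =>
    simp only [Pr.C, leaves, Multiset.mem_singleton] at hl
    subst hl
    obtain ⟨h1, h2⟩ := h
    refine ⟨fun h => ?_, fun h => ?_⟩
    · obtain ⟨k, hk⟩ := nonempty_of_leaf (ne_leaves y)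
      exact h2 k hk (((InK.C (.conj x y)).1 h).2 k hk)
    · obtain ⟨k, hk⟩ := nonempty_of_leaf (ne_leaves x)
      exact (((InK.C (.conj x y)).1 h).1 k hk) (h1 k hk)

theorem Dec.st {v : I ⟶ X} {e : X ⟶ Y} (h : Dec p K T v) (he : OSt T S e) : Dec p K S (v ≫ e) := by
  obtain ⟨G, D, TG, TD, v1, v2, s, h1, h2, h3, rfl, h5, h6⟩ := h
  exact ⟨G, D, TG, TD, v1, v2, s ≫ e, h1, h2, h3.comp he, by simp, h5, h6⟩

theorem Dec.step {l : Tr P Λ X} {l' : Tr P Λ Y} {R : Tr P Λ Z} {u : I ⟶ X ⊗ Z} {h : X ⟶ Y} (hp : PK p K)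
    (hd : Dec p K (l ⊛ R) u) (hn : ND (l ⊛ R))
    (hl : (InK K l ∧ InK K l') ∨ (InK Kᶜ l ∧ InK Kᶜ l')) (hh : Pres l l' h) :
    Dec p K (l' ⊛ R) (u ≫ h ▷ Z) := by
  obtain ⟨G, D, TG, TD, v1, v2, s, h1, h2, h3, rfl, h5, h6⟩ := hd
  have hnl := hn.leaves
  have hnl' := h3.leaves_eq ▸ hnl
  have hle := h3.leaves_eq
  have nl : (leaves l).Nodup := (Multiset.nodup_add.1 hnl).1
  rcases hl with ⟨ha, hb⟩ | ⟨ha, hb⟩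
  · obtain ⟨W, TM, t, ht⟩ : ∃ (W : Ob P) (TM : Tr P Λ W) (e : G ⟶ X ⊗ W), OSt TG (l ⊛ TM) e := by
      apply ost_split
      rw [Multiset.le_iff_subset nl]
      intro a hal
      have hK := InK.leaves.1 ha a hal
      have : a ∈ leaves (l ⊛ R) := Multiset.mem_add.2 (.inl hal)
      rw [← hle] at this
      rcases Multiset.mem_add.1 this with this | this
      · rcases Multiset.mem_add.1 this with this | this
        · exact ((hp.leaf this).1 hK).elim
        · exact (not_both this hK (InK.leaves.1 h6 a this)).elim
      · exact this
    obtain ⟨t', ht', tt, _⟩ := ht.inv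
    have hin := (InK.ten (T := l) (S := TM) (K := K)).1 (InK.leaves.2 (ht.leaves_eq ▸ InK.leaves.1 h5))
    obtain ⟨r, hr⟩ := ost_of_leaves (T := (p.C ⊛ TD) ⊛ TM) (S := R) (by
      have := ht.leaves_eq
      simp only [leaves] at hle this ⊢
      rw [this] at hle
      exact add_left_cancel (a := leaves l) (by rw [← hle]; ac_rfl))
    have hs : s = _ ◁ t ≫ mid _ _ _ ≫ _ ◁ r :=
      h3.unique ((ht.wl _).comp ((OSt.mid _ _ _).comp (hr.wl _))) hnl'
    refine ⟨_, _, l' ⊛ TM, TD, v1 ≫ _ ◁ t ≫ _ ◁ h ▷ _, v2, mid _ _ _ ≫ _ ◁ r, ?_, h2,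
      (OSt.mid _ _ _).comp (hr.wl _), ?_, InK.ten.2 ⟨hb, hin.2⟩, h6⟩
    · exact Pres.app (((ht.wl _).pres).comp ((hh.wr _).wl _)) h1
    · rw [hs, ← MonoidalCategory.whiskerLeft_comp, tens_rl]
      simp only [Category.assoc]
      rw [whisker_exchange, ← reassoc_of% (mid_nat_r' _ _ h)]
      simp
  · obtain ⟨W, TM, t, ht⟩ : ∃ (W : Ob P) (TM : Tr P Λ W) (e : D ⟶ X ⊗ W), OSt TD (l ⊛ TM) e := by
      apply ost_split
      rw [Multiset.le_iff_subset nl]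
      intro a hal
      have hK := InK.leaves.1 ha a hal
      have : a ∈ leaves (l ⊛ R) := Multiset.mem_add.2 (.inl hal)
      rw [← hle] at this
      rcases Multiset.mem_add.1 this with this | this
      · rcases Multiset.mem_add.1 this with this | this
        · exact ((hp.leaf this).2 hK).elim
        · exact this
      · exact (not_both this (InK.leaves.1 h5 a this) hK).elim
    have hin := (InK.ten (T := l) (S := TM) (K := Kᶜ)).1 (InK.leaves.2 (ht.leaves_eq ▸ InK.leaves.1 h6))
    obtain ⟨r, hr⟩ := ost_of_leaves (T := (p.C ⊛ TM) ⊛ TG) (S := R) (by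
      have := ht.leaves_eq
      simp only [leaves] at hle this ⊢
      rw [this] at hle
      exact add_left_cancel (a := leaves l) (by rw [← hle]; ac_rfl))
    have hs : s = (_ ◁ t) ▷ _ ≫ mid _ _ _ ▷ _ ≫ (α_ _ _ _).hom ≫ _ ◁ r :=
      h3.unique (((ht.wl _).wr _).comp (((OSt.mid _ _ _).wr _).comp ((OSt.ass _ _ _).comp (hr.wl _)))) hnl'
    refine ⟨_, _, TG, l' ⊛ TM, v1, v2 ≫ _ ◁ t ≫ _ ◁ h ▷ _, mid _ _ _ ▷ _ ≫ (α_ _ _ _).hom ≫ _ ◁ r, h1, ?_,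
      ((OSt.mid _ _ _).wr _).comp ((OSt.ass _ _ _).comp (hr.wl _)), ?_, h5, InK.ten.2 ⟨hb, hin.2⟩⟩
    · exact Pres.app (((ht.wl _).pres).comp ((hh.wr _).wl _)) h2
    · rw [hs, ← MonoidalCategory.whiskerLeft_comp, tens_rr]
      simp only [Category.assoc]
      rw [whisker_exchange]
      have := mid_nat_r' (X0 ⊠ Y0) W h
      simp only [MonoidalCategory.whiskerLeft_comp, comp_whiskerRight, Category.assoc]
      have this2 := congrArg (· ▷ G) this
      simp only [comp_whiskerRight] at this2
      rw [reassoc_of% this2]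
      simp
end
end MPN

namespace MPN
open CategoryTheory MonoidalCategory
variable {P : Type} {Λ : Type}
open Ob OHom

/-- adding a one-sided component -/
def ext {B X : Ob P} (b : 𝟙_ (Ob P) ⟶ B) : X ⟶ B ⊗ X := (λ_ X).inv ≫ b ▷ X

section
variable {X0 Y0 X Y Z B : Ob P} {p : Pr P Λ X0 Y0} {K : Set Λ} {T : Tr P Λ X} {S : Tr P Λ Y}

theorem ext_wl (S X : Ob P) (b : 𝟙_ (Ob P) ⟶ B) : S ◁ (ext b : X ⟶ _) = ext b ≫ mid _ _ _ := by
  simp only [ext, Category.assoc]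
  rw [mid_nat_l]; simp [mid]
theorem ext_wr (X G : Ob P) (b : 𝟙_ (Ob P) ⟶ B) : (ext b : X ⟶ _) ▷ G = ext b ≫ (α_ _ _ _).inv := by
  simp [ext]
theorem ext_nat {b : 𝟙_ (Ob P) ⟶ B} (f : X ⟶ Y) : f ≫ ext b = ext b ≫ B ◁ f := by
  rw [ext, ext, Category.assoc, ← whisker_exchange, ← leftUnitor_inv_naturality_assoc]

theorem tens_mix {G D : Ob P} (u : I ⟶ I ⊗ G) (v : I ⟶ I ⊗ D) : tens u v = u ≫ v ▷ G := by rw [tens, act_I]; rfl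
theorem mixK {X : Ob P} (v : 𝟙_ (Ob P) ⟶ X) :
    v = ((v ≫ (λ_ X).inv) ≫ (𝟙 (𝟙_ (Ob P)) ≫ (λ_ _).inv) ▷ X) ≫ (λ_ (𝟙_ (Ob P))).hom ▷ X ≫ (λ_ X).hom := by simp
theorem mixKc {X : Ob P} (v : 𝟙_ (Ob P) ⟶ X) :
    v = ((𝟙 _ ≫ (λ_ _).inv) ≫ (v ≫ (λ_ X).inv) ▷ (𝟙_ (Ob P))) ≫ (λ_ X).hom ▷ _ ≫ (ρ_ X).hom := by
  simp [unitors_inv_equal]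
theorem mixM {G D X : Ob P} (v1 : 𝟙_ (Ob P) ⟶ 𝟙_ (Ob P) ⊗ G) (v2 : 𝟙_ (Ob P) ⟶ 𝟙_ (Ob P) ⊗ D) (s : (𝟙_ (Ob P) ⊗ D) ⊗ G ⟶ X) :
    (v1 ≫ v2 ▷ G) ≫ s = (v1 ≫ (λ_ _).hom) ≫ ext (v2 ≫ (λ_ _).hom) ≫ (λ_ _).inv ▷ _ ≫ s := by simp [ext]

def Ext (K : Set Λ) (T : Tr P Λ X) (S : Tr P Λ Y) (k : X ⟶ Y) : Prop :=
  ∃ (Z : Ob P) (B : Tr P Λ Z) (b : I ⟶ Z) (r : Z ⊗ X ⟶ Y), CF B b ∧ (InK K B ∨ InK Kᶜ B) ∧ OSt (B ⊛ T) S r ∧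
    k = ext b ≫ r

theorem Ext.wl {k : X ⟶ Y} (h : Ext K T S k) (R : Tr P Λ Z) : Ext K (R ⊛ T) (R ⊛ S) (Z ◁ k) := by
  obtain ⟨W, B, b, r, h1, h2, h3, rfl⟩ := h
  refine ⟨W, B, b, mid _ _ _ ≫ _ ◁ r, h1, h2, (OSt.mid _ _ _).comp (h3.wl _), ?_⟩
  rw [MonoidalCategory.whiskerLeft_comp, ext_wl, Category.assoc]
theorem Ext.wr {k : X ⟶ Y} (h : Ext K T S k) (R : Tr P Λ Z) : Ext K (T ⊛ R) (S ⊛ R) (k ▷ Z) := by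
  obtain ⟨W, B, b, r, h1, h2, h3, rfl⟩ := h
  refine ⟨W, B, b, (α_ _ _ _).inv ≫ r ▷ _, h1, h2, (OSt.ass' _ _ _).comp (h3.wr _), ?_⟩
  rw [comp_whiskerRight, ext_wr, Category.assoc]

theorem CF.pres_nil {b : I ⟶ Y} (h : CF S b) : Pres .nil S b := by
  have h1 := (Pres.act .mix (h.st (OSt.lun' S))).comp (OSt.lun S).pres
  rw [act_I] at h1
  have e : (b ≫ (λ_ Y).inv) ≫ (λ_ Y).hom = b := by simp
  exact h1.cast e
theorem ND.nil_ten (h : ND T) : ND (.nil ⊛ T) := by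
  simpa [ND, pos, neg] using h

theorem Dec.ext {k : X ⟶ Y} {w : I ⟶ X} (hp : PK p K) (hd : Dec p K T w) (hk : Ext K T S k) (hn : ND S) :
    Dec p K S (w ≫ k) := by
  obtain ⟨W, B, b, r, h1, h2, h3, rfl⟩ := hk
  have hT : ND T := (ND.ten.1 (h3.nd.2 hn)).2.1
  have := Dec.step hp (hd.st (OSt.lun' T)) hT.nil_ten
    (by rcases h2 with h | h; exacts [.inl ⟨InK.nil _, h⟩, .inr ⟨InK.nil _, h⟩]) h1.pres_nil
  have := this.st h3
  simp only [Category.assoc] at this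
  simp only [MPN.ext, Category.assoc]
  exact this

/-- everything on one side -/
theorem Dec.ofK {v : I ⟶ X} (h : CF T v) (hT : InK K T) : Dec Pr.mix K T v := by
  refine ⟨_, I, T, .nil, v ≫ (λ_ _).inv, 𝟙 _ ≫ (λ_ _).inv, (λ_ _).hom ▷ _ ≫ (λ_ _).hom, h.st (OSt.lun' _), CF.unit.st (OSt.lun' _),
    ((OSt.lun _).wr _).comp (OSt.lun _), ?_, hT, InK.nil _⟩
  exact (mixK v).trans (congrArg (· ≫ _) (tens_mix _ _).symm)
theorem Dec.ofKc {v : I ⟶ X} (h : CF T v) (hT : InK Kᶜ T) : Dec Pr.mix K T v := by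
  refine ⟨I, _, .nil, T, 𝟙 _ ≫ (λ_ _).inv, v ≫ (λ_ _).inv, (λ_ _).hom ▷ _ ≫ (ρ_ _).hom, CF.unit.st (OSt.lun' _), h.st (OSt.lun' _),
    ((OSt.lun _).wr _).comp (OSt.run _), ?_, InK.nil _, hT⟩
  exact (mixKc v).trans (congrArg (· ≫ _) (tens_mix _ _).symm)

/-- principal split is a decomposition -/
theorem Dec.prin {G D : Ob P} {TG : Tr P Λ G} {TD : Tr P Λ D} {u v} (hu : CF (p.L ⊛ TG) u) (hv : CF (p.R ⊛ TD) v)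
    (h1 : InK K TG) (h2 : InK Kᶜ TD) : Dec p K ((p.C ⊛ TD) ⊛ TG) (tens u v) :=
  ⟨_, _, _, _, u, v, 𝟙 _, hu, hv, .id _, by simp, h1, h2⟩

/-- mix decomposition -/
def MDec (K : Set Λ) (T : Tr P Λ X) (u : I ⟶ X) : Prop :=
  ∃ (G D : Ob P) (TG : Tr P Λ G) (TD : Tr P Λ D) (b1 : I ⟶ G) (b2 : I ⟶ D) (s : D ⊗ G ⟶ X), CF TG b1 ∧ CF TD b2 ∧
    OSt (TD ⊛ TG) T s ∧ u = b1 ≫ MPN.ext b2 ≫ s ∧ InK K TG ∧ InK Kᶜ TD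

theorem Dec.mdec {v : I ⟶ X} (h : Dec Pr.mix K T v) : MDec K T v := by
  obtain ⟨G, D, TG, TD, v1, v2, s, h1, h2, h3, rfl, h5, h6⟩ := h
  refine ⟨G, D, TG, TD, v1 ≫ (λ_ _).hom, v2 ≫ (λ_ _).hom, (λ_ _).inv ▷ _ ≫ s, h1.st (OSt.lun _), h2.st (OSt.lun _),
    ((OSt.lun' _).wr _).comp h3, ?_, h5, h6⟩
  exact (congrArg (· ≫ s) (tens_mix v1 v2)).trans (mixM v1 v2 s)
theorem MDec.symm {v : I ⟶ X} (h : MDec K T v) : MDec Kᶜ T v := by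
  obtain ⟨G, D, TG, TD, b1, b2, s, h1, h2, h3, rfl, h5, h6⟩ := h
  refine ⟨D, G, TD, TG, b2, b1, (β_ _ _).hom ≫ s, h2, h1, (OSt.br _ _).comp h3, ?_, h6, by rwa [compl_compl]⟩
  have e : ∀ (b1 : 𝟙_ (Ob P) ⟶ G) (b2 : 𝟙_ (Ob P) ⟶ D), b1 ≫ MPN.ext b2 = b2 ≫ MPN.ext b1 ≫ (β_ _ _).hom := by
    intro b1 b2
    rw [ext_nat, MPN.ext, MPN.ext]
    simp [unitors_inv_equal, ← whisker_exchange_assoc]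
  have := e b1 b2 =≫ s
  simpa using this

/-- peeling the components not connected to `l` -/
theorem MDec.peel {l : Tr P Λ X} {R : Tr P Λ Z} {u : I ⟶ X ⊗ Z} (h : MDec K (l ⊛ R) u) (hn : ND (l ⊛ R)) (hl : InK K l) :
    ∃ (W : Ob P) (R1 : Tr P Λ W) (b : I ⟶ X ⊗ W) (k : W ⟶ Z), CF (l ⊛ R1) b ∧ InK K R1 ∧ Ext K R1 R k ∧ u = b ≫ X ◁ k := by
  obtain ⟨G, D, TG, TD, b1, b2, s, h1, h2, h3, rfl, h5, h6⟩ := h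
  have hnl := hn.leaves
  have hle := h3.leaves_eq
  have nl : (leaves l).Nodup := (Multiset.nodup_add.1 hnl).1
  obtain ⟨W, TM, t, ht⟩ : ∃ (W : Ob P) (TM : Tr P Λ W) (e : G ⟶ X ⊗ W), OSt TG (l ⊛ TM) e := by
    apply ost_split
    rw [Multiset.le_iff_subset nl]
    intro a hal
    have hK := InK.leaves.1 hl a hal
    have : a ∈ leaves (l ⊛ R) := Multiset.mem_add.2 (.inl hal)
    rw [← hle] at this
    rcases Multiset.mem_add.1 this with this | this
    · exact (not_both this hK (InK.leaves.1 h6 a this)).elim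
    · exact this
  have hin := (InK.ten (T := l) (S := TM) (K := K)).1 (InK.leaves.2 (ht.leaves_eq ▸ InK.leaves.1 h5))
  obtain ⟨r, hr⟩ := ost_of_leaves (T := TD ⊛ TM) (S := R) (by
    have := ht.leaves_eq
    simp only [leaves] at hle this ⊢
    rw [this] at hle
    exact add_left_cancel (a := leaves l) (by rw [← hle]; ac_rfl))
  have hs : s = _ ◁ t ≫ mid _ _ _ ≫ _ ◁ r :=
    h3.unique ((ht.wl _).comp ((OSt.mid _ _ _).comp (hr.wl _))) (hle ▸ hnl)
  refine ⟨W, TM, b1 ≫ t, MPN.ext b2 ≫ r, h1.st ht, hin.2, ⟨_, TD, b2, r, h2, .inr h6, hr, rfl⟩, ?_⟩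
  rw [hs, MonoidalCategory.whiskerLeft_comp, ext_wl, ← reassoc_of% (ext_nat (b := b2) t)]
  simp
end
end MPN

namespace MPN
open CategoryTheory MonoidalCategory
variable {P : Type} {Λ : Type}
open Ob OHom

section
variable {X0 Y0 X Y Z G D : Ob P} {p : Pr P Λ X0 Y0} {q : Pr P Λ X Y} {K : Set Λ} {TG : Tr P Λ G} {TD : Tr P Λ D}

theorem pos_prem (q : Pr P Λ X Y) (TG : Tr P Λ G) (TD : Tr P Λ D) :
    pos ((q.C ⊛ TD) ⊛ TG) = pos (q.L ⊛ TG) + pos (q.R ⊛ TD) := by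
  simp only [pos, pos_C]; ac_rfl
theorem neg_prem (q : Pr P Λ X Y) (TG : Tr P Λ G) (TD : Tr P Λ D) :
    neg ((q.C ⊛ TD) ⊛ TG) = neg (q.L ⊛ TG) + neg (q.R ⊛ TD) := by
  simp only [neg, neg_C]; ac_rfl
theorem ND.prem (h : ND ((q.C ⊛ TD) ⊛ TG)) : ND (q.L ⊛ TG) ∧ ND (q.R ⊛ TD) := by
  rw [ND, pos_prem, neg_prem, Multiset.nodup_add, Multiset.nodup_add] at h
  exact ⟨⟨h.1.1, h.2.1⟩, ⟨h.1.2.1, h.2.2.1⟩⟩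

theorem Ext.compl {T : Tr P Λ X} {S : Tr P Λ Y} {k : X ⟶ Y} (h : Ext Kᶜ T S k) : Ext K T S k := by
  obtain ⟨Z, B, b, r, h1, h2, h⟩ := h
  exact ⟨Z, B, b, r, h1, by rw [compl_compl] at h2; exact h2.symm, h⟩

def Side (K : Set Λ) (q : Pr P Λ X Y) : Prop := InK K q.L ∧ InK K q.R
theorem side_of (h : ∀ l ∈ leaves q.C, InK K l.2 ∨ InK Kᶜ l.2) : Side K q ∨ Side Kᶜ q := by
  cases q with
  | mix => exact .inl ⟨InK.nil _, InK.nil _⟩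
  | conj x y =>
    rcases h ⟨_, .conj x y⟩ (by simp [Pr.C, leaves]) with h | h
    · exact .inl ((InK.C (.conj x y)).1 h)
    · exact .inr ((InK.C (.conj x y)).1 h)

theorem caseG {u1 : I ⟶ X ⊗ G} {u2 : I ⟶ Y ⊗ D} (hp : PK p K) (h1 : Dec p K (q.L ⊛ TG) u1)
    (h2 : MDec K (q.R ⊛ TD) u2) (hs : Side K q ∨ Side Kᶜ q) (hn : ND ((q.C ⊛ TD) ⊛ TG)) :
    Dec p K ((q.C ⊛ TD) ⊛ TG) (tens u1 u2) := by
  obtain ⟨W, R1, b, k, c1, c2, c3, rfl⟩ : ∃ (W : Ob P) (R1 : Tr P Λ W) (b : I ⟶ Y ⊗ W) (k : W ⟶ D), CF (q.R ⊛ R1) b ∧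
      ((InK K q.L ∧ InK K (q.C ⊛ R1)) ∨ (InK Kᶜ q.L ∧ InK Kᶜ (q.C ⊛ R1))) ∧ Ext K R1 TD k ∧ u2 = b ≫ Y ◁ k := by
    rcases hs with hs | hs
    · obtain ⟨W, R1, b, k, c1, c2, c3, c4⟩ := h2.peel hn.prem.2 hs.2
      exact ⟨W, R1, b, k, c1, .inl ⟨hs.1, InK.ten.2 ⟨(InK.C _).2 hs, c2⟩⟩, c3, c4⟩
    · obtain ⟨W, R1, b, k, c1, c2, c3, c4⟩ := h2.symm.peel hn.prem.2 hs.2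
      exact ⟨W, R1, b, k, c1, .inr ⟨hs.1, InK.ten.2 ⟨(InK.C _).2 hs, c2⟩⟩, c3.compl, c4⟩
  rw [tens_rr]
  exact Dec.ext hp (Dec.step hp h1 hn.prem.1 c2 (Pres.act q c1)) ((c3.wl _).wr _) hn

theorem caseD {u1 : I ⟶ X ⊗ G} {u2 : I ⟶ Y ⊗ D} (hp : PK p K) (h1 : MDec K (q.L ⊛ TG) u1)
    (h2 : Dec p K (q.R ⊛ TD) u2) (hs : Side K q ∨ Side Kᶜ q) (hn : ND ((q.C ⊛ TD) ⊛ TG)) :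
    Dec p K ((q.C ⊛ TD) ⊛ TG) (tens u1 u2) := by
  obtain ⟨W, R1, b, k, c1, c2, c3, rfl⟩ : ∃ (W : Ob P) (R1 : Tr P Λ W) (b : I ⟶ X ⊗ W) (k : W ⟶ G), CF (q.L ⊛ R1) b ∧
      ((InK K q.R ∧ InK K (q.C ⊛ R1)) ∨ (InK Kᶜ q.R ∧ InK Kᶜ (q.C ⊛ R1))) ∧ Ext K R1 TG k ∧ u1 = b ≫ X ◁ k := by
    rcases hs with hs | hs
    · obtain ⟨W, R1, b, k, c1, c2, c3, c4⟩ := h1.peel hn.prem.1 hs.1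
      exact ⟨W, R1, b, k, c1, .inl ⟨hs.2, InK.ten.2 ⟨(InK.C _).2 hs, c2⟩⟩, c3, c4⟩
    · obtain ⟨W, R1, b, k, c1, c2, c3, c4⟩ := h1.symm.peel hn.prem.1 hs.1
      exact ⟨W, R1, b, k, c1, .inr ⟨hs.2, InK.ten.2 ⟨(InK.C _).2 hs, c2⟩⟩, c3.compl, c4⟩
  rw [tens_rl, tens_actR]
  have := Dec.step hp h2 hn.prem.2 c2 (Pres.actR q c1)
  have := Dec.ext hp (this.st (OSt.sw _ _ _)) (c3.wl _) hn
  simpa using this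

theorem caseB {G D : Ob P} {TG : Tr P Λ G} {TD : Tr P Λ D} {u1 : I ⟶ X0 ⊗ G} {u2 : I ⟶ Y0 ⊗ D} (hp : PK p K)
    (h1 : MDec K (p.L ⊛ TG) u1) (h2 : MDec K (p.R ⊛ TD) u2) (hn : ND ((p.C ⊛ TD) ⊛ TG)) :
    Dec p K ((p.C ⊛ TD) ⊛ TG) (tens u1 u2) := by
  obtain ⟨W, R1, b, k, c1, c2, c3, rfl⟩ := h1.peel hn.prem.1 hp.1
  obtain ⟨W', R1', b', k', c1', c2', c3', rfl⟩ := h2.symm.peel hn.prem.2 hp.2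
  rw [tens_rl, tens_rr]
  refine Dec.ext hp (Dec.ext hp (Dec.prin c1 c1' c2 c2') ((c3'.compl.wl _).wr _) ?_) (c3.wl _) hn
  obtain ⟨Z, B, b, r, d1, d2, d3, d4⟩ := c3.wl (p.C ⊛ TD)
  exact (ND.ten.1 (d3.nd.2 hn)).2.1

def Good (p : Pr P Λ X0 Y0) (K : Set Λ) (T : Tr P Λ X) : Prop :=
  ∀ l ∈ leaves T, InK K l.2 ∨ InK Kᶜ l.2 ∨ l ∈ leaves p.C

/-- leaves of a one-sided or composite piece -/
theorem side_leaves {T : Tr P Λ X} (h : InK K T ∨ InK Kᶜ T) : ∀ l ∈ leaves T, InK K l.2 ∨ InK Kᶜ l.2 := by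
  intro l hl
  rcases h with h | h
  · exact .inl (InK.leaves.1 h l hl)
  · exact .inr (InK.leaves.1 h l hl)

theorem CF.invert {T : Tr P Λ X} {v : I ⟶ X} (h : CF T v) (K : Set Λ) : ∀ {X0 Y0 : Ob P} (p : Pr P Λ X0 Y0), PK p K →
    leaves p.C ≤ leaves T → Good p K T → ND T → Dec p K T v := by
  induction h with
  | unit =>
    intro X0 Y0 p hp hl _ _
    cases p with
    | mix => exact Dec.ofK .unit (InK.nil _)
    | conj x y => simp [Pr.C, leaves] at hl
  | ax c a =>
    intro X0 Y0 p hp hl hg _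
    cases p with
    | mix =>
      rcases hg ⟨_, .nlit c a⟩ (by simp [leaves]) with h | h | h
      · exact Dec.ofK (.ax c a) (by simpa [InK, pos, neg] using h)
      · exact Dec.ofKc (.ax c a) (by simpa [InK, pos, neg] using h)
      · simp [Pr.C, leaves] at h
    | conj x y =>
      have := Multiset.mem_of_le hl (a := ⟨_, .conj x y⟩) (by simp [Pr.C, leaves])
      simp [leaves] at this
  | st hu he ih =>
    intro X0 Y0 p hp hl hg hn
    refine (ih p hp (he.leaves_eq ▸ hl) ?_ (he.nd.2 hn)).st he
    intro l hl; exact hg l (he.leaves_eq ▸ hl)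
  | @ten X Y G D q TG TD u1 u2 hu1 hu2 ih1 ih2 =>
    intro X0 Y0 p hp hl hg hn
    have hnl := hn.leaves
    obtain ⟨n1, n2⟩ := hn.prem
    -- a premise without the principal leaf
    have mk : ∀ {A B : Ob P} {l : Tr P Λ A} {R : Tr P Λ B} {u : I ⟶ A ⊗ B}, (InK K l ∨ InK Kᶜ l) → leaves R ≤ leaves ((q.C ⊛ TD) ⊛ TG) →
        (∀ a ∈ leaves p.C, a ∉ leaves R) → ND (l ⊛ R) → (∀ {X0 Y0 : Ob P} (p : Pr P Λ X0 Y0), PK p K →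
          leaves p.C ≤ leaves (l ⊛ R) → Good p K (l ⊛ R) → ND (l ⊛ R) → Dec p K (l ⊛ R) u) → MDec K (l ⊛ R) u := by
      intro A B l R u s1 s2 s3 s4 s5
      refine (s5 .mix (PK.mix K) (by simp [Pr.C, leaves]) ?_ s4).mdec
      intro a ha
      rcases Multiset.mem_add.1 ha with ha | ha
      · rcases side_leaves s1 a ha with h | h
        exacts [.inl h, .inr (.inl h)]
      · rcases hg a (Multiset.mem_of_le s2 ha) with h | h | h
        exacts [.inl h, .inr (.inl h), (s3 a h ha).elim]
    have lG : leaves TG ≤ leaves ((q.C ⊛ TD) ⊛ TG) := Multiset.le_add_left _ _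
    have lD : leaves TD ≤ leaves ((q.C ⊛ TD) ⊛ TG) := (Multiset.le_add_left _ _).trans (Multiset.le_add_right _ _)
    have lC : leaves q.C ≤ leaves ((q.C ⊛ TD) ⊛ TG) := (Multiset.le_add_right _ _).trans (Multiset.le_add_right _ _)
    obtain ⟨m1, m2, m3⟩ := Multiset.nodup_add.1 hnl
    obtain ⟨m4, m5, m6⟩ := Multiset.nodup_add.1 m1
    -- side condition for a non-principal rule
    have sd : (∀ a ∈ leaves p.C, a ∉ leaves q.C) → Side K q ∨ Side Kᶜ q := fun h =>
      side_of fun a ha => by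
        rcases hg a (Multiset.mem_of_le lC ha) with h' | h' | h'
        exacts [.inl h', .inr h', (h a h' ha).elim]
    have cG : leaves p.C ≤ leaves TG → Dec p K ((q.C ⊛ TD) ⊛ TG) (tens u1 u2) := fun hle => by
      have hs := sd fun a ha hq => Multiset.disjoint_left.1 m3 (Multiset.mem_add.2 (.inl hq)) (Multiset.mem_of_le hle ha)
      refine caseG hp (ih1 p hp (hle.trans (Multiset.le_add_left _ _)) ?_ n1) (mk ?_ lD ?_ n2 ih2) hs hn
      · intro a ha
        rcases Multiset.mem_add.1 ha with ha | ha
        · rcases side_leaves (hs.imp And.left And.left) a ha with h | h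
          exacts [.inl h, .inr (.inl h)]
        · exact hg a (Multiset.mem_of_le lG ha)
      · exact hs.imp And.right And.right
      · intro a ha hq
        exact Multiset.disjoint_left.1 m3 (Multiset.mem_add.2 (.inr hq)) (Multiset.mem_of_le hle ha)
    have cD : leaves p.C ≤ leaves TD → Dec p K ((q.C ⊛ TD) ⊛ TG) (tens u1 u2) := fun hle => by
      have hs := sd fun a ha hq => Multiset.disjoint_left.1 m6 hq (Multiset.mem_of_le hle ha)
      refine caseD hp (mk ?_ lG ?_ n1 ih1) (ih2 p hp (hle.trans (Multiset.le_add_left _ _)) ?_ n2) hs hn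
      · exact hs.imp And.left And.left
      · intro a ha hq
        exact Multiset.disjoint_left.1 m3 (Multiset.mem_add.2 (.inr (Multiset.mem_of_le hle ha))) hq
      · intro a ha
        rcases Multiset.mem_add.1 ha with ha | ha
        · rcases side_leaves (hs.imp And.right And.right) a ha with h | h
          exacts [.inl h, .inr (.inl h)]
        · exact hg a (Multiset.mem_of_le lD ha)
    cases p with
    | mix => exact cG (by simp [Pr.C, leaves])
    | conj x y =>
      have hm := Multiset.mem_of_le hl (a := ⟨_, .conj x y⟩) (by simp [Pr.C, leaves])
      rcases Multiset.mem_add.1 hm with hm | hm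
      · rcases Multiset.mem_add.1 hm with hm | hm
        · cases q with
          | mix => simp [Pr.C, leaves] at hm
          | conj x' y' =>
            simp only [Pr.C, leaves, Multiset.mem_singleton] at hm
            cases hm
            refine caseB hp (mk (.inl hp.1) lG ?_ n1 ih1) (mk (.inr hp.2) lD ?_ n2 ih2) hn
            · intro a ha hq
              exact Multiset.disjoint_left.1 m3 (Multiset.mem_add.2 (.inl ha)) hq
            · intro a ha hq
              exact Multiset.disjoint_left.1 m6 ha hq
        · exact cD (by simpa [Pr.C, leaves] using hm)
      · exact cG (by simpa [Pr.C, leaves] using hm)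
end
end MPN

namespace MPN
open CategoryTheory MonoidalCategory
variable {P : Type} {Λ : Type}
open Ob OHom

section
variable {X Y G D : Ob P}

theorem leafless_pt {TG : Tr P Λ G} (h : leaves TG = 0) (u : I ⟶ I ⊗ G) :
    OSt (.nil) (.nil ⊛ TG : Tr P Λ (I ⊗ G)) u := by
  obtain ⟨e, he⟩ := ost_of_leaves (T := TG) (S := .nil) (by simp [h, leaves])
  obtain ⟨g, hg, h1, h2⟩ := he.inv
  have k : OSt (.nil) (.nil ⊛ TG : Tr P Λ (I ⊗ G)) ((λ_ I).inv ≫ I ◁ g) := (OSt.lun' _).comp (hg.wl _)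
  have : u = ((λ_ I).inv ≫ I ◁ g) := by
    have : u ≫ I ◁ e ≫ (λ_ _).hom = 𝟙 _ := hom_I_I _ _
    have := this =≫ ((λ_ I).inv ≫ I ◁ g)
    simp only [Category.assoc, Iso.hom_inv_id_assoc, ← MonoidalCategory.whiskerLeft_comp, h1] at this
    simpa using this
  rw [this]; exact k

theorem leafless_tens_r {TD : Tr P Λ D} {TG : Tr P Λ G} (h : leaves TG = 0) (u : I ⟶ I ⊗ G) (v : I ⟶ I ⊗ D) :
    ∃ s, OSt (.nil ⊛ TD : Tr P Λ (I ⊗ D)) ((Pr.mix.C ⊛ TD) ⊛ TG) s ∧ tens u v = v ≫ s := by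
  obtain ⟨e, he⟩ := ost_of_leaves (T := TG) (S := .nil) (by simp [h, leaves])
  obtain ⟨g, hg, h1, h2⟩ := he.inv
  have : u = ((λ_ I).inv ≫ I ◁ g) := by
    have : u ≫ I ◁ e ≫ (λ_ _).hom = 𝟙 _ := hom_I_I _ _
    have := this =≫ ((λ_ I).inv ≫ I ◁ g)
    simp only [Category.assoc, Iso.hom_inv_id_assoc, ← MonoidalCategory.whiskerLeft_comp, h1] at this
    simpa using this
  refine ⟨(ρ_ _).inv ≫ _ ◁ g, (OSt.run' _).comp (hg.wl _), ?_⟩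
  rw [tens_mix, this, Category.assoc, whisker_exchange]
  have : (λ_ (I : Ob P)).inv ≫ v ▷ I = v ≫ (ρ_ _).inv := by
    rw [rightUnitor_inv_naturality]; congr 1
  rw [reassoc_of% this]; rfl

theorem leafless_tens_l {TD : Tr P Λ D} {TG : Tr P Λ G} (h : leaves TD = 0) (u : I ⟶ I ⊗ G) (v : I ⟶ I ⊗ D) :
    ∃ s, OSt (.nil ⊛ TG : Tr P Λ (I ⊗ G)) ((Pr.mix.C ⊛ TD) ⊛ TG) s ∧ tens u v = u ≫ s :=
  ⟨_, (leafless_pt h v).wr _, tens_mix _ _⟩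

theorem ax_inv {T : Tr P Λ X} {v : I ⟶ X} (h : CF T v) (p : P) (a : Λ)
    (hl : leaves T = leaves (.nlit p a ⊛ .lit p a)) : ∃ s, OSt (.nlit p a ⊛ .lit p a) T s ∧ v = axp p ≫ s := by
  induction h with
  | unit => simp [leaves] at hl
  | ax q b =>
    obtain ⟨rfl, rfl⟩ : q = p ∧ b = a := by
      have : (⟨_, .lit q b⟩ : Lf P Λ) ∈ leaves (.nlit p a ⊛ .lit p a) := by rw [← hl]; simp [leaves]
      simp [leaves] at this
      obtain ⟨rfl, h⟩ := this
      simpa using h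
    exact ⟨_, .id _, by simp⟩
  | st _ h ih =>
    obtain ⟨s, h1, rfl⟩ := ih (h.leaves_eq.trans hl)
    exact ⟨_, h1.comp h, by simp⟩
  | @ten X Y G D q TG TD u v h1 h2 i1 i2 =>
    cases q with
    | conj x y =>
      have : (⟨_, .conj x y⟩ : Lf P Λ) ∈ leaves (.nlit p a ⊛ .lit p a) := by rw [← hl]; simp [leaves, Pr.C]
      simp [leaves] at this
    | mix =>
      have key : ∀ {Z : Ob P} (R : Tr P Λ Z), leaves R ≤ leaves (.nlit p a ⊛ .lit p a) → pos R = neg R → leaves R ≠ 0 → a ∈ pos R := by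
        intro Z R h hb h0
        obtain ⟨l, hl⟩ := Multiset.exists_mem_of_ne_zero h0
        have := Multiset.mem_of_le h hl
        simp only [leaves, Multiset.singleton_add, Multiset.mem_cons, Multiset.mem_singleton] at this
        rcases this with rfl | rfl
        · rw [hb]; exact Multiset.mem_of_le (leaf_sub hl).2 (by simp [neg])
        · exact Multiset.mem_of_le (leaf_sub hl).1 (by simp [pos])
      have b1 := h1.bal
      have b2 := h2.bal
      simp only [Pr.L, Pr.R, pos, neg, zero_add] at b1 b2
      by_cases hG : leaves TG = 0
      · obtain ⟨s, k1, k2⟩ := leafless_tens_r (TD := TD) hG u v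
        obtain ⟨s', k3, rfl⟩ := i2 (k1.leaves_eq.trans hl)
        exact ⟨_, k3.comp k1, by rw [k2]; simp⟩
      by_cases hD : leaves TD = 0
      · obtain ⟨s, k1, k2⟩ := leafless_tens_l (TG := TG) hD u v
        obtain ⟨s', k3, rfl⟩ := i1 (k1.leaves_eq.trans hl)
        exact ⟨_, k3.comp k1, by rw [k2]; simp⟩
      exfalso
      have m1 := key TG (by rw [← hl]; simp [leaves]) b1 hG
      have m2 := key TD (by rw [← hl]; simp [leaves, Pr.C]) b2 hD
      obtain ⟨e, he⟩ := ost_of_leaves hl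
      have := congrArg Multiset.card he.pos_eq
      simp [pos, Pr.C] at this
      have := Multiset.card_pos_iff_exists_mem.2 ⟨_, m1⟩
      have := Multiset.card_pos_iff_exists_mem.2 ⟨_, m2⟩
      omega

theorem nodup_eq {α : Type*} {A B : Multiset α} (h1 : A.Nodup) (h2 : B.Nodup) (h : ∀ l, l ∈ A ↔ l ∈ B) : A = B :=
  (Multiset.Nodup.ext h1 h2).2 h

theorem CF.thin {T : Tr P Λ X} {u : I ⟶ X} (h : CF T u) : ND T → ∀ v, CF T v → u = v := by
  induction h with
  | unit => intro _ v _; exact hom_I_I _ _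
  | ax p a =>
    intro hn v hv
    obtain ⟨s, h1, rfl⟩ := ax_inv hv p a rfl
    have : s = 𝟙 _ := h1.unique (.id _) hn.leaves
    simp [this]
  | st h he ih =>
    intro hn v hv
    obtain ⟨g, hg, h1, h2⟩ := he.inv
    rw [ih (he.nd.2 hn) _ (hv.st hg)]; simp [h2]
  | @ten X Y G D q TG TD u1 u2 h1 h2 i1 i2 =>
    intro hn v hv
    have hn' := hn
    have b1 := h1.bal
    have b2 := h2.bal
    rw [ND, pos_prem, neg_prem, Multiset.nodup_add, Multiset.nodup_add] at hn
    obtain ⟨K, hK, hKc⟩ : ∃ K : Set Λ, InK K (q.L ⊛ TG) ∧ InK Kᶜ (q.R ⊛ TD) := by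
      refine ⟨{a | a ∈ pos (q.L ⊛ TG)}, fun a ha => ?_, fun a ha => ?_⟩
      · rw [← b1] at ha; simpa using ha
      · rw [← b2] at ha
        exact fun h => Multiset.disjoint_left.1 hn.1.2.2 h (by simpa using ha)
    rw [InK.ten] at hK hKc
    have hp : PK q K := ⟨hK.1, hKc.1⟩
    have good : Good q K ((q.C ⊛ TD) ⊛ TG) := by
      intro l hl
      simp only [leaves, Multiset.mem_add] at hl
      rcases hl with (hl | hl) | hl
      · exact .inr (.inr hl)
      · exact .inr (.inl (InK.leaves.1 hKc.2 l hl))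
      · exact .inl (InK.leaves.1 hK.2 l hl)
    obtain ⟨G', D', TG', TD', v1, v2, s, c1, c2, hs, rfl, k1, k2⟩ := hv.invert K q hp (by simp [leaves, add_assoc]) good hn'
    have hl := hs.leaves_eq
    simp only [leaves] at hl
    have nl := hn'.leaves
    simp only [leaves] at nl
    have nl' := nl
    rw [← hl] at nl'
    have ex : ∀ l, (l ∈ leaves q.C ∨ l ∈ leaves TD') ∨ l ∈ leaves TG' ↔ (l ∈ leaves q.C ∨ l ∈ leaves TD) ∨ l ∈ leaves TG := by
      intro l; rw [← Multiset.mem_add, ← Multiset.mem_add, hl]; simp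
    rw [Multiset.nodup_add, Multiset.nodup_add] at nl nl'
    have A1 : ∀ l ∈ leaves TG, InK K l.2 := InK.leaves.1 hK.2
    have A2 : ∀ l ∈ leaves TG', InK K l.2 := InK.leaves.1 k1
    have A3 : ∀ l ∈ leaves TD, InK Kᶜ l.2 := InK.leaves.1 hKc.2
    have A4 : ∀ l ∈ leaves TD', InK Kᶜ l.2 := InK.leaves.1 k2
    have A5 : ∀ l ∈ leaves q.C, ¬ InK K l.2 ∧ ¬ InK Kᶜ l.2 := fun l h => hp.leaf h
    have eG : leaves TG' = leaves TG := by
      refine nodup_eq nl'.2.1 nl.2.1 fun l => ⟨fun h => ?_, fun h => ?_⟩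
      · rcases (ex l).1 (.inr h) with (h' | h') | h'
        · exact absurd (A2 l h) (A5 l h').1
        · exact (not_both h (A2 l h) (A3 l h')).elim
        · exact h'
      · rcases (ex l).2 (.inr h) with (h' | h') | h'
        · exact absurd (A1 l h) (A5 l h').1
        · exact (not_both h (A1 l h) (A4 l h')).elim
        · exact h'
    have eD : leaves TD' = leaves TD := by
      refine nodup_eq nl'.1.2.1 nl.1.2.1 fun l => ⟨fun h => ?_, fun h => ?_⟩
      · rcases (ex l).1 (.inl (.inr h)) with (h' | h') | h'
        · exact absurd (A4 l h) (A5 l h').2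
        · exact h'
        · exact (not_both h (A1 l h') (A4 l h)).elim
      · rcases (ex l).2 (.inl (.inr h)) with (h' | h') | h'
        · exact absurd (A3 l h) (A5 l h').2
        · exact h'
        · exact (not_both h (A2 l h') (A3 l h)).elim
    obtain ⟨g, hg⟩ := ost_of_leaves eG
    obtain ⟨d, hd⟩ := ost_of_leaves eD
    rw [i1 ⟨hn.1.1, hn.2.1⟩ _ (c1.st (hg.wl _)), i2 ⟨hn.1.2.1, hn.2.2.1⟩ _ (c2.st (hd.wl _)), tens_rl, tens_rr, Category.assoc]
    congr 1
    exact OSt.unique (((hd.wl _).wr _).comp (hg.wl _)) hs (hs.nd.2 hn').leaves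
end
end MPN

namespace MPN
open CategoryTheory MonoidalCategory
variable {P : Type} {Λ : Type}
open Ob OHom

/-- literal occurrences of a tree -/
def Pos : ∀ {X : Ob P}, Tr P Λ X → Type
  | _, .nil => Empty
  | _, .lit _ _ => Unit
  | _, .nlit _ _ => Unit
  | _, .conj x y => Pos x ⊕ Pos y
  | _, .ten x y => Pos x ⊕ Pos y

/-- relabelling of the literal occurrences -/
def rel {M : Type} : ∀ {X : Ob P} (T : Tr P Λ X), (Pos T → M) → Tr P M X
  | _, .nil, _ => .nil
  | _, .lit p _, f => .lit p (f ())
  | _, .nlit p _, f => .nlit p (f ())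
  | _, .conj x y, f => .conj (rel x (fun i => f (.inl i))) (rel y (fun i => f (.inr i)))
  | _, .ten x y, f => .ten (rel x (fun i => f (.inl i))) (rel y (fun i => f (.inr i)))

/-- change of labels -/
def Tr.map {M : Type} (r : Λ → M) : ∀ {X : Ob P}, Tr P Λ X → Tr P M X
  | _, .nil => .nil
  | _, .lit p a => .lit p (r a)
  | _, .nlit p a => .nlit p (r a)
  | _, .conj x y => .conj (x.map r) (y.map r)
  | _, .ten x y => .ten (x.map r) (y.map r)

def Pr.map {M : Type} (r : Λ → M) : ∀ {X Y : Ob P}, Pr P Λ X Y → Pr P M X Y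
  | _, _, .mix => .mix
  | _, _, .conj x y => .conj (x.map r) (y.map r)

section
variable {M N : Type} {X Y G D : Ob P} {T : Tr P Λ X} {S : Tr P Λ Y}

theorem rel_map (r : M → N) (T : Tr P Λ X) : ∀ f : Pos T → M, (rel T f).map r = rel T (fun i => r (f i)) := by
  induction T with
  | nil => intro f; rfl
  | lit p a => intro f; rfl
  | nlit p a => intro f; rfl
  | conj x y h1 h2 => intro f; simp only [rel, Tr.map, h1, h2]
  | ten x y h1 h2 => intro f; simp only [rel, Tr.map, h1, h2]

theorem OSt.map (r : Λ → M) {e : X ⟶ Y} (h : OSt T S e) : OSt (T.map r) (S.map r) e := by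
  induction h with
  | id T => exact .id _
  | comp _ _ h1 h2 => exact h1.comp h2
  | ten _ _ h1 h2 => exact h1.ten h2
  | ass T S R => exact .ass _ _ _
  | ass' T S R => exact .ass' _ _ _
  | br T S => exact .br _ _
  | run T => exact .run _
  | run' T => exact .run' _

theorem CF.map (r : Λ → M) {u : I ⟶ X} (h : CF T u) : CF (T.map r) u := by
  induction h with
  | unit => exact .unit
  | ax p a => exact .ax p _
  | ten p _ _ h1 h2 => cases p with
    | mix => exact .ten .mix h1 h2
    | conj x y => exact .ten (.conj (x.map r) (y.map r)) h1 h2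
  | st _ h ih => exact ih.st (h.map r)

theorem pos_map (r : Λ → M) (T : Tr P Λ X) : pos (T.map r) = (pos T).map r := by
  induction T with
  | nil => rfl
  | lit p a => simp [pos, Tr.map]
  | nlit p a => simp [pos, Tr.map]
  | conj x y h1 h2 => simp [pos, Tr.map, h1, h2]
  | ten x y h1 h2 => simp [pos, Tr.map, h1, h2]
theorem neg_map (r : Λ → M) (T : Tr P Λ X) : neg (T.map r) = (neg T).map r := by
  induction T with
  | nil => rfl
  | lit p a => simp [neg, Tr.map]
  | nlit p a => simp [neg, Tr.map]
  | conj x y h1 h2 => simp [neg, Tr.map, h1, h2]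
  | ten x y h1 h2 => simp [neg, Tr.map, h1, h2]

theorem ND.map {r : Λ → M} (hr : Function.Injective r) (h : ND T) : ND (T.map r) := by
  rw [ND, pos_map, neg_map]
  exact ⟨h.1.map hr, h.2.map hr⟩

theorem OSt.rel {e : X ⟶ Y} (h : OSt T S e) (M : Type) :
    ∃ σ : Pos S → Pos T, ∀ f : Pos T → M, OSt (rel T f) (rel S (fun i => f (σ i))) e := by
  induction h with
  | id T => exact ⟨fun i => i, fun f => .id _⟩
  | comp _ _ h1 h2 =>
    obtain ⟨s, h1⟩ := h1
    obtain ⟨t, h2⟩ := h2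
    exact ⟨fun i => s (t i), fun f => (h1 f).comp (h2 _)⟩
  | ten _ _ h1 h2 =>
    obtain ⟨s, h1⟩ := h1
    obtain ⟨t, h2⟩ := h2
    exact ⟨Sum.map s t, fun f => (h1 _).ten (h2 _)⟩
  | ass T S R => exact ⟨(Equiv.sumAssoc _ _ _).symm, fun f => .ass _ _ _⟩
  | ass' T S R => exact ⟨(Equiv.sumAssoc _ _ _), fun f => .ass' _ _ _⟩
  | br T S => exact ⟨Sum.swap, fun f => .br _ _⟩
  | run T => exact ⟨Sum.inl, fun f => .run _⟩
  | run' T => exact ⟨Sum.elim (fun i => i) Empty.elim, fun f => .run' _⟩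

theorem CF.lift {u : I ⟶ X} (h : CF T u) : ∃ f : Pos T → ℕ, CF (rel T f) u ∧ ND (rel T f) := by
  induction h with
  | unit => exact ⟨Empty.elim, .unit, by simp [ND, MPN.rel, pos, neg]⟩
  | ax p a => exact ⟨fun _ => 0, .ax p 0, by simp [ND, MPN.rel, pos, neg]⟩
  | st _ h ih =>
    obtain ⟨f, h1, h2⟩ := ih
    obtain ⟨s, hs⟩ := h.rel ℕ
    exact ⟨_, h1.st (hs f), (hs f).nd.1 h2⟩
  | @ten X Y G D q TG TD u v h1 h2 i1 i2 =>
    obtain ⟨f, a1, b1⟩ := i1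
    obtain ⟨g, a2, b2⟩ := i2
    have r1 : Function.Injective (fun n : ℕ => 2 * n) := fun a b h => by simp at h; exact h
    have r2 : Function.Injective (fun n : ℕ => 2 * n + 1) := fun a b h => by simp at h; exact h
    replace b1 := b1.map r1
    replace b2 := b2.map r2
    have d : ∀ A B : Multiset ℕ, Disjoint (A.map fun n : ℕ => 2 * n) (B.map fun n : ℕ => 2 * n + 1) := by
      intro A B
      rw [Multiset.disjoint_left]
      intro a ha hb
      obtain ⟨x, _, rfl⟩ := Multiset.mem_map.1 ha
      obtain ⟨y, _, hy⟩ := Multiset.mem_map.1 hb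
      omega
    have d1 := d (pos (rel _ f)) (pos (rel _ g))
    have d2 := d (neg (rel _ f)) (neg (rel _ g))
    rw [← pos_map, ← pos_map] at d1
    rw [← neg_map, ← neg_map] at d2
    replace a1 := a1.map (fun n : ℕ => 2 * n)
    replace a2 := a2.map (fun n : ℕ => 2 * n + 1)
    rw [rel_map] at a1 a2 b1 b2
    rw [rel_map, rel_map] at d1 d2
    generalize (fun i => 2 * f i) = f at *
    generalize (fun i => 2 * g i + 1) = g at *
    have key : ∀ {A B C D : Multiset ℕ}, (A + B).Nodup → (C + D).Nodup → Disjoint (A + B) (C + D) → ((A + C + D) + B).Nodup := by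
      intro A B C D h1 h2 h3
      have : A + C + D + B = (A + B) + (C + D) := by ac_rfl
      rw [this, Multiset.nodup_add]; exact ⟨h1, h2, h3⟩
    cases q with
    | mix =>
      refine ⟨fun i => match i with | .inl (.inr i) => g (.inr i) | .inr i => f (.inr i), CF.ten .mix a1 a2, ?_⟩
      have h1 := key b1.1 b2.1 d1
      have h2 := key b1.2 b2.2 d2
      exact ⟨h1, h2⟩
    | conj x y =>
      have c := CF.ten (.conj (rel x (fun i => f (.inl i))) (rel y (fun i => g (.inl i)))) (u := u) (v := v) (TG := rel TG (fun i => f (.inr i))) (TD := rel TD (fun i => g (.inr i))) a1 a2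
      refine ⟨fun i => match i with | .inl (.inl (.inl i)) => f (.inl i) | .inl (.inl (.inr i)) => g (.inl i) | .inl (.inr i) => g (.inr i) | .inr i => f (.inr i), c, ?_⟩
      have h1 := key b1.1 b2.1 d1
      have h2 := key b1.2 b2.2 d2
      exact ⟨h1, h2⟩
end

theorem rel_thin {X : Ob P} {T : Tr P Λ X} {u v : I ⟶ X} {f g : Pos T → ℕ} (hu : CF (rel T f) u) (hv : CF (rel T g) v)
    (hn : ND (rel T g)) (h : ∀ i j, f i = f j → g i = g j) : u = v := by
  obtain ⟨r, hr⟩ : ∃ r : ℕ → ℕ, ∀ i, r (f i) = g i := by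
    classical
    refine ⟨fun n => if h : ∃ i, f i = n then g h.choose else 0, fun i => ?_⟩
    have hh : ∃ j, f j = f i := ⟨i, rfl⟩
    simp only [hh, dif_pos]
    exact h _ _ hh.choose_spec
  have k := hu.map r
  rw [rel_map] at k
  simp only [hr] at k
  exact k.thin hn v hv
end MPN

namespace MPN
open CategoryTheory MonoidalCategory
variable {P : Type} {Λ : Type}
open Ob OHom

/-! ### A relational model -/

def V : Form P → Type
  | .letter _ => Prop
  | .neg A => V A
  | .conj A B => V A × V B
  | .disj A B => V A × V B

def tsem : ∀ {A B : Form P}, Term P A B → V A → V B → Prop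
  | _, _, .id _ => fun x y => x = y
  | _, _, .comp g f => fun x z => ∃ y, tsem f x y ∧ tsem g y z
  | _, _, .conj f g => fun x y => tsem f x.1 y.1 ∧ tsem g x.2 y.2
  | _, _, .disj f g => fun x y => tsem f x.1 y.1 ∧ tsem g x.2 y.2
  | _, _, .bConjTo _ _ _ => fun x y => y.1.1 = x.1 ∧ y.1.2 = x.2.1 ∧ y.2 = x.2.2
  | _, _, .bConjFrom _ _ _ => fun x y => y.1 = x.1.1 ∧ y.2.1 = x.1.2 ∧ y.2.2 = x.2
  | _, _, .bDisjTo _ _ _ => fun x y => y.1.1 = x.1 ∧ y.1.2 = x.2.1 ∧ y.2 = x.2.2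
  | _, _, .bDisjFrom _ _ _ => fun x y => y.1 = x.1.1 ∧ y.2.1 = x.1.2 ∧ y.2.2 = x.2
  | _, _, .cConj _ _ => fun x y => y.1 = x.2 ∧ y.2 = x.1
  | _, _, .cDisj _ _ => fun x y => y.1 = x.2 ∧ y.2 = x.1
  | _, _, .d _ _ _ => fun x y => y.1.1 = x.1 ∧ y.1.2 = x.2.1 ∧ y.2 = x.2.2
  | _, _, .delta B _ => fun x y => y.1 = x ∧ (show V B from y.2.1) = y.2.2
  | _, _, .sigma B _ => fun x y => x.1.1 = (show V B from x.1.2) ∧ x.2 = y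
  | _, _, .mix _ _ => fun x y => y.1 = x.1 ∧ y.2 = x.2

section
variable {A B C D : Form P}
theorem ex_conj {p : V (A ⋏ B) → Prop} : (∃ y, p y) ↔ ∃ a b, p (a, b) := Prod.exists
theorem ex_disj {p : V (A ⋎ B) → Prop} : (∃ y, p y) ↔ ∃ a b, p (a, b) := Prod.exists
theorem eq_conj {x y : V (A ⋏ B)} : x = y ↔ x.1 = y.1 ∧ x.2 = y.2 := Prod.ext_iff
theorem eq_disj {x y : V (A ⋎ B)} : x = y ↔ x.1 = y.1 ∧ x.2 = y.2 := Prod.ext_iff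
theorem ex_neg {p : V (∼A) → Prop} : (∃ y, p y) ↔ ∃ a : V A, p a := Iff.rfl
theorem eq_neg {x y : V (∼A)} : x = y ↔ (show V A from x) = (show V A from y) := Iff.rfl

theorem tsem_sound {f g : Term P A B} (h : Eqv f g) : ∀ x y, tsem f x y ↔ tsem g x y := by
  induction h with
  | refl => simp
  | symm _ h => intro x y; rw [h]
  | trans _ _ h1 h2 => intro x y; rw [h1, h2]
  | congComp _ _ h1 h2 => intro x y; simp only [tsem, h1, h2]
  | congConj _ _ h1 h2 => intro x y; simp only [tsem, h1, h2]
  | congDisj _ _ h1 h2 => intro x y; simp only [tsem, h1, h2]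
  | catIdR => intro x y; simp [tsem]
  | catIdL => intro x y; simp [tsem]
  | catAssoc => intro x y; simp only [tsem]; grind
  | deltaNat => intro x y; simp only [tsem, ex_conj, ex_disj, eq_conj, eq_disj]; grind
  | sigmaNat => intro x y; simp only [tsem, ex_conj, ex_disj, eq_conj, eq_disj]; grind
  | sigmaDelta A =>
    intro x y; simp only [tsem, ex_conj, ex_disj, eq_conj, eq_disj]
    constructor
    · grind
    · rintro rfl
      let z : V (∼A) := x
      exact ⟨x, z, x, ⟨x, z, x, ⟨rfl, rfl⟩, rfl, rfl, rfl⟩, rfl, rfl⟩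
  | sigmaDelta' A =>
    intro x y; simp only [tsem, sigma', delta', ex_conj, ex_disj, eq_conj, eq_disj, eq_neg, ex_neg]
    constructor
    · grind
    · rintro rfl
      let z : V A := x
      refine ⟨z, z, z, ⟨z, z, z, ⟨z, z, z, ⟨rfl, rfl⟩, rfl, rfl, rfl⟩, rfl, rfl, rfl⟩, z, z, z, ⟨⟨rfl, rfl⟩, rfl⟩, rfl, rfl⟩
  | _ =>
    intro x y
    simp only [tsem, dR, sigmaConj, deltaDisj, ex_conj, ex_disj, eq_conj, eq_disj]
    try grind
end
end MPN

namespace MPN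
open CategoryTheory MonoidalCategory
variable {P : Type} {Λ : Type}
open Ob OHom

def hsem {A B : Form P} (f : Hm A B) : V A → V B → Prop :=
  Quot.lift tsem (fun _ _ h => funext fun x => funext fun y => propext (tsem_sound h x y)) f
def sem {A B : Form P} (f : A ⟶ B) : V A → V B → Prop := hsem f

section
variable {A B C D E : Form P}
theorem sem_tm (f : Term P A B) : sem (tm f) = tsem f := rfl
@[simp] theorem sem_id (x y : V A) : sem (𝟙 A) x y ↔ x = y := Iff.rfl
@[simp] theorem sem_comp (f : A ⟶ B) (g : B ⟶ C) (x : V A) (z : V C) : sem (f ≫ g) x z ↔ ∃ y, sem f x y ∧ sem g y z := by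
  obtain ⟨f, rfl⟩ := tm_surj f
  obtain ⟨g, rfl⟩ := tm_surj g
  exact Iff.rfl
@[simp] theorem sem_cj (f : A ⟶ B) (g : C ⟶ D) (x) (y) : sem (cj f g) x y ↔ sem f x.1 y.1 ∧ sem g x.2 y.2 := by
  obtain ⟨f, rfl⟩ := tm_surj f
  obtain ⟨g, rfl⟩ := tm_surj g
  exact Iff.rfl
@[simp] theorem sem_dj (f : A ⟶ B) (g : C ⟶ D) (x) (y) : sem (dj f g) x y ↔ sem f x.1 y.1 ∧ sem g x.2 y.2 := by
  obtain ⟨f, rfl⟩ := tm_surj f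
  obtain ⟨g, rfl⟩ := tm_surj g
  exact Iff.rfl
@[simp] theorem sem_bC (x y) : sem (bC A B C) x y ↔ y.1.1 = x.1 ∧ y.1.2 = x.2.1 ∧ y.2 = x.2.2 := Iff.rfl
@[simp] theorem sem_bC' (x y) : sem (bC' A B C) x y ↔ y.1 = x.1.1 ∧ y.2.1 = x.1.2 ∧ y.2.2 = x.2 := Iff.rfl
@[simp] theorem sem_bD (x y) : sem (bD A B C) x y ↔ y.1.1 = x.1 ∧ y.1.2 = x.2.1 ∧ y.2 = x.2.2 := Iff.rfl
@[simp] theorem sem_bD' (x y) : sem (bD' A B C) x y ↔ y.1 = x.1.1 ∧ y.2.1 = x.1.2 ∧ y.2.2 = x.2 := Iff.rfl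
@[simp] theorem sem_cC (x y) : sem (cC A B) x y ↔ y.1 = x.2 ∧ y.2 = x.1 := Iff.rfl
@[simp] theorem sem_cD (x y) : sem (cD A B) x y ↔ y.1 = x.2 ∧ y.2 = x.1 := Iff.rfl
@[simp] theorem sem_dd (x y) : sem (dd A B C) x y ↔ y.1.1 = x.1 ∧ y.1.2 = x.2.1 ∧ y.2 = x.2.2 := Iff.rfl
@[simp] theorem sem_mx (x y) : sem (mx A B) x y ↔ y.1 = x.1 ∧ y.2 = x.2 := Iff.rfl
@[simp] theorem sem_del (x y) : sem (del A B) x y ↔ y.1 = x ∧ (show V A from y.2.1) = y.2.2 := Iff.rfl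

theorem V_ne : ∀ A : Form P, Nonempty (V A)
  | .letter _ => ⟨True⟩
  | .neg A => V_ne A
  | .conj A B => ⟨((V_ne A).some, (V_ne B).some)⟩
  | .disj A B => ⟨((V_ne A).some, (V_ne B).some)⟩

/-- the subset defined by a point -/
def S (u : Pt A) (x : V A) : Prop := ∃ (Z : Form P) (z : V Z), sem (u.l Z) z (x, z)

theorem sem_l_aux (u : Pt A) (Z W : Form P) (z z' : V Z) (w w' : V W) (x : V A) :
    (sem (u.l Z) z (x, z') ∧ w = w') ↔ (z = z' ∧ sem (u.l W) w (x, w')) := by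
  have h : cC Z W ≫ (cj (u.l W) (𝟙 Z) ≫ bC' A W Z) = (cj (u.l Z) (𝟙 W) ≫ bC' A Z W) ≫ cj (𝟙 A) (cC Z W) := by
    rw [← u.ass, ← u.ass, u.nat]
  have k : ∀ (p : V (Z ⋏ W)) (q : V (A ⋏ (W ⋏ Z))), (sem (u.l Z) p.1 (q.1, q.2.2) ∧ p.2 = q.2.1) ↔
      (p.1 = q.2.2 ∧ sem (u.l W) p.2 (q.1, q.2.1)) := by
    intro p q
    have k := iff_of_eq (congrArg (fun f : (Z ⋏ W) ⟶ A ⋏ (W ⋏ Z) => sem f p q) h)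
    simp only [sem_comp, sem_cj, sem_cC, sem_bC', sem_id, ex_conj] at k
    constructor
    · rintro ⟨h1, h2⟩
      obtain ⟨a, b, ⟨h3, h4⟩, c1, c2, d, ⟨h5, h6⟩, h7, h8, h9⟩ := k.2 ⟨_, _, _, ⟨_, _, _, ⟨h1, h2⟩, rfl, rfl, rfl⟩, rfl, rfl, rfl⟩
      subst h3 h4 h6
      rw [h7, h8, h9]
      exact ⟨rfl, h5⟩
    · rintro ⟨h1, h2⟩
      obtain ⟨a, b1, b2, ⟨c1, c2, d, ⟨h3, h4⟩, h5, h6, h7⟩, h8, h9, h10⟩ := k.1 ⟨_, _, ⟨rfl, rfl⟩, _, _, _, ⟨h2, h1⟩, rfl, rfl, rfl⟩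
      subst h5 h6 h7
      rw [← h8, h9, h10]
      exact ⟨h3, h4⟩
  exact k (z, w) (x, (w', z'))
theorem sem_l (u : Pt A) (Z : Form P) (z : V Z) (y) : sem (u.l Z) z y ↔ z = y.2 ∧ S u y.1 := by
  obtain ⟨x, z'⟩ := y
  constructor
  · intro h
    have := (sem_l_aux u Z Z z z' z z x).1 ⟨h, rfl⟩
    exact ⟨this.1, Z, z, this.2⟩
  · rintro ⟨rfl, W, w, h⟩
    exact ((sem_l_aux u Z W z z w w x).2 ⟨rfl, h⟩).1
@[simp] theorem sem_a (u : Pt A) (Z : Form P) (z : V Z) (y) : sem (u.a Z) z y ↔ z = y.2 ∧ S u y.1 := by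
  simp only [Pt.a, sem_comp, sem_l, sem_mx, ex_conj]; grind
theorem S_push (u : Pt A) (f : A ⟶ B) (y : V B) : S (u.push f) y ↔ ∃ x, S u x ∧ sem f x y := by
  have h : ∀ (z : V A) (p : V (B ⋏ A)), (∃ a b, (z = b ∧ S u a) ∧ sem f a p.1 ∧ b = p.2) ↔ z = p.2 ∧ S (u.push f) p.1 := by
    intro z p
    rw [← sem_l (u.push f) A z p]
    have e : (u.push f).l A = u.l A ≫ cj f (𝟙 A) := rfl
    rw [e]
    simp only [sem_comp, sem_l, sem_cj, ex_conj, sem_id]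
  obtain ⟨z⟩ := V_ne A
  have h := h z (y, z)
  refine Iff.trans ⟨fun k => ⟨rfl, k⟩, fun k => k.2⟩ (h.symm.trans ?_)
  exact ⟨fun ⟨a, b, ⟨h1, h2⟩, h3, h4⟩ => ⟨a, h2, h3⟩, fun ⟨a, h1, h2⟩ => ⟨a, z, ⟨rfl, h1⟩, h2, rfl⟩⟩

def OV : Ob P → Type
  | I => Unit
  | o A => V A

def ou : OV (I : Ob P) := ()

def osem : ∀ {X Y : Ob P}, OHom X Y → OV X → OV Y → Prop
  | _, _, .nil => fun _ _ => True
  | _, _, .pt u => fun _ x => S u x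
  | _, _, .ar f => fun x y => sem f x y

def pp : ∀ {X Y : Ob P}, OV X → OV Y → OV (oten X Y)
  | I, _, _, y => y
  | o _, I, x, _ => x
  | o _, o _, x, y => (x, y)
def pc : ∀ {X Y : Ob P}, OV X → OV Y → OV (ocj X Y)
  | I, _, _, y => y
  | o _, I, x, _ => x
  | o _, o _, x, y => (x, y)
end
section
variable {X Y Z X' Y' G D : Ob P}
theorem pp_inj {a a' : OV X} {b b' : OV Y} : pp a b = pp a' b' ↔ a = a' ∧ b = b' := by
  cases X with
  | I => exact ⟨fun h => ⟨rfl, h⟩, fun h => h.2⟩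
  | o X => cases Y with
    | I => exact ⟨fun h => ⟨h, rfl⟩, fun h => h.1⟩
    | o Y => exact Prod.mk.injEq .. ▸ Iff.rfl
theorem pc_inj {a a' : OV X} {b b' : OV Y} : pc a b = pc a' b' ↔ a = a' ∧ b = b' := by
  cases X with
  | I => exact ⟨fun h => ⟨rfl, h⟩, fun h => h.2⟩
  | o X => cases Y with
    | I => exact ⟨fun h => ⟨h, rfl⟩, fun h => h.1⟩
    | o Y => exact Prod.mk.injEq .. ▸ Iff.rfl
theorem pp_surj (z : OV (oten X Y)) : ∃ a b, z = pp a b := by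
  cases X with
  | I => exact ⟨(), z, rfl⟩
  | o X => cases Y with
    | I => exact ⟨z, (), rfl⟩
    | o Y => exact ⟨z.1, z.2, rfl⟩
theorem pc_surj (z : OV (ocj X Y)) : ∃ a b, z = pc a b := by
  cases X with
  | I => exact ⟨(), z, rfl⟩
  | o X => cases Y with
    | I => exact ⟨z, (), rfl⟩
    | o Y => exact ⟨z.1, z.2, rfl⟩

theorem osem_oid (x y : OV X) : osem (oid X) x y ↔ x = y := by
  cases X with
  | I => exact ⟨fun _ => rfl, fun _ => trivial⟩
  | o A => exact Iff.rfl
theorem osem_ocomp (f : OHom X Y) (g : OHom Y Z) (x z) : osem (ocomp f g) x z ↔ ∃ y, osem f x y ∧ osem g y z := by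
  cases f with
  | nil => exact ⟨fun h => ⟨(), trivial, h⟩, fun ⟨_, _, h⟩ => h⟩
  | pt u => cases g with
    | ar g => exact S_push u g z
  | ar f => cases g with
    | ar g => exact sem_comp f g x z
theorem osem_htn (f : OHom X Y) (g : OHom X' Y') (a a' b b') :
    osem (htn f g) (pp a a') (pp b b') ↔ osem f a b ∧ osem g a' b' := by
  cases f with
  | nil => exact ⟨fun h => ⟨trivial, h⟩, fun h => h.2⟩
  | pt u => cases g with
    | nil => exact ⟨fun h => ⟨h, trivial⟩, fun h => h.1⟩
    | pt v =>
      refine (S_push v _ _).trans ?_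
      constructor
      · rintro ⟨x, h1, h2⟩
        obtain ⟨h2, h3⟩ := (sem_a _ _ _ _).1 h2
        cases h2
        exact ⟨h3, h1⟩
      · rintro ⟨h1, h2⟩
        exact ⟨_, h2, (sem_a _ _ _ _).2 ⟨rfl, h1⟩⟩
    | ar g =>
      refine (sem_comp _ _ _ _).trans ?_
      constructor
      · rintro ⟨x, h1, h2⟩
        obtain ⟨h2, h3⟩ := (sem_a _ _ _ _).1 h2
        cases h2
        exact ⟨h3, h1⟩
      · rintro ⟨h1, h2⟩
        exact ⟨_, h2, (sem_a _ _ _ _).2 ⟨rfl, h1⟩⟩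
  | ar f => cases g with
    | nil => exact ⟨fun h => ⟨h, trivial⟩, fun h => h.1⟩
    | pt v =>
      refine (sem_comp _ _ _ _).trans ?_
      constructor
      · rintro ⟨x, h1, h2⟩
        obtain ⟨⟨c, d⟩, h2, h3⟩ := (sem_comp _ _ _ _).1 h2
        obtain ⟨h2, h4⟩ := (sem_a _ _ _ _).1 h2
        obtain ⟨h5, h6⟩ := (sem_cD _ _).1 h3
        cases h2; cases h5; cases h6
        exact ⟨h1, h4⟩
      · rintro ⟨h1, h2⟩
        exact ⟨_, h1, (sem_comp _ _ _ _).2 ⟨(b', b), (sem_a _ _ _ _).2 ⟨rfl, h2⟩, (sem_cD _ _).2 ⟨rfl, rfl⟩⟩⟩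
    | ar g => exact sem_dj _ _ _ _
theorem osem_hcj (f : OHom X Y) (g : OHom X' Y') (a a' b b') :
    osem (hcj f g) (pc a a') (pc b b') ↔ osem f a b ∧ osem g a' b' := by
  cases f with
  | nil => exact ⟨fun h => ⟨trivial, h⟩, fun h => h.2⟩
  | pt u => cases g with
    | nil => exact ⟨fun h => ⟨h, trivial⟩, fun h => h.1⟩
    | pt v =>
      refine (S_push v _ _).trans ?_
      constructor
      · rintro ⟨x, h1, h2⟩
        obtain ⟨h2, h3⟩ := (sem_l _ _ _ _).1 h2
        cases h2
        exact ⟨h3, h1⟩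
      · rintro ⟨h1, h2⟩
        exact ⟨_, h2, (sem_l _ _ _ _).2 ⟨rfl, h1⟩⟩
    | ar g =>
      refine (sem_comp _ _ _ _).trans ?_
      constructor
      · rintro ⟨x, h1, h2⟩
        obtain ⟨h2, h3⟩ := (sem_l _ _ _ _).1 h2
        cases h2
        exact ⟨h3, h1⟩
      · rintro ⟨h1, h2⟩
        exact ⟨_, h2, (sem_l _ _ _ _).2 ⟨rfl, h1⟩⟩
  | ar f => cases g with
    | nil => exact ⟨fun h => ⟨h, trivial⟩, fun h => h.1⟩
    | pt v =>
      refine (sem_comp _ _ _ _).trans ?_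
      constructor
      · rintro ⟨x, h1, h2⟩
        obtain ⟨⟨c, d⟩, h2, h3⟩ := (sem_comp _ _ _ _).1 h2
        obtain ⟨h2, h4⟩ := (sem_l _ _ _ _).1 h2
        obtain ⟨h5, h6⟩ := (sem_cC _ _).1 h3
        cases h2; cases h5; cases h6
        exact ⟨h1, h4⟩
      · rintro ⟨h1, h2⟩
        exact ⟨_, h1, (sem_comp _ _ _ _).2 ⟨(b', b), (sem_l _ _ _ _).2 ⟨rfl, h2⟩, (sem_cC _ _).2 ⟨rfl, rfl⟩⟩⟩
    | ar g => exact sem_cj _ _ _ _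

theorem osem_oass (a : OV X) (b : OV Y) (c : OV Z) (w) : osem (oass X Y Z) (pp (pp a b) c) w ↔ w = pp a (pp b c) := by
  cases X with
  | I => exact (osem_oid _ _).trans eq_comm
  | o X => cases Y with
    | I => exact (osem_oid _ _).trans eq_comm
    | o Y => cases Z with
      | I => exact (osem_oid _ _).trans eq_comm
      | o Z => exact ⟨fun h => Prod.ext h.1 (Prod.ext h.2.1 h.2.2), fun h => by cases h; exact ⟨rfl, rfl, rfl⟩⟩
theorem osem_oass' (a : OV X) (b : OV Y) (c : OV Z) (w) : osem (oass' X Y Z) (pp a (pp b c)) w ↔ w = pp (pp a b) c := by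
  cases X with
  | I => exact (osem_oid _ _).trans eq_comm
  | o X => cases Y with
    | I => exact (osem_oid _ _).trans eq_comm
    | o Y => cases Z with
      | I => exact (osem_oid _ _).trans eq_comm
      | o Z => exact ⟨fun h => Prod.ext (Prod.ext h.1 h.2.1) h.2.2, fun h => by cases h; exact ⟨rfl, rfl, rfl⟩⟩
theorem osem_obr (a : OV X) (b : OV Y) (w) : osem (obr X Y) (pp a b) w ↔ w = pp b a := by
  cases X with
  | I => cases Y with
    | I => exact ⟨fun _ => rfl, fun _ => trivial⟩
    | o Y => exact eq_comm
  | o X => cases Y with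
    | I => exact eq_comm
    | o Y => exact ⟨fun h => Prod.ext h.1 h.2, fun h => by cases h; exact ⟨rfl, rfl⟩⟩
theorem osem_orun (a : OV X) (w) : osem (orun X) (pp a ou) w ↔ w = a := by
  cases X with
    | I => exact ⟨fun _ => rfl, fun _ => trivial⟩
    | o Y => exact eq_comm
theorem osem_orun' (a : OV X) (w) : osem (orun' X) a w ↔ w = pp a ou := by
  cases X with
    | I => exact ⟨fun _ => rfl, fun _ => trivial⟩
    | o Y => exact eq_comm
theorem osem_ocr (a : OV X) (w) : osem (ocr X) a w ↔ w = pc a ou := by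
  cases X with
    | I => exact ⟨fun _ => rfl, fun _ => trivial⟩
    | o Y => exact eq_comm
theorem osem_odd (a : OV X) (b : OV Y) (c : OV Z) (w) : osem (odd X Y Z) (pc a (pp b c)) w ↔ w = pp (pc a b) c := by
  cases X with
  | I => exact (osem_oid _ _).trans eq_comm
  | o X => cases Y with
    | I => cases Z with
      | I => exact (osem_oid _ _).trans eq_comm
      | o Z => exact ⟨fun h => Prod.ext h.1 h.2, fun h => by cases h; exact ⟨rfl, rfl⟩⟩
    | o Y => cases Z with
      | I => exact (osem_oid _ _).trans eq_comm
      | o Z => exact ⟨fun h => Prod.ext (Prod.ext h.1 h.2.1) h.2.2, fun h => by cases h; exact ⟨rfl, rfl, rfl⟩⟩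

theorem osem_tens (u : I ⟶ X ⊗ G) (v : I ⟶ Y ⊗ D) (x : OV X) (y : OV Y) (d g) :
    osem (tens u v) ou (pp (pp (pc x y) d) g) ↔ osem u ou (pp x g) ∧ osem v ou (pp y d) := by
  have e : tens u v = ocomp u (htn (ocomp (ocr X) (ocomp (hcj (oid X) v) (odd X Y D))) (oid G)) := rfl
  rw [e]
  refine (osem_ocomp _ _ _ _).trans ?_
  have k : ∀ x', osem (ocomp (ocr X) (ocomp (hcj (oid X) v) (odd X Y D))) x' (pp (pc x y) d) ↔ x' = x ∧ osem v ou (pp y d) := by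
    intro x'
    simp only [osem_ocomp, osem_ocr]
    constructor
    · rintro ⟨_, rfl, z, h1, h2⟩
      obtain ⟨a, b, rfl⟩ := pc_surj z
      obtain ⟨b, c, rfl⟩ := pp_surj b
      rw [osem_odd, pp_inj, pc_inj] at h2
      obtain ⟨⟨rfl, rfl⟩, rfl⟩ := h2
      rw [osem_hcj, osem_oid] at h1
      exact h1
    · rintro ⟨rfl, h⟩
      exact ⟨_, rfl, pc x' (pp y d), (osem_hcj _ _ _ _ _ _).2 ⟨(osem_oid _ _).2 rfl, h⟩, (osem_odd _ _ _ _).2 rfl⟩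
  constructor
  · rintro ⟨z, h1, h2⟩
    obtain ⟨a, b, rfl⟩ := pp_surj z
    rw [osem_htn, k, osem_oid] at h2
    obtain ⟨⟨rfl, h⟩, rfl⟩ := h2
    exact ⟨h1, h⟩
  · rintro ⟨h1, h2⟩
    exact ⟨pp x g, h1, (osem_htn _ _ _ _ _ _).2 ⟨(k x).2 ⟨rfl, h2⟩, (osem_oid _ _).2 rfl⟩⟩
end
end MPN

namespace MPN
open CategoryTheory MonoidalCategory
variable {P : Type} {Λ : Type}
open Ob OHom

/-- the valuation of a tree induced by a valuation of the labels -/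
def tvl (c : Λ → Prop) : ∀ {X : Ob P}, Tr P Λ X → OV X
  | _, .nil => ou
  | _, .lit _ a => c a
  | _, .nlit _ a => c a
  | _, .conj x y => (tvl c x, tvl c y)
  | _, .ten x y => pp (tvl c x) (tvl c y)

section
variable {X Y G D : Ob P} {T : Tr P Λ X} {S : Tr P Λ Y}

theorem OSt.tvl {e : X ⟶ Y} (h : OSt T S e) (c : Λ → Prop) : ∀ w, osem e (tvl c T) w ↔ w = MPN.tvl c S := by
  induction h with
  | id T => intro w; exact (osem_oid _ _).trans eq_comm
  | comp _ _ h1 h2 =>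
    intro w
    refine (osem_ocomp _ _ _ _).trans ⟨?_, ?_⟩
    · rintro ⟨y, a, b⟩
      obtain rfl := (h1 _).1 a
      exact (h2 _).1 b
    · intro hw
      exact ⟨_, (h1 _).2 rfl, (h2 _).2 hw⟩
  | ten _ _ h1 h2 =>
    intro w
    obtain ⟨a, b, rfl⟩ := pp_surj w
    refine (osem_htn _ _ _ _ _ _).trans ?_
    rw [h1, h2]
    exact pp_inj.symm
  | ass T S R => intro w; exact osem_oass _ _ _ _
  | ass' T S R => intro w; exact osem_oass' _ _ _ _
  | br T S => intro w; exact osem_obr _ _ _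
  | run T => intro w; exact osem_orun _ _
  | run' T => intro w; exact osem_orun' _ _

theorem tvl_congr {c c' : Λ → Prop} (T : Tr P Λ X) (h : ∀ a ∈ pos T + neg T, c a = c' a) : tvl c T = tvl c' T := by
  induction T with
  | nil => rfl
  | lit p a => exact h a (by simp [pos, neg])
  | nlit p a => exact h a (by simp [pos, neg])
  | conj x y h1 h2 =>
    simp only [pos, neg, Multiset.mem_add] at h h1 h2
    exact Prod.ext (h1 fun a ha => h a (by tauto)) (h2 fun a ha => h a (by tauto))
  | ten x y h1 h2 =>
    simp only [pos, neg, Multiset.mem_add] at h h1 h2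
    exact pp_inj.2 ⟨h1 fun a ha => h a (by tauto), h2 fun a ha => h a (by tauto)⟩

theorem tvl_C (c : Λ → Prop) (p : Pr P Λ X Y) : tvl c p.C = pc (tvl c p.L) (tvl c p.R) := by
  cases p <;> rfl

theorem S_ptDel (A : Form P) (x : V (∼A ⋎ A)) : MPN.S (ptDel A) x ↔ (show V A from x.1) = x.2 := by
  obtain ⟨z⟩ := V_ne A
  have h : ∀ q : V ((∼A ⋎ A) ⋏ A), (z = q.2 ∧ MPN.S (ptDel A) q.1) ↔ z = q.2 ∧ (show V A from q.1.1) = q.1.2 := by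
    intro q
    rw [← sem_l (ptDel A) A z q]
    have e : (ptDel A).l A = del A A ≫ cC _ _ := rfl
    rw [e]
    simp only [sem_comp, sem_del, sem_cC]
    constructor
    · rintro ⟨y, ⟨h1, h2⟩, h3, h4⟩
      rw [h4, h3]
      exact ⟨h1.symm, h2⟩
    · rintro ⟨h1, h2⟩
      exact ⟨(q.2, q.1), ⟨h1.symm, h2⟩, rfl, rfl⟩
  have h := h (x, z)
  exact ⟨fun k => (h.1 ⟨rfl, k⟩).2, fun k => (h.2 ⟨rfl, k⟩).2⟩

theorem CF.sound {u : I ⟶ X} (h : CF T u) (c : Λ → Prop) : osem u ou (tvl c T) := by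
  induction h with
  | unit => trivial
  | ax p a => exact (S_ptDel _ _).2 rfl
  | ten p _ _ h1 h2 =>
    have := (osem_tens _ _ _ _ _ _).2 ⟨h1, h2⟩
    rw [← tvl_C] at this
    exact this
  | st _ h ih => exact (osem_ocomp _ _ _ _).2 ⟨_, ih, (h.tvl c _).2 rfl⟩

theorem CF.complete {u : I ⟶ X} (h : CF T u) : ND T → ∀ x, osem u ou x → ∃ c, x = tvl c T := by
  induction h with
  | unit => intro _ x _; exact ⟨fun _ => True, rfl⟩
  | ax p a =>
    intro _ x h
    have h := (S_ptDel (.letter p) x).1 h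
    exact ⟨fun _ => x.2, Prod.ext h rfl⟩
  | @ten X Y G D p TG TD u v h1 h2 i1 i2 =>
    intro hn x hx
    obtain ⟨x, g, rfl⟩ := pp_surj x
    obtain ⟨x, d, rfl⟩ := pp_surj x
    obtain ⟨x, y, rfl⟩ := pc_surj x
    obtain ⟨hu, hv⟩ := (osem_tens _ _ _ _ _ _).1 hx
    have b1 := h1.bal
    have b2 := h2.bal
    simp only [ND, pos, neg, pos_C, neg_C, Multiset.nodup_add] at hn i1 i2
    simp only [Multiset.disjoint_add_left, Multiset.disjoint_add_right] at hn i1 i2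
    obtain ⟨c1, e1⟩ := i1 (by tauto) _ hu
    obtain ⟨c2, e2⟩ := i2 (by tauto) _ hv
    have dj : Disjoint (pos (p.L ⊛ TG)) (pos (p.R ⊛ TD)) := by
      simp only [pos, Multiset.disjoint_add_left, Multiset.disjoint_add_right]
      have := hn.1
      simp only [disjoint_comm] at *
      tauto
    rw [Multiset.disjoint_left] at dj
    classical
    let c : Λ → Prop := fun a => if a ∈ pos (p.L ⊛ TG) then c1 a else c2 a
    have e3 : tvl c1 (p.L ⊛ TG) = tvl c (p.L ⊛ TG) := by
      apply tvl_congr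
      intro a ha
      rw [← b1, Multiset.mem_add, or_self] at ha
      simp only [c, if_pos ha]
    have e4 : tvl c2 (p.R ⊛ TD) = tvl c (p.R ⊛ TD) := by
      apply tvl_congr
      intro a ha
      rw [← b2, Multiset.mem_add, or_self] at ha
      have : a ∉ pos (p.L ⊛ TG) := fun h => dj h ha
      simp only [c, if_neg this]
    rw [e3] at e1
    rw [e4] at e2
    obtain ⟨rfl, rfl⟩ := pp_inj.1 e1
    obtain ⟨rfl, rfl⟩ := pp_inj.1 e2
    refine ⟨c, ?_⟩
    have : tvl c ((p.C ⊛ TD) ⊛ TG) = pp (pp (tvl c p.C) (tvl c TD)) (tvl c TG) := rfl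
    rw [this, tvl_C]
  | st _ h ih =>
    intro hn x hx
    obtain ⟨y, h1, h2⟩ := (osem_ocomp _ _ _ _).1 hx
    obtain ⟨c, rfl⟩ := ih (h.nd.2 hn) y h1
    exact ⟨c, (h.tvl c _).1 h2⟩

theorem tvl_rel {M N : Type} {c : M → Prop} {c' : N → Prop} (T : Tr P Λ X) : ∀ (f : Pos T → M) (g : Pos T → N),
    tvl c (rel T f) = tvl c' (rel T g) → ∀ i, c (f i) = c' (g i) := by
  induction T with
  | nil => intro f g h i; exact i.elim
  | lit p a => intro f g h i; exact h
  | nlit p a => intro f g h i; exact h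
  | conj x y h1 h2 =>
    intro f g h i
    have h := Prod.ext_iff.1 h
    cases i with
    | inl i => exact h1 (fun i => f (.inl i)) (fun i => g (.inl i)) h.1 i
    | inr i => exact h2 (fun i => f (.inr i)) (fun i => g (.inr i)) h.2 i
  | ten x y h1 h2 =>
    intro f g h i
    have h := pp_inj.1 h
    cases i with
    | inl i => exact h1 (fun i => f (.inl i)) (fun i => g (.inl i)) h.1 i
    | inr i => exact h2 (fun i => f (.inr i)) (fun i => g (.inr i)) h.2 i

theorem CF.faithful {u v : I ⟶ X} (hu : CF T u) (hv : CF T v) (h : ∀ x, osem u ou x ↔ osem v ou x) : u = v := by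
  obtain ⟨f, a1, b1⟩ := hu.lift
  obtain ⟨g, a2, b2⟩ := hv.lift
  refine rel_thin a1 a2 b2 ?_
  intro i j hij
  obtain ⟨c, hc⟩ := a1.complete b1 _ ((h _).2 (a2.sound (fun n => n = g j)))
  have h := tvl_rel T _ _ hc
  have h1 := h i
  have h2 := h j
  rw [hij, ← h2] at h1
  simpa using h1
end
end MPN

namespace MPN
open CategoryTheory MonoidalCategory
variable {P : Type} {Λ : Type}
open Ob OHom

/-! ### From split equivalences to the relational model -/

/-- compatibility of a pair of valuations with a split relation -/
def Cmp (R : GRel) (a b : ℕ → Prop) : Prop := ∀ u v, R u v → Sum.elim a b u = Sum.elim a b v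

def agree (n : ℕ) (a b : ℕ → Prop) : Prop := ∀ i, i < n → a i = b i

def cat (m : ℕ) (a b : ℕ → Prop) : ℕ → Prop := fun i => if i < m then a i else b (i - m)

def Supp (m n : ℕ) (R : GRel) : Prop := ∀ u v, R u v →
  Sum.elim (· < m) (· < n) u ∧ Sum.elim (· < m) (· < n) v

theorem cat_lt {m i : ℕ} (h : i < m) (a b) : cat m a b i = a i := if_pos h
theorem cat_add (m i : ℕ) (a b) : cat m a b (m + i) = b i := by simp [cat]
theorem cat_add' (m i : ℕ) (a b) : cat m a b (i + m) = b i := by simp [cat]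
theorem agree_add {m n : ℕ} {a b} : agree (m + n) a b ↔ agree m a b ∧ ∀ i, i < n → a (m + i) = b (m + i) := by
  constructor
  · intro h
    exact ⟨fun i hi => h i (by omega), fun i hi => h _ (by omega)⟩
  · rintro ⟨h1, h2⟩ i hi
    by_cases hm : i < m
    · exact h1 i hm
    · have := h2 (i - m) (by omega)
      rwa [show m + (i - m) = i by omega] at this
theorem agree_cat {m n : ℕ} {a b a' b'} : agree (m + n) (cat m a b) (cat m a' b') ↔ agree m a a' ∧ agree n b b' := by
  rw [agree_add]
  simp only [cat_add]
  refine and_congr_left' ?_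
  exact ⟨fun h i hi => by have := h i hi; rwa [cat_lt hi, cat_lt hi] at this, fun h i hi => by rw [cat_lt hi, cat_lt hi]; exact h i hi⟩
theorem cat_assoc (m n : ℕ) (a b c) : cat (m + n) (cat m a b) c = cat m a (cat n b c) := by
  funext i
  simp only [cat]
  split_ifs <;> first | rfl | omega | (congr 1; omega)
theorem agree_comm {n a b} : agree n a b ↔ agree n b a := ⟨fun h i hi => (h i hi).symm, fun h i hi => (h i hi).symm⟩
theorem agree_cat_l {m : ℕ} {a b} : agree m (cat m a b) a := fun _ hi => cat_lt hi _ _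

theorem Cmp_gFun {m φ a b} : Cmp (gFun m φ) a b ↔ ∀ i, i < m → a i = b (φ i) := by
  constructor
  · intro h i hi
    exact h (.inl i) (.inr (φ i)) ⟨i, hi, .inl rfl, .inr rfl⟩
  · rintro h u v ⟨i, hi, rfl | rfl, rfl | rfl⟩ <;> simp [h i hi]
theorem Cmp_gId {m a b} : Cmp (gId m) a b ↔ agree m a b := Cmp_gFun (φ := fun i => i)
theorem Cmp_gSwap {m n a b a' b'} : Cmp (gSwap m n) (cat m a b) (cat n b' a') ↔ agree m a a' ∧ agree n b b' := by
  rw [gSwap, Cmp_gFun]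
  constructor
  · intro h
    constructor
    · intro i hi
      have := h i (by omega)
      rwa [if_pos hi, cat_lt hi, cat_add'] at this
    · intro i hi
      have := h (m + i) (by omega)
      rwa [if_neg (by omega), cat_add, show m + i - m = i by omega, cat_lt hi] at this
  · rintro ⟨h1, h2⟩ i hi
    by_cases hm : i < m
    · rw [if_pos hm, cat_lt hm, cat_add']; exact h1 i hm
    · rw [if_neg hm, cat_lt (by omega : i - m < n)]
      obtain ⟨j, rfl⟩ : ∃ j, i = m + j := ⟨i - m, by omega⟩
      rw [cat_add, show m + j - m = j by omega]; exact h2 j (by omega)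
theorem Cmp_gDelta {m n x y b c} : Cmp (gDelta m n) x (cat m y (cat n b c)) ↔ agree m y x ∧ agree n b c := by
  have e1 : ∀ i, cat m y (cat n b c) (m + n + i) = c i := by
    intro i; rw [add_assoc, cat_add, cat_add]
  have e2 : ∀ i, i < n → cat m y (cat n b c) (m + i) = b i := by
    intro i hi; rw [cat_add, cat_lt hi]
  constructor
  · intro h
    constructor
    · intro i hi
      have := h (.inr i) (.inl i) (.inl ⟨i, hi, .inr rfl, .inl rfl⟩)
      simpa [cat_lt hi] using this
    · intro i hi
      have := h (.inr (m + i)) (.inr (m + n + i)) (.inr ⟨i, hi, .inl rfl, .inr rfl⟩)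
      simpa [e1, e2 i hi] using this
  · rintro ⟨h1, h2⟩ u v (⟨i, hi, rfl | rfl, rfl | rfl⟩ | ⟨i, hi, rfl | rfl, rfl | rfl⟩)
    all_goals simp [e1, e2 i, cat_lt, hi, h1 i, h2 i]
theorem Cmp_gSigma {m n x y b c} : Cmp (gSigma m n) (cat (n + n) (cat n b c) x) y ↔ agree n b c ∧ agree m x y := by
  have e1 : ∀ i, cat (n + n) (cat n b c) x (2 * n + i) = x i := by
    intro i; rw [two_mul, cat_add]
  have e2 : ∀ i, i < n → cat (n + n) (cat n b c) x (n + i) = c i := by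
    intro i hi; rw [cat_lt (by omega), cat_add]
  have e3 : ∀ i, i < n → cat (n + n) (cat n b c) x i = b i := by
    intro i hi; rw [cat_lt (by omega), cat_lt hi]
  constructor
  · intro h
    constructor
    · intro i hi
      have := h (.inl i) (.inl (n + i)) (.inr ⟨i, hi, .inl rfl, .inr rfl⟩)
      simpa [e2 i hi, e3 i hi] using this
    · intro i hi
      have := h (.inl (2 * n + i)) (.inr i) (.inl ⟨i, hi, .inl rfl, .inr rfl⟩)
      simpa [e1] using this
  · rintro ⟨h1, h2⟩ u v (⟨i, hi, rfl | rfl, rfl | rfl⟩ | ⟨i, hi, rfl | rfl, rfl | rfl⟩)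
    all_goals first | (simp [e1, hi, h2 i]; done) | simp [e2 i, e3 i, hi, h1 i]
theorem Cmp.congr {m n R a b a' b'} (hs : Supp m n R) (h1 : agree m a a') (h2 : agree n b b') : Cmp R a b → Cmp R a' b' := by
  intro h u v huv
  obtain ⟨su, sv⟩ := hs u v huv
  have k : ∀ u : ℕ ⊕ ℕ, Sum.elim (· < m) (· < n) u → Sum.elim a b u = Sum.elim a' b' u := by
    rintro (u | u) hu
    · exact h1 u hu
    · exact h2 u hu
  rw [← k u su, ← k v sv]; exact h u v huv
theorem Cmp_gPar {m n R S a b c d} (hs : Supp m n R) :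
    Cmp (gPar m n R S) (cat m a b) (cat n c d) ↔ Cmp R a c ∧ Cmp S b d := by
  have k : ∀ u : ℕ ⊕ ℕ, Sum.elim (cat m a b) (cat n c d) (Sum.map (· + m) (· + n) u) = Sum.elim b d u := by
    rintro (u | u)
    · exact cat_add' _ _ _ _
    · exact cat_add' _ _ _ _
  constructor
  · intro h
    constructor
    · exact Cmp.congr hs agree_cat_l agree_cat_l fun u v huv => h u v (.inl huv)
    · intro u v huv
      rw [← k u, ← k v]
      exact h _ _ (.inr ⟨u, v, huv, rfl, rfl⟩)
  · rintro ⟨h1, h2⟩ u v (huv | ⟨u, v, huv, rfl, rfl⟩)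
    · exact Cmp.congr hs (agree_comm.1 agree_cat_l) (agree_comm.1 agree_cat_l) h1 u v huv
    · rw [k, k]; exact h2 u v huv

def gStep (Q R : GRel) : ℕ ⊕ ℕ ⊕ ℕ → ℕ ⊕ ℕ ⊕ ℕ → Prop := fun x y =>
      (∃ x' y', Sum.map id Sum.inl x' = x ∧ Sum.map id Sum.inl y' = y ∧ R x' y') ∨
      (∃ x' y', Sum.inr x' = x ∧ Sum.inr y' = y ∧ Q x' y')

theorem gComp_eq (Q R : GRel) (u v) : gComp Q R u v ↔
    Relation.TransGen (gStep Q R) (Sum.map id Sum.inr u) (Sum.map id Sum.inr v) := Iff.rfl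

theorem gStep_symm {Q R : GRel} (hQ : ∀ u v, Q u v → Q v u) (hR : ∀ u v, R u v → R v u) {x y}
    (h : gStep Q R x y) : gStep Q R y x := by
  rcases h with ⟨x', y', h1, h2, h3⟩ | ⟨x', y', h1, h2, h3⟩
  · exact .inl ⟨_, _, h2, h1, hR _ _ h3⟩
  · exact .inr ⟨_, _, h2, h1, hQ _ _ h3⟩
theorem gComp_symm {Q R : GRel} (hQ : ∀ u v, Q u v → Q v u) (hR : ∀ u v, R u v → R v u) (u v)
    (h : gComp Q R u v) : gComp Q R v u := by
  rw [gComp_eq] at h ⊢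
  generalize Sum.map id Sum.inr u = x at *
  generalize Sum.map id Sum.inr v = y at *
  induction h with
  | single h => exact .single (gStep_symm hQ hR h)
  | tail _ h ih => exact .head (gStep_symm hQ hR h) ih

theorem gStep_val {Q R : GRel} {a b c : ℕ → Prop} (h1 : Cmp R a b) (h2 : Cmp Q b c) {x y} (h : gStep Q R x y) :
    Sum.elim a (Sum.elim b c) x = Sum.elim a (Sum.elim b c) y := by
  rcases h with ⟨x', y', rfl, rfl, h3⟩ | ⟨x', y', rfl, rfl, h3⟩
  · have := h1 _ _ h3
    cases x' <;> cases y' <;> exact this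
  · exact h2 _ _ h3

theorem Cmp_gComp {Q R : GRel} (hQ : ∀ u v, Q u v → Q v u) (hR : ∀ u v, R u v → R v u) {a c} :
    Cmp (gComp Q R) a c ↔ ∃ b, Cmp R a b ∧ Cmp Q b c := by
  constructor
  · intro h
    let E : ℕ ⊕ ℕ ⊕ ℕ → Prop := fun z =>
      ∃ u, Relation.TransGen (gStep Q R) z (Sum.map id Sum.inr u) ∧ Sum.elim a c u
    have hE : ∀ {x y}, gStep Q R x y → E x = E y := by
      intro x y hxy
      apply propext
      constructor
      · rintro ⟨u, h1, h2⟩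
        exact ⟨u, .head (gStep_symm hQ hR hxy) h1, h2⟩
      · rintro ⟨u, h1, h2⟩
        exact ⟨u, .head hxy h1, h2⟩
    have hO : ∀ {u y}, gStep Q R (Sum.map id Sum.inr u) y → Sum.elim a c u = E (Sum.map id Sum.inr u) := by
      intro u y hu
      apply propext
      constructor
      · intro k
        exact ⟨u, .head hu (.single (gStep_symm hQ hR hu)), k⟩
      · rintro ⟨w, h1, h2⟩
        have := h u w h1
        rw [this]; exact h2
    let b : ℕ → Prop := fun k => E (.inr (.inl k))
    have hv : ∀ {x y}, gStep Q R x y → Sum.elim a (Sum.elim b c) x = E x := by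
      rintro (i | k | j) y hxy
      · exact hO (u := .inl i) hxy
      · rfl
      · exact hO (u := .inr j) hxy
    have hv2 : ∀ {x y}, gStep Q R x y → Sum.elim a (Sum.elim b c) x = Sum.elim a (Sum.elim b c) y := by
      intro x y hxy
      rw [hv hxy, hv (gStep_symm hQ hR hxy), hE hxy]
    refine ⟨b, ?_, ?_⟩
    · intro u v huv
      have := hv2 (.inl ⟨u, v, rfl, rfl, huv⟩)
      cases u <;> cases v <;> exact this
    · intro u v huv
      exact hv2 (.inr ⟨u, v, rfl, rfl, huv⟩)
  · rintro ⟨b, h1, h2⟩ u v huv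
    have k : ∀ {x y}, Relation.TransGen (gStep Q R) x y →
        Sum.elim a (Sum.elim b c) x = Sum.elim a (Sum.elim b c) y := by
      intro x y hxy
      induction hxy with
      | single h => exact gStep_val h1 h2 h
      | tail _ h ih => exact ih.trans (gStep_val h1 h2 h)
    have := k huv
    cases u <;> cases v <;> exact this

theorem Supp_gFun {m n φ} (h : ∀ i, i < m → φ i < n) : Supp m n (gFun m φ) := by
  rintro u v ⟨i, hi, rfl | rfl, rfl | rfl⟩ <;> simp [hi, h i hi]
theorem gFun_symm {m φ} (u v) : gFun m φ u v → gFun m φ v u := fun ⟨i, h, a, b⟩ => ⟨i, h, b, a⟩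
theorem Supp_gId {m n n'} (h : m = n) (h' : m = n') : Supp n n' (gId m) := by
  subst h; subst h'; exact Supp_gFun (φ := fun i => i) fun i hi => hi
theorem gId_symm {m} (u v) : gId m u v → gId m v u := gFun_symm (φ := fun i => i) u v

theorem Supp_gComp {m n k Q R} (hR : Supp m n R) (hQ : Supp n k Q) : Supp m k (gComp Q R) := by
  let B : ℕ ⊕ ℕ ⊕ ℕ → Prop := Sum.elim (· < m) (Sum.elim (· < n) (· < k))
  have s : ∀ {x y}, gStep Q R x y → B x ∧ B y := by
    rintro x y (⟨u, v, rfl, rfl, h⟩ | ⟨u, v, rfl, rfl, h⟩)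
    · have := hR u v h
      cases u <;> cases v <;> exact this
    · exact hQ u v h
  have t : ∀ {x y}, Relation.TransGen (gStep Q R) x y → B x ∧ B y := by
    intro x y h
    induction h with
    | single h => exact s h
    | tail _ h ih => exact ⟨ih.1, (s h).2⟩
  intro u v h
  have := t h
  cases u <;> cases v <;> exact this

theorem Supp_gPar {m n m' n' R S} (hR : Supp m n R) (hS : Supp m' n' S) : Supp (m + m') (n + n') (gPar m n R S) := by
  rintro u v (h | ⟨u, v, h, rfl, rfl⟩)
  · have := hR u v h
    cases u <;> cases v <;> simp at this ⊢ <;> omega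
  · have := hS u v h
    cases u <;> cases v <;> simp at this ⊢ <;> omega
theorem gPar_symm {m n R S} (hR : ∀ u v, R u v → R v u) (hS : ∀ u v, S u v → S v u) (u v) :
    gPar m n R S u v → gPar m n R S v u := by
  rintro (h | ⟨u, v, h, h1, h2⟩)
  · exact .inl (hR _ _ h)
  · exact .inr ⟨v, u, hS _ _ h, h2, h1⟩

theorem G_symm {A B : Form P} (f : Term P A B) : ∀ u v, Term.G f u v → Term.G f v u := by
  induction f with
  | comp g f h1 h2 => exact gComp_symm h1 h2
  | conj f g h1 h2 => exact gPar_symm h1 h2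
  | disj f g h1 h2 => exact gPar_symm h1 h2
  | cConj => exact gFun_symm
  | cDisj => exact gFun_symm
  | delta =>
    rintro u v (⟨i, h, a, b⟩ | ⟨i, h, a, b⟩)
    · exact .inl ⟨i, h, b, a⟩
    · exact .inr ⟨i, h, b, a⟩
  | sigma =>
    rintro u v (⟨i, h, a, b⟩ | ⟨i, h, a, b⟩)
    · exact .inl ⟨i, h, b, a⟩
    · exact .inr ⟨i, h, b, a⟩
  | _ => exact gId_symm

theorem Supp_gSwap (m n : ℕ) : Supp (m + n) (n + m) (gSwap m n) := by
  have := Supp_gFun (m := m + n) (n := n + m) (φ := fun i => if i < m then i + n else i - m) (by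
    intro i hi
    split_ifs <;> omega)
  exact this

theorem G_supp {A B : Form P} (f : Term P A B) : Supp A.size B.size (Term.G f) := by
  induction f with
  | comp g f h1 h2 => exact Supp_gComp h2 h1
  | conj f g h1 h2 => exact Supp_gPar h1 h2
  | disj f g h1 h2 => exact Supp_gPar h1 h2
  | cConj => exact Supp_gSwap _ _
  | cDisj => exact Supp_gSwap _ _
  | delta =>
    rintro u v (⟨i, hi, rfl | rfl, rfl | rfl⟩ | ⟨i, hi, rfl | rfl, rfl | rfl⟩) <;> simp [Form.size] <;> omega
  | sigma =>
    rintro u v (⟨i, hi, rfl | rfl, rfl | rfl⟩ | ⟨i, hi, rfl | rfl, rfl | rfl⟩) <;> simp [Form.size] <;> omega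
  | _ => exact Supp_gId (by simp [Form.size, add_assoc]) (by simp [Form.size, add_assoc])

def val : ∀ {A : Form P}, V A → ℕ → Prop
  | .letter _, x => fun _ => x
  | .neg A, x => val (A := A) x
  | .conj A _, x => cat A.size (val x.1) (val x.2)
  | .disj A _, x => cat A.size (val x.1) (val x.2)

section
variable {A B C D : Form P}
theorem val_conj (x : V (A ⋏ B)) : val x = cat A.size (val x.1) (val x.2) := rfl
theorem val_disj (x : V (A ⋎ B)) : val x = cat A.size (val x.1) (val x.2) := rfl
theorem val_neg (x : V (∼A)) : val x = val (A := A) x := rfl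

theorem val_inj : ∀ {A : Form P} {x y : V A}, agree A.size (val x) (val y) ↔ x = y
  | .letter _, x, y => ⟨fun h => h 0 Nat.one_pos, fun h i _ => h⟩
  | .neg A, x, y => val_inj (A := A)
  | .conj A B, x, y => by
    rw [val_conj, val_conj, eq_conj, ← val_inj, ← val_inj]; exact agree_cat
  | .disj A B, x, y => by
    rw [val_disj, val_disj, eq_disj, ← val_inj, ← val_inj]; exact agree_cat
theorem val_surj : ∀ (A : Form P) (b : ℕ → Prop), ∃ x : V A, agree A.size b (val x)
  | .letter _, b => ⟨b 0, fun i hi => by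
      have : i = 0 := by simp [Form.size] at hi; exact hi
      subst this; rfl⟩
  | .neg A, b => val_surj A b
  | .conj A B, b => by
    obtain ⟨x, hx⟩ := val_surj A b
    obtain ⟨y, hy⟩ := val_surj B (fun i => b (A.size + i))
    refine ⟨(x, y), ?_⟩
    change agree (A.size + B.size) b (cat A.size (val x) (val y))
    refine agree_add.2 ⟨fun i hi => ?_, fun i hi => ?_⟩
    · rw [cat_lt hi]; exact hx i hi
    · rw [cat_add]; exact hy i hi
  | .disj A B, b => by
    obtain ⟨x, hx⟩ := val_surj A b
    obtain ⟨y, hy⟩ := val_surj B (fun i => b (A.size + i))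
    refine ⟨(x, y), ?_⟩
    change agree (A.size + B.size) b (cat A.size (val x) (val y))
    refine agree_add.2 ⟨fun i hi => ?_, fun i hi => ?_⟩
    · rw [cat_lt hi]; exact hx i hi
    · rw [cat_add]; exact hy i hi

theorem tsem_iff (f : Term P A B) : ∀ x y, tsem f x y ↔ Cmp (Term.G f) (val x) (val y) := by
  induction f with
  | id A => intro x y; exact (Cmp_gId.trans val_inj).symm
  | @comp A B C g f h1 h2 =>
    intro x y
    refine Iff.trans ?_ (Cmp_gComp (G_symm g) (G_symm f)).symm
    constructor
    · rintro ⟨z, a, b⟩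
      exact ⟨val z, (h2 _ _).1 a, (h1 _ _).1 b⟩
    · rintro ⟨b, k1, k2⟩
      obtain ⟨z, hz⟩ := val_surj B b
      exact ⟨z, (h2 _ _).2 (k1.congr (G_supp f) (fun _ _ => rfl) hz),
        (h1 _ _).2 (k2.congr (G_supp g) hz (fun _ _ => rfl))⟩
  | conj f g h1 h2 =>
    intro x y
    exact (and_congr (h1 _ _) (h2 _ _)).trans (Cmp_gPar (G_supp f)).symm
  | disj f g h1 h2 =>
    intro x y
    exact (and_congr (h1 _ _) (h2 _ _)).trans (Cmp_gPar (G_supp f)).symm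
  | bConjTo A B C =>
    intro x y
    refine Iff.trans ?_ Cmp_gId.symm
    have e : val y = cat A.size (val y.1.1) (cat B.size (val y.1.2) (val y.2)) := cat_assoc _ _ _ _ _
    have e' : val x = cat A.size (val x.1) (cat B.size (val x.2.1) (val x.2.2)) := rfl
    rw [e, e', agree_cat, agree_cat, agree_comm, agree_comm (n := B.size), agree_comm (n := C.size), val_inj, val_inj, val_inj]
    exact Iff.rfl
  | bDisjTo A B C =>
    intro x y
    refine Iff.trans ?_ Cmp_gId.symm
    have e : val y = cat A.size (val y.1.1) (cat B.size (val y.1.2) (val y.2)) := cat_assoc _ _ _ _ _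
    have e' : val x = cat A.size (val x.1) (cat B.size (val x.2.1) (val x.2.2)) := rfl
    rw [e, e', agree_cat, agree_cat, agree_comm, agree_comm (n := B.size), agree_comm (n := C.size), val_inj, val_inj, val_inj]
    exact Iff.rfl
  | d A B C =>
    intro x y
    refine Iff.trans ?_ Cmp_gId.symm
    have e : val y = cat A.size (val y.1.1) (cat B.size (val y.1.2) (val y.2)) := cat_assoc _ _ _ _ _
    have e' : val x = cat A.size (val x.1) (cat B.size (val x.2.1) (val x.2.2)) := rfl
    rw [e, e', agree_cat, agree_cat, agree_comm, agree_comm (n := B.size), agree_comm (n := C.size), val_inj, val_inj, val_inj]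
    exact Iff.rfl
  | bConjFrom A B C =>
    intro x y
    refine Iff.trans ?_ Cmp_gId.symm
    have e : val x = cat A.size (val x.1.1) (cat B.size (val x.1.2) (val x.2)) := cat_assoc _ _ _ _ _
    have e' : val y = cat A.size (val y.1) (cat B.size (val y.2.1) (val y.2.2)) := rfl
    rw [e, e', add_assoc, agree_cat, agree_cat, agree_comm, agree_comm (n := B.size), agree_comm (n := C.size), val_inj, val_inj, val_inj]
    exact Iff.rfl
  | bDisjFrom A B C =>
    intro x y
    refine Iff.trans ?_ Cmp_gId.symm
    have e : val x = cat A.size (val x.1.1) (cat B.size (val x.1.2) (val x.2)) := cat_assoc _ _ _ _ _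
    have e' : val y = cat A.size (val y.1) (cat B.size (val y.2.1) (val y.2.2)) := rfl
    rw [e, e', add_assoc, agree_cat, agree_cat, agree_comm, agree_comm (n := B.size), agree_comm (n := C.size), val_inj, val_inj, val_inj]
    exact Iff.rfl
  | cConj A B =>
    intro x y
    refine Iff.trans ?_ Cmp_gSwap.symm
    rw [val_inj, val_inj]
    exact ⟨fun h => ⟨h.2.symm, h.1.symm⟩, fun h => ⟨h.2.symm, h.1.symm⟩⟩
  | cDisj A B =>
    intro x y
    refine Iff.trans ?_ Cmp_gSwap.symm
    rw [val_inj, val_inj]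
    exact ⟨fun h => ⟨h.2.symm, h.1.symm⟩, fun h => ⟨h.2.symm, h.1.symm⟩⟩
  | mix A B =>
    intro x y
    refine Iff.trans ?_ Cmp_gId.symm
    rw [val_conj, val_disj, agree_cat, val_inj, val_inj]
    exact ⟨fun h => ⟨h.1.symm, h.2.symm⟩, fun h => ⟨h.1.symm, h.2.symm⟩⟩
  | delta B A =>
    intro x y
    refine Iff.trans ?_ Cmp_gDelta.symm
    exact and_congr val_inj.symm (val_inj (A := B)).symm
  | sigma B A =>
    intro x y
    refine Iff.trans ?_ Cmp_gSigma.symm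
    exact and_congr (val_inj (A := B)).symm val_inj.symm

theorem sem_of_G {f g : Term P A B} (h : Term.G f = Term.G g) : sem (tm f) = sem (tm g) := by
  funext x y
  apply propext
  rw [sem_tm, sem_tm, tsem_iff, tsem_iff, h]

theorem osem_pnt {f g : A ⟶ B} (h : sem f = sem g) : osem (pnt f) = osem (pnt g) := by
  have c : ∀ {X Y Z : Ob P} (p : OHom X Y) {q q' : OHom Y Z}, osem q = osem q' → osem (ocomp p q) = osem (ocomp p q') := by
    intro X Y Z p q q' e
    funext x y
    apply propext
    rw [osem_ocomp, osem_ocomp, e]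
  have d : ∀ {X Y Z : Ob P} {p p' : OHom X Y} (q : OHom Y Z), osem p = osem p' → osem (ocomp p q) = osem (ocomp p' q) := by
    intro X Y Z p p' q e
    funext x y
    apply propext
    rw [osem_ocomp, osem_ocomp, e]
  have t : ∀ {X Y Z : Ob P} {p p' : OHom X Y}, osem p = osem p' → osem (htn (oid Z) p) = osem (htn (oid Z) p') := by
    intro X Y Z p p' e
    funext x y
    obtain ⟨x, x', rfl⟩ := pp_surj x
    obtain ⟨y, y', rfl⟩ := pp_surj y
    apply propext
    rw [osem_htn, osem_htn, e]
  have e : osem (OHom.ar f) = osem (OHom.ar g) := h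
  exact c _ (t (c _ (d _ e)))
end
end MPN

open MPN in
theorem MPNneg_coherence_aux {P : Type} {A B : Form P} (f g : Term P A B) :
    Term.G f = Term.G g → Eqv f g := by
  intro h
  apply tm_eq.1
  apply pnt_inj
  refine CF.faithful (pnt_CF (tm f)) (pnt_CF (tm g)) fun x => ?_
  rw [osem_pnt (sem_of_G h)]

/-- **MPN¬ Coherence**: the functor `G` from MPN¬ to Br is faithful; that is, for all
arrow terms `f, g : A ⊢ B` of MPN¬, if `Gf = Gg` in Br then `f = g` in MPN¬. -/
theorem MPNneg_coherence {P : Type} {A B : Form P} (f g : Term P A B) :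
    Term.G f = Term.G g → Eqv f g := by
  exact MPNneg_coherence_aux f g
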